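/- arXiv:2006.01421 — 6 statements merged into one kernel-verified Lean document; each statement's English description precedes it below -/
import Mathlib

section
/- Let G be a finite group such that every proper quotient of G is cyclic. Then one of the following holds: (i) G is cyclic, and s(G) ≥ k and u(G) ≥ k for every integer k ≥ 0; (ii) G is isomorphic to C_p × C_p for a prime p, and s(G) = p and u(G) = 0; (iii) G is nonabelian and has a unique minimal normal subgroup. -/
/-- `SpreadGE G k` means: for any `k` nontrivial elements `x₁, …, x_k` of `G`
there exists `y ∈ G` with `G = ⟨x_i, y⟩` for all `i`. -/
def SpreadGE (G : Type*) [Group G] (k : ℕ) : Prop :=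
  ∀ x : Fin k → G, (∀ i, x i ≠ 1) →
    ∃ y : G, ∀ i, Subgroup.closure {x i, y} = ⊤

/-- `UniformSpreadGE G k` means some conjugacy class (of an element `c`)
witnesses `u(G) ≥ k`. -/
def UniformSpreadGE (G : Type*) [Group G] (k : ℕ) : Prop :=
  ∃ c : G, ∀ x : Fin k → G, (∀ i, x i ≠ 1) →
    ∃ y : G, IsConj c y ∧ ∀ i, Subgroup.closure {x i, y} = ⊤

/-- A minimal normal subgroup: nontrivial, normal, containing no nontrivial
normal subgroup of the ambient group properly inside it. -/
def IsMinimalNormalSubgroup {G : Type*} [Group G] (N : Subgroup G) : Prop :=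
  N.Normal ∧ N ≠ ⊥ ∧ ∀ M : Subgroup G, M.Normal → M ≠ ⊥ → M ≤ N → M = N

theorem mem_of_zpow_mem_of_pow_prime_eq_one {G : Type*} [Group G] {H : Subgroup G} {x : G}
    {p : ℕ} (hp : p.Prime) (hx : x ^ p = 1) {i : ℤ} (hi : x ^ i ∈ H) (hpi : ¬ (p : ℤ) ∣ i) :
    x ∈ H := by
  obtain ⟨a, b, hab⟩ : IsCoprime (p : ℤ) i :=
    (Nat.prime_iff_prime_int.mp hp).coprime_iff_not_dvd.mpr hpi
  have h : x = (x ^ i) ^ b := by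
    calc x = x ^ (a * p + b * i) := by rw [hab, zpow_one]
      _ = (x ^ i) ^ b := by
        rw [zpow_add, mul_comm a, zpow_mul, zpow_natCast, hx, one_zpow, one_mul, mul_comm b,
          zpow_mul]
  rw [h]
  exact H.zpow_mem hi b

theorem isCyclic_of_zpowers_eq_top {G : Type*} [Group G] {g : G}
    (h : Subgroup.zpowers g = ⊤) : IsCyclic G :=
  isCyclic_iff_exists_zpowers_eq_top.mpr ⟨g, h⟩

theorem nontrivial_of_not_isCyclic {G : Type*} [Group G] (hG : ¬ IsCyclic G) : Nontrivial G := by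
  by_contra h
  rw [not_nontrivial_iff_subsingleton] at h
  exact hG inferInstance

theorem isCyclic_of_pow_prime_ne_one {G : Type*} [CommGroup G]
    (hq : ∀ N : Subgroup G, N ≠ ⊥ → IsCyclic (G ⧸ N)) {p : ℕ} (hp : p.Prime) {x g : G}
    (hx : x ^ p = 1) (hxg : Subgroup.closure {x, g} = ⊤) (hg : g ^ p ≠ 1) : IsCyclic G := by
  have key : ∀ u : G, x ∈ Subgroup.zpowers u → g ∈ Subgroup.zpowers u → IsCyclic G := by
    intro u h₁ h₂
    refine isCyclic_of_zpowers_eq_top (g := u) (top_le_iff.mp ?_)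
    rw [← hxg, Subgroup.closure_le]
    rintro y (rfl | rfl)
    exacts [h₁, h₂]
  have hle : ∀ u : G, u ^ p = g ^ p → Subgroup.zpowers (g ^ p) ≤ Subgroup.zpowers u := by
    intro u hu
    rw [Subgroup.zpowers_le, ← hu]
    exact Subgroup.npow_mem_zpowers u p
  by_cases hxN : x ∈ Subgroup.zpowers (g ^ p)
  · exact key g (hle g rfl hxN) (Subgroup.mem_zpowers g)
  obtain ⟨q, hqgen⟩ := (hq (Subgroup.zpowers (g ^ p)) (by simpa using hg)).exists_generator
  have hqp : q ^ p = 1 := by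
    obtain ⟨h, rfl⟩ := QuotientGroup.mk_surjective q
    have hh : h ∈ Subgroup.closure {x, g} := hxg ▸ Subgroup.mem_top h
    obtain ⟨m, n, rfl⟩ := Subgroup.mem_closure_pair.mp hh
    rw [← QuotientGroup.mk_pow, QuotientGroup.eq_one_iff, mul_pow]
    have h₁ : (x ^ m) ^ p = 1 := by
      rw [← zpow_natCast, zpow_comm, zpow_natCast, hx, one_zpow]
    have h₂ : (g ^ n) ^ p = (g ^ p) ^ n := by
      rw [← zpow_natCast, zpow_comm, zpow_natCast]
    rw [h₁, h₂, one_mul]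
    exact Subgroup.zpow_mem_zpowers _ _
  obtain ⟨t, ht⟩ := Subgroup.mem_zpowers_iff.mp (hqgen (x : G ⧸ Subgroup.zpowers (g ^ p)))
  have hpt : ¬ (p : ℤ) ∣ t := by
    rintro ⟨s, rfl⟩
    rw [zpow_mul, zpow_natCast, hqp, one_zpow] at ht
    exact hxN ((QuotientGroup.eq_one_iff x).mp ht.symm)
  have hqx : q ∈ Subgroup.zpowers (x : G ⧸ Subgroup.zpowers (g ^ p)) :=
    mem_of_zpow_mem_of_pow_prime_eq_one hp hqp (ht ▸ Subgroup.mem_zpowers _) hpt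
  obtain ⟨i, hi⟩ := Subgroup.mem_zpowers_iff.mp
    ((Subgroup.zpowers_le.mpr hqx) (hqgen (g : G ⧸ Subgroup.zpowers (g ^ p))))
  rw [← QuotientGroup.mk_zpow, QuotientGroup.eq] at hi
  have hfin : ∀ j : ℤ, ¬ (p : ℤ) ∣ i + j → IsCyclic G := by
    intro j hj
    have hu : (g * x ^ j) ^ p = g ^ p := by
      rw [mul_pow, ← zpow_natCast (x ^ j), zpow_comm, zpow_natCast, hx, one_zpow, mul_one]
    have hxu : x ∈ Subgroup.zpowers (g * x ^ j) := by
      refine mem_of_zpow_mem_of_pow_prime_eq_one hp hx ?_ hj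
      have := mul_mem (inv_mem (hle _ hu hi)) (Subgroup.mem_zpowers (g * x ^ j))
      rwa [mul_inv, inv_inv, mul_assoc, inv_mul_cancel_left, ← zpow_add] at this
    refine key _ hxu ?_
    have := mul_mem (Subgroup.mem_zpowers (g * x ^ j)) (zpow_mem hxu (-j))
    simpa using this
  by_cases h0 : (p : ℤ) ∣ i
  · refine hfin 1 fun h1 => ?_
    have := (Int.dvd_add_right h0).mp h1
    have := Int.eq_one_of_dvd_one (by positivity) this
    exact hp.one_lt.ne' (by exact_mod_cast this)
  · exact hfin 0 (by simpa using h0)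

theorem exists_prime_card_eq_sq {G : Type*} [CommGroup G] [Finite G]
    (hq : ∀ N : Subgroup G, N ≠ ⊥ → IsCyclic (G ⧸ N)) (hG : ¬ IsCyclic G) :
    ∃ p : ℕ, p.Prime ∧ Nat.card G = p ^ 2 ∧ ∀ g : G, g ^ p = 1 := by
  have := nontrivial_of_not_isCyclic hG
  obtain ⟨p, hp, hpG⟩ := Nat.exists_prime_and_dvd (Finite.one_lt_card (α := G)).ne'
  have := Fact.mk hp
  obtain ⟨x, hx⟩ := exists_prime_orderOf_dvd_card' p hpG
  have hx1 : x ^ p = 1 := hx ▸ pow_orderOf_eq_one x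
  have hxb : Subgroup.zpowers x ≠ ⊥ := by
    rw [Ne, Subgroup.zpowers_eq_bot, ← orderOf_eq_one_iff, hx]
    exact hp.ne_one
  obtain ⟨q, hqgen⟩ := (hq _ hxb).exists_generator
  obtain ⟨g, rfl⟩ := QuotientGroup.mk_surjective q
  have hxg : Subgroup.closure {x, g} = ⊤ := by
    refine top_le_iff.mp fun h _ => ?_
    obtain ⟨n, hn⟩ := Subgroup.mem_zpowers_iff.mp (hqgen (h : G ⧸ Subgroup.zpowers x))
    rw [← QuotientGroup.mk_zpow, QuotientGroup.eq] at hn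
    obtain ⟨m, hm⟩ := Subgroup.mem_zpowers_iff.mp hn
    refine Subgroup.mem_closure_pair.mpr ⟨m, n, ?_⟩
    rw [hm, mul_comm, mul_inv_cancel_left]
  have hg : g ^ p = 1 := by
    by_contra h
    exact hG (isCyclic_of_pow_prime_ne_one hq hp hx1 hxg h)
  refine ⟨p, hp, ?_, fun h => ?_⟩
  · have hcard := Subgroup.card_eq_card_quotient_mul_card_subgroup (Subgroup.zpowers x)
    rw [Nat.card_zpowers, hx, ← orderOf_eq_card_of_forall_mem_zpowers hqgen] at hcard
    rcases (Nat.dvd_prime hp).mp (orderOf_dvd_of_pow_eq_one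
      (show (g : G ⧸ Subgroup.zpowers x) ^ p = 1 by
        rw [← QuotientGroup.mk_pow, hg, QuotientGroup.mk_one])) with h | h
    · rw [h, one_mul] at hcard
      exact absurd (isCyclic_of_prime_card hcard) hG
    · rw [hcard, h, sq]
  · have hh : h ∈ Subgroup.closure {x, g} := hxg ▸ Subgroup.mem_top h
    obtain ⟨m, n, rfl⟩ := Subgroup.mem_closure_pair.mp hh
    rw [mul_pow, ← zpow_natCast, ← zpow_natCast, zpow_comm x, zpow_comm g, zpow_natCast,
      zpow_natCast, hx1, hg, one_zpow, one_zpow, one_mul]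

theorem nonempty_mulEquiv_prod_zmod {G : Type*} [CommGroup G] {p : ℕ} (hp : p.Prime)
    (hcard : Nat.card G = p ^ 2) (hexp : ∀ g : G, g ^ p = 1) :
    Nonempty (G ≃* (Multiplicative (ZMod p) × Multiplicative (ZMod p))) := by
  have := Fact.mk hp
  have : Finite G := Nat.finite_of_card_ne_zero (by rw [hcard]; exact (pow_pos hp.pos 2).ne')
  let : Module (ZMod p) (Additive G) := AddCommGroup.zmodModule (n := p) hexp
  have hrank : Module.finrank (ZMod p) (Additive G) =
      Module.finrank (ZMod p) (ZMod p × ZMod p) := by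
    have h : Nat.card (Additive G) = _ := Module.natCard_eq_pow_finrank (K := ZMod p)
    rw [show Nat.card (Additive G) = p ^ 2 from hcard, Nat.card_zmod] at h
    rw [← Nat.pow_right_injective hp.two_le h]
    simp
  let e : Additive G ≃+ ZMod p × ZMod p := (LinearEquiv.ofFinrankEq _ _ hrank).toAddEquiv
  exact ⟨(AddEquiv.toMultiplicative e).trans (MulEquiv.prodMultiplicative _ _)⟩

theorem closure_pair_ne_top_of_mem_zpowers {G : Type*} [Group G] (hG : ¬ IsCyclic G) {x y : G}
    (h : x ∈ Subgroup.zpowers y) : Subgroup.closure {x, y} ≠ ⊤ := by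
  intro htop
  refine hG (isCyclic_of_zpowers_eq_top (g := y) (top_le_iff.mp ?_))
  rw [← htop, Subgroup.closure_le]
  rintro z (rfl | rfl)
  exacts [h, Subgroup.mem_zpowers _]

theorem spreadGE_prime {G : Type*} [Group G] {p : ℕ} (hp : p.Prime)
    (hcard : Nat.card G = p ^ 2) (hexp : ∀ g : G, g ^ p = 1) : SpreadGE G p := by
  intro x hx
  have : Finite G := Nat.finite_of_card_ne_zero (by rw [hcard]; exact (pow_pos hp.pos 2).ne')
  have := Fact.mk hp
  have hord : ∀ i, Nat.card (Subgroup.zpowers (x i)) = p := fun i => by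
    rw [Nat.card_zpowers, orderOf_eq_prime (hexp _) (hx i)]
  obtain ⟨y, hy⟩ : ∃ y, ∀ i, y ∉ Subgroup.zpowers (x i) := by
    by_contra! hcov
    have hsub : (Set.univ : Set G) ⊆
        {1} ∪ ⋃ i ∈ (Finset.univ : Finset (Fin p)), ((Subgroup.zpowers (x i) : Set G) \ {1}) := by
      intro y _
      obtain ⟨i, hi⟩ := hcov y
      by_cases h : y = 1
      · exact Or.inl h
      · exact Or.inr (Set.mem_iUnion₂.mpr ⟨i, Finset.mem_univ i, hi, h⟩)
    have h₁ := Set.ncard_le_ncard hsub (Set.toFinite _)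
    have h₂ := Set.ncard_union_le ({1} : Set G)
      (⋃ i ∈ (Finset.univ : Finset (Fin p)), ((Subgroup.zpowers (x i) : Set G) \ {1}))
    have h₃ := Finset.set_ncard_biUnion_le (Finset.univ : Finset (Fin p))
      fun i => (Subgroup.zpowers (x i) : Set G) \ {1}
    have h₄ : ∀ i, ((Subgroup.zpowers (x i) : Set G) \ {1}).ncard = p - 1 := fun i => by
      rw [Set.ncard_sdiff_singleton_of_mem (one_mem _), ← Nat.card_coe_set_eq]
      exact congrArg (· - 1) (hord i)
    simp only [h₄, Finset.sum_const, Finset.card_univ, Fintype.card_fin, smul_eq_mul] at h₃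
    rw [Set.ncard_univ, hcard] at h₁
    rw [Set.ncard_singleton] at h₂
    obtain ⟨n, rfl⟩ : ∃ n, p = n + 2 := ⟨p - 2, by have := hp.two_le; omega⟩
    have h₅ : n + 2 - 1 = n + 1 := rfl
    rw [h₅] at h₃
    nlinarith
  refine ⟨y, fun i => ?_⟩
  have hle : Subgroup.zpowers (x i) ≤ Subgroup.closure {x i, y} := by
    rw [Subgroup.zpowers_le]
    exact Subgroup.subset_closure (Or.inl rfl)
  obtain ⟨k, hk, hkc⟩ := (Nat.dvd_prime_pow hp).mp
    (hcard ▸ Subgroup.card_subgroup_dvd_card (Subgroup.closure {x i, y}))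
  rcases hk.eq_or_lt with rfl | hk
  · exact Subgroup.eq_top_of_card_eq _ (hkc.trans hcard.symm)
  · refine absurd ?_ (hy i)
    rw [Subgroup.eq_of_le_of_card_ge hle ?_]
    · exact Subgroup.subset_closure (Or.inr rfl)
    · rw [hord, hkc]
      simpa using Nat.pow_le_pow_right hp.pos (Nat.lt_succ_iff.mp hk)

theorem not_spreadGE_succ {G : Type*} [CommGroup G] (hG : ¬ IsCyclic G) {p : ℕ} (hp : p ≠ 0)
    (hexp : ∀ g : G, g ^ p = 1) : ¬ SpreadGE G (p + 1) := by
  intro h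
  have := nontrivial_of_not_isCyclic hG
  obtain ⟨b, hb⟩ := exists_ne (1 : G)
  obtain ⟨a, ha⟩ : ∃ a : G, a ∉ Subgroup.zpowers b := by
    by_contra! hall
    exact hG ⟨b, hall⟩
  obtain ⟨y, hy⟩ := h (Fin.cons b fun i : Fin p => a * b ^ (i : ℕ)) (by
    refine Fin.cases hb fun i => ?_
    simp only [Fin.cons_succ]
    intro hab
    rw [eq_inv_of_mul_eq_one_left hab] at ha
    exact ha (inv_mem (Subgroup.npow_mem_zpowers b _)))
  have h0 : Subgroup.closure {b, y} = ⊤ := hy 0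
  obtain ⟨m, n, hmn⟩ := Subgroup.mem_closure_pair.mp (h0 ▸ Subgroup.mem_top a)
  have hp' : (p : ℤ) ≠ 0 := by exact_mod_cast hp
  obtain ⟨i, hi⟩ := Int.eq_ofNat_of_zero_le (Int.emod_nonneg (-m) hp')
  have hip : i < p := by
    have := Int.emod_lt_of_pos (-m) (b := p) (by omega)
    omega
  refine closure_pair_ne_top_of_mem_zpowers hG (x := a * b ^ i) (y := y) ?_ (hy (Fin.succ ⟨i, hip⟩))
  refine Subgroup.mem_zpowers_iff.mpr ⟨n, ?_⟩
  have hbi : b ^ i = b ^ (-m) := by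
    rw [← zpow_natCast, ← hi, ← Int.emod_add_mul_ediv (-m) p, zpow_add, zpow_mul, zpow_natCast b p,
      hexp, one_zpow, mul_one, Int.add_mul_emod_self_left, Int.emod_emod]
  rw [hbi, ← hmn, mul_comm, zpow_neg, inv_mul_cancel_left]

theorem not_uniformSpreadGE_one {G : Type*} [CommGroup G] (hG : ¬ IsCyclic G) :
    ¬ UniformSpreadGE G 1 := by
  rintro ⟨c, h⟩
  obtain ⟨b, hb, hcb⟩ : ∃ b : G, b ≠ 1 ∧ Subgroup.closure {b, c} ≠ ⊤ := by
    by_cases hc : c = 1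
    · by_contra! hall
      have := nontrivial_of_not_isCyclic hG
      obtain ⟨b, hb⟩ := exists_ne (1 : G)
      have htop := hall b hb
      rw [Set.pair_comm] at htop
      exact closure_pair_ne_top_of_mem_zpowers hG (hc ▸ one_mem _) htop
    · exact ⟨c, hc, closure_pair_ne_top_of_mem_zpowers hG (Subgroup.mem_zpowers c)⟩
  obtain ⟨y, hcy, hy⟩ := h (fun _ => b) fun _ => hb
  rw [isConj_iff_eq] at hcy
  exact hcb (hcy ▸ hy 0)

theorem uniformSpreadGE_of_isCyclic (G : Type*) [Group G] [IsCyclic G] (k : ℕ) :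
    UniformSpreadGE G k := by
  obtain ⟨g, hg⟩ := IsCyclic.exists_generator (α := G)
  refine ⟨g, fun x _ => ⟨g, IsConj.refl g, fun i => top_le_iff.mp fun y _ => ?_⟩⟩
  have hle : Subgroup.zpowers g ≤ Subgroup.closure {x i, g} :=
    Subgroup.zpowers_le.mpr (Subgroup.subset_closure (Or.inr rfl))
  exact hle (hg y)

theorem UniformSpreadGE.spreadGE {G : Type*} [Group G] {k : ℕ} (h : UniformSpreadGE G k) :
    SpreadGE G k := by
  obtain ⟨c, hc⟩ := h
  intro x hx
  obtain ⟨y, -, hy⟩ := hc x hx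
  exact ⟨y, hy⟩

theorem exists_isMinimalNormalSubgroup (G : Type*) [Group G] [Finite G] [Nontrivial G] :
    ∃ N : Subgroup G, IsMinimalNormalSubgroup N := by
  obtain ⟨N, hN⟩ := (Set.toFinite {N : Subgroup G | N.Normal ∧ N ≠ ⊥}).exists_minimal
    ⟨⊤, inferInstance, top_ne_bot⟩
  exact ⟨N, hN.prop.1, hN.prop.2, fun M hM hMb hle => hle.antisymm (hN.le_of_le ⟨hM, hMb⟩ hle)⟩

theorem commute_of_normal_disjoint_of_isCyclic_quotient {G : Type*} [Group G] {M N : Subgroup G}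
    [M.Normal] [N.Normal] [IsCyclic (G ⧸ M)] [IsCyclic (G ⧸ N)] (h : M ⊓ N = ⊥) (a b : G) :
    a * b = b * a := by
  have key : ∀ (K : Subgroup G) [K.Normal] [IsCyclic (G ⧸ K)], (a * b)⁻¹ * (b * a) ∈ K := by
    intro K _ _
    rw [← QuotientGroup.eq, QuotientGroup.mk_mul, QuotientGroup.mk_mul]
    exact IsCyclic.isMulCommutative.is_comm.comm _ _
  have hmem : (a * b)⁻¹ * (b * a) ∈ M ⊓ N := ⟨key M, key N⟩
  rw [h, Subgroup.mem_bot, inv_mul_eq_one] at hmem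
  exact hmem

/-- Trichotomy for finite groups all of whose proper quotients are cyclic:
either `G` is cyclic with infinite spread and uniform spread; or
`G ≅ C_p × C_p` for a prime `p`, with `s(G) = p` and `u(G) = 0`; or `G` is
nonabelian with a unique minimal normal subgroup. -/
theorem proper_quotients_cyclic_trichotomy (G : Type*) [Group G] [Finite G]
    (hq : ∀ (N : Subgroup G) [N.Normal], N ≠ ⊥ → IsCyclic (G ⧸ N)) :
    (IsCyclic G ∧ ∀ k : ℕ, SpreadGE G k ∧ UniformSpreadGE G k) ∨
    (∃ p : ℕ, p.Prime ∧
      Nonempty (G ≃* (Multiplicative (ZMod p) × Multiplicative (ZMod p))) ∧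
      (SpreadGE G p ∧ ¬ SpreadGE G (p + 1)) ∧ ¬ UniformSpreadGE G 1) ∨
    ((¬ ∀ a b : G, a * b = b * a) ∧
      ∃! N : Subgroup G, IsMinimalNormalSubgroup N) := by
  by_cases hG : IsCyclic G
  · exact Or.inl ⟨hG, fun k => ⟨(uniformSpreadGE_of_isCyclic G k).spreadGE,
      uniformSpreadGE_of_isCyclic G k⟩⟩
  by_cases hcomm : ∀ a b : G, a * b = b * a
  · let : CommGroup G := { (inferInstance : Group G) with mul_comm := hcomm }
    obtain ⟨p, hp, hcard, hexp⟩ := exists_prime_card_eq_sq (G := G) (fun N => hq N) hG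
    exact Or.inr (Or.inl ⟨p, hp, nonempty_mulEquiv_prod_zmod hp hcard hexp,
      ⟨spreadGE_prime hp hcard hexp, not_spreadGE_succ hG hp.ne_zero hexp⟩,
      not_uniformSpreadGE_one hG⟩)
  · refine Or.inr (Or.inr ⟨hcomm, ?_⟩)
    have := nontrivial_of_not_isCyclic hG
    obtain ⟨N, hN⟩ := exists_isMinimalNormalSubgroup G
    refine ⟨N, hN, fun M hM => ?_⟩
    have := hM.1
    have := hN.1
    have := hq M hM.2.1
    have := hq N hN.2.1
    by_cases hMN : M ⊓ N = ⊥
    · exact absurd (commute_of_normal_disjoint_of_isCyclic_quotient hMN) hcomm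
    · exact (hM.2.2 (M ⊓ N) inferInstance hMN inf_le_left).symm.trans
        (hN.2.2 (M ⊓ N) inferInstance hMN inf_le_right)
end

section
/- Let G be a finite nonabelian group with a unique minimal normal subgroup N. Assume that N is abelian and G/N is cyclic. Then s(G) = |N| − ε and u(G) = |N| − 1, where ε = 0 if |G/N| is a prime and ε = 1 otherwise. In particular, u(G) ≥ 2. -/
/-- `N` is an abelian minimal normal subgroup of the centreless group `G`, and `t ∉ N` generates
`G` modulo `N`. -/
structure IsCyclicExtension {G : Type*} [Group G] (N : Subgroup G) (t : G) : Prop where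
  normal : N.Normal
  ne_bot : N ≠ ⊥
  minimal : ∀ M : Subgroup G, M.Normal → M ≠ ⊥ → M ≤ N → M = N
  comm : ∀ a ∈ N, ∀ b ∈ N, a * b = b * a
  exists_eq_mul_zpow : ∀ g : G, ∃ n ∈ N, ∃ k : ℤ, g = n * t ^ k
  notMem : t ∉ N
  center_eq_bot : Subgroup.center G = ⊥

namespace IsCyclicExtension

open Subgroup

variable {G : Type*} [Group G] {N : Subgroup G} {t : G}

theorem eq_of_conj_zpow_mem (h : IsCyclicExtension N t) {M : Subgroup G} (hle : M ≤ N)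
    (hM : ∀ n ∈ M, ∀ k : ℤ, t ^ k * n * (t ^ k)⁻¹ ∈ M) {n : G} (hn : n ∈ M) (hn1 : n ≠ 1) :
    M = N := by
  refine h.minimal M ⟨fun a ha g => ?_⟩ (fun hb => hn1 (by simpa [hb] using hn)) hle
  obtain ⟨m, hm, k, rfl⟩ := h.exists_eq_mul_zpow g
  have hb := hM a ha k
  have e : m * t ^ k * a * (m * t ^ k)⁻¹ = t ^ k * a * (t ^ k)⁻¹ := by
    have hc := h.comm m hm _ (hle hb)
    calc m * t ^ k * a * (m * t ^ k)⁻¹ = m * (t ^ k * a * (t ^ k)⁻¹) * m⁻¹ := by group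
      _ = _ := by rw [hc]; group
  rwa [e]

theorem eq_top (h : IsCyclicExtension N t) {K : Subgroup G} (ht : t ∈ K) {n : G} (hn : n ∈ N)
    (hnK : n ∈ K) (hn1 : n ≠ 1) : K = ⊤ := by
  have hKN : K ⊓ N = N := by
    refine h.eq_of_conj_zpow_mem inf_le_right (fun a ha k => ⟨?_, ?_⟩) ⟨hnK, hn⟩ hn1
    · exact K.mul_mem (K.mul_mem (K.zpow_mem ht k) ha.1) (K.inv_mem (K.zpow_mem ht k))
    · exact h.normal.conj_mem a ha.2 _
  rw [eq_top_iff]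
  intro g _
  obtain ⟨m, hm, k, rfl⟩ := h.exists_eq_mul_zpow g
  exact K.mul_mem (inf_eq_right.1 hKN hm) (K.zpow_mem ht k)

theorem eq_one_of_commute (h : IsCyclicExtension N t) {x n : G} (hx : x ∈ zpowers t)
    (hx1 : x ≠ 1) (hn : n ∈ N) (hc : x * n = n * x) : n = 1 := by
  by_contra hn1
  obtain ⟨j, rfl⟩ := mem_zpowers_iff.1 hx
  have hM : centralizer {t ^ j} ⊓ N = N := by
    refine h.eq_of_conj_zpow_mem (n := n) inf_le_right (fun a ha k => ⟨?_, ?_⟩) ⟨?_, hn⟩ hn1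
    · have htk : t ^ k ∈ centralizer {t ^ j} := by
        rw [mem_centralizer_singleton_iff]
        exact ((Commute.refl t).zpow_zpow k j).eq
      exact (centralizer {t ^ j}).mul_mem
        ((centralizer {t ^ j}).mul_mem htk ha.1) ((centralizer {t ^ j}).inv_mem htk)
    · exact h.normal.conj_mem a ha.2 _
    · exact mem_centralizer_singleton_iff.2 hc.symm
  refine hx1 ?_
  rw [← mem_bot, ← h.center_eq_bot, mem_center_iff]
  intro g
  obtain ⟨m, hm, k, rfl⟩ := h.exists_eq_mul_zpow g
  have h1 : Commute m (t ^ j) := mem_centralizer_singleton_iff.1 (inf_eq_right.1 hM hm)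
  exact (h1.mul_left ((Commute.refl t).zpow_zpow k j)).eq

theorem eq_one_of_mem_zpowers (h : IsCyclicExtension N t) {x : G} (hx : x ∈ zpowers t)
    (hxN : x ∈ N) : x = 1 := by
  obtain ⟨j, rfl⟩ := mem_zpowers_iff.1 hx
  refine h.eq_one_of_commute (mem_zpowers t) (fun e => h.notMem (e ▸ N.one_mem)) hxN ?_
  exact ((Commute.refl t).zpow_right j).eq

theorem conj_inv_mem_iff (h : IsCyclicExtension N t) {v x : G} :
    v⁻¹ * x * v ∈ N ↔ x ∈ N := by
  constructor
  · intro hx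
    simpa [mul_assoc] using h.normal.conj_mem _ hx v
  · intro hx
    simpa using h.normal.conj_mem _ hx v⁻¹

theorem eq_of_conj_mem_zpowers (h : IsCyclicExtension N t) {x v w : G} (hx : x ≠ 1)
    (hv : v ∈ N) (hw : w ∈ N) (hxv : v⁻¹ * x * v ∈ zpowers t) (hxw : w⁻¹ * x * w ∈ zpowers t) :
    v = w := by
  have hmem : (v⁻¹ * x * v)⁻¹ * (w⁻¹ * x * w) ∈ N := by
    have h1 : x⁻¹ * (v * w⁻¹) * x ∈ N := h.conj_inv_mem_iff.2 (mul_mem hv (inv_mem hw))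
    have h2 := mul_mem (mul_mem (inv_mem hv) h1) hw
    convert h2 using 1
    group
  have heq : v⁻¹ * x * v = w⁻¹ * x * w :=
    inv_mul_eq_one.1 (h.eq_one_of_mem_zpowers (mul_mem (inv_mem hxv) hxw) hmem)
  have h1 : v⁻¹ * w = 1 := by
    refine h.eq_one_of_commute hxv ?_ (mul_mem (inv_mem hv) hw) ?_
    · intro e
      apply hx
      calc x = v * (v⁻¹ * x * v) * v⁻¹ := by group
        _ = 1 := by rw [e]; group
    · calc v⁻¹ * x * v * (v⁻¹ * w) = v⁻¹ * w * (w⁻¹ * x * w) := by group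
        _ = _ := by rw [heq]
  exact inv_mul_eq_one.1 h1

theorem exists_conj_mem_zpowers [Finite G] (h : IsCyclicExtension N t) {x : G} (hx : x ∉ N) :
    ∃ v ∈ N, v⁻¹ * x * v ∈ zpowers t := by
  obtain ⟨n, hn, k, rfl⟩ := h.exists_eq_mul_zpow x
  have hk : t ^ k ≠ 1 := fun e => hx (by rwa [e, mul_one])
  have hf (v : N) : (v : G) * t ^ k * (v : G)⁻¹ * (t ^ k)⁻¹ ∈ N := by
    have h1 := mul_mem v.2 (h.normal.conj_mem _ (inv_mem v.2) (t ^ k))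
    convert h1 using 1
    group
  let f : N → N := fun v => ⟨_, hf v⟩
  have hinj : Function.Injective f := by
    intro v w hvw
    have e : (v : G) * t ^ k * (v : G)⁻¹ = w * t ^ k * (w : G)⁻¹ :=
      mul_right_cancel (Subtype.ext_iff.1 hvw)
    have h1 : (w : G)⁻¹ * v = 1 := by
      refine h.eq_one_of_commute (zpow_mem (mem_zpowers t) k) hk (mul_mem (inv_mem w.2) v.2) ?_
      calc t ^ k * ((w : G)⁻¹ * v) = (w : G)⁻¹ * (w * t ^ k * (w : G)⁻¹) * v := by group
        _ = _ := by rw [← e]; group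
    exact Subtype.ext (inv_mul_eq_one.1 h1).symm
  obtain ⟨v, hv⟩ := Finite.surjective_of_injective hinj ⟨n, hn⟩
  have hv' : (v : G) * t ^ k * (v : G)⁻¹ * (t ^ k)⁻¹ = n := Subtype.ext_iff.1 hv
  refine ⟨v, v.2, mem_zpowers_iff.2 ⟨k, ?_⟩⟩
  rw [← hv']
  group

theorem closure_ne_top_of_conj_mem {K : Subgroup G} (hK : K ≠ ⊤) {x y v : G}
    (hx : v⁻¹ * x * v ∈ K) (hy : v⁻¹ * y * v ∈ K) : closure {x, y} ≠ ⊤ := by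
  intro htop
  have hle : closure {x, y} ≤ K.comap (MulAut.conj v⁻¹).toMonoidHom := by
    rw [closure_le]
    rintro g (rfl | rfl) <;> simpa
  refine hK (eq_top_iff.2 fun g _ => ?_)
  have hg : v * g * v⁻¹ ∈ closure {x, y} := htop ▸ mem_top _
  simpa [mul_assoc] using hle hg

theorem exists_mem_ne_one (h : IsCyclicExtension N t) : ∃ n ∈ N, n ≠ 1 :=
  let ⟨n, hn⟩ := N.ne_bot_iff_exists_ne_one.1 h.ne_bot
  ⟨n, n.2, fun e => hn (Subtype.ext e)⟩

theorem zpowers_ne_top (h : IsCyclicExtension N t) : zpowers t ≠ ⊤ := by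
  intro htop
  obtain ⟨n, hn, hn1⟩ := h.exists_mem_ne_one
  exact hn1 (h.eq_one_of_mem_zpowers (htop ▸ mem_top _) hn)

theorem ne_top (h : IsCyclicExtension N t) : N ≠ ⊤ := fun e => h.notMem (e ▸ mem_top t)

theorem closure_pair_conj_eq_top (h : IsCyclicExtension N t) {x v : G}
    (hx : v⁻¹ * x * v ∉ zpowers t) : closure {x, v * t * v⁻¹} = ⊤ := by
  set K := (closure {x, v * t * v⁻¹}).comap (MulAut.conj v).toMonoidHom with hK
  have htK : t ∈ K := subset_closure (by simp)
  have hxK : v⁻¹ * x * v ∈ K := subset_closure (by simp [mul_assoc])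
  obtain ⟨n, hn, k, hnk⟩ := h.exists_eq_mul_zpow (v⁻¹ * x * v)
  have hKtop : K = ⊤ := by
    refine h.eq_top htK hn ?_ ?_
    · rw [eq_mul_inv_of_mul_eq hnk.symm]
      exact mul_mem hxK (inv_mem (zpow_mem htK k))
    · rintro rfl
      exact hx (mem_zpowers_iff.2 ⟨k, by rw [hnk, one_mul]⟩)
  refine eq_top_iff.2 fun g _ => ?_
  have hg : v⁻¹ * g * v ∈ K := hKtop ▸ mem_top _
  simpa [hK, mul_assoc] using hg

theorem uniformSpreadGE [Finite G] (h : IsCyclicExtension N t) {k : ℕ} (hk : k < Nat.card N) :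
    UniformSpreadGE G k := by
  refine ⟨t, fun x hx => ?_⟩
  suffices hv : ∃ v : N, ∀ i, (v : G)⁻¹ * x i * v ∉ zpowers t by
    obtain ⟨v, hv⟩ := hv
    exact ⟨v * t * (v : G)⁻¹, isConj_iff.2 ⟨v, rfl⟩, fun i => h.closure_pair_conj_eq_top (hv i)⟩
  by_contra! hcon
  choose f hf using hcon
  have hinj : Function.Injective f := fun v w hvw =>
    Subtype.ext (h.eq_of_conj_mem_zpowers (hx (f v)) v.2 w.2 (hf v) (hvw ▸ hf w))
  have := Nat.card_le_card_of_injective f hinj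
  rw [Nat.card_fin] at this
  omega

theorem not_uniformSpreadGE [Finite G] (h : IsCyclicExtension N t) :
    ¬ UniformSpreadGE G (Nat.card N) := by
  rintro ⟨c, hc⟩
  obtain ⟨n, hn, hn1⟩ := h.exists_mem_ne_one
  have ht1 : t ≠ 1 := fun e => h.notMem (e ▸ N.one_mem)
  let e := Finite.equivFin N
  have hcN : c ∉ N := by
    intro hcN
    obtain ⟨y, hy, hgen⟩ := hc (fun _ => n) (fun _ => hn1)
    obtain ⟨g, rfl⟩ := isConj_iff.1 hy
    exact closure_ne_top_of_conj_mem (v := 1) h.ne_top (by simpa)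
      (by simpa using h.normal.conj_mem c hcN g) (hgen (e 1))
  obtain ⟨y, hy, hgen⟩ := hc (fun i => (e.symm i : G) * t * (e.symm i : G)⁻¹) (fun i => by simpa)
  have hyN : y ∉ N := by
    obtain ⟨g, rfl⟩ := isConj_iff.1 hy
    exact fun hy => hcN (by simpa [mul_assoc] using h.conj_inv_mem_iff (v := g).2 hy)
  obtain ⟨v, hv, hyv⟩ := h.exists_conj_mem_zpowers hyN
  exact closure_ne_top_of_conj_mem h.zpowers_ne_top (v := v) (by simp [mul_assoc]) hyv
    (hgen (e ⟨v, hv⟩))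

theorem not_spreadGE_card_add_one [Finite G] (h : IsCyclicExtension N t) :
    ¬ SpreadGE G (Nat.card N + 1) := by
  intro hs
  obtain ⟨n, hn, hn1⟩ := h.exists_mem_ne_one
  have ht1 : t ≠ 1 := fun e => h.notMem (e ▸ N.one_mem)
  let e := Finite.equivFin N
  obtain ⟨y, hgen⟩ := hs (Fin.cons n fun i => (e.symm i : G) * t * (e.symm i : G)⁻¹)
    (Fin.cases (by simpa) fun i => by simpa)
  by_cases hyN : y ∈ N
  · exact closure_ne_top_of_conj_mem (v := 1) h.ne_top (by simpa) (by simpa) (hgen 0)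
  · obtain ⟨v, hv, hyv⟩ := h.exists_conj_mem_zpowers hyN
    exact closure_ne_top_of_conj_mem h.zpowers_ne_top (v := v) (by simp [mul_assoc]) hyv
      (hgen (e ⟨v, hv⟩).succ)

theorem not_spreadGE_card [Finite G] (h : IsCyclicExtension N t) {x : G} (hx : x ∈ zpowers t)
    (hx1 : x ≠ 1) (hxN : N ⊔ zpowers x ≠ ⊤) : ¬ SpreadGE G (Nat.card N) := by
  intro hs
  let e := Finite.equivFin N
  obtain ⟨y, hgen⟩ := hs (fun i => (e.symm i : G) * x * (e.symm i : G)⁻¹) (fun i => by simpa)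
  by_cases hyN : y ∈ N
  · refine closure_ne_top_of_conj_mem hxN (v := e.symm (e 1)) ?_ ?_ (hgen (e 1))
    · simpa using mem_sup_right (mem_zpowers x)
    · simpa using mem_sup_left hyN
  · obtain ⟨v, hv, hyv⟩ := h.exists_conj_mem_zpowers hyN
    exact closure_ne_top_of_conj_mem h.zpowers_ne_top (v := v) (by simpa [mul_assoc]) hyv
      (hgen (e ⟨v, hv⟩))

theorem of_prime_card [N.Normal] (h : IsCyclicExtension N t) (hp : (Nat.card (G ⧸ N)).Prime)
    {x : G} (hx : x ∉ N) : IsCyclicExtension N x := by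
  refine { h with notMem := hx, exists_eq_mul_zpow := fun g => ?_ }
  have := Fact.mk hp
  obtain ⟨k, hk⟩ := mem_zpowers_iff.1 <| mem_zpowers_of_prime_card (g' := (g : G ⧸ N)) rfl
    (mt (QuotientGroup.eq_one_iff x).1 hx)
  refine ⟨g * (x ^ k)⁻¹, ?_, k, by group⟩
  rw [← QuotientGroup.eq_one_iff]
  simp [hk]

theorem spreadGE_card [Finite G] [N.Normal] (h : IsCyclicExtension N t)
    (hp : (Nat.card (G ⧸ N)).Prime) : SpreadGE G (Nat.card N) := by
  intro x hx
  by_cases hv : ∃ v : N, ∀ i, (v : G)⁻¹ * x i * v ∉ zpowers t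
  · obtain ⟨v, hv⟩ := hv
    exact ⟨v * t * (v : G)⁻¹, fun i => h.closure_pair_conj_eq_top (hv i)⟩
  push Not at hv
  choose f hf using hv
  have hinj : Function.Injective f := fun v w hvw =>
    Subtype.ext (h.eq_of_conj_mem_zpowers (hx (f v)) v.2 w.2 (hf v) (hvw ▸ hf w))
  have hsurj : Function.Surjective f :=
    (Nat.bijective_iff_injective_and_card f).2 ⟨hinj, by simp⟩ |>.surjective
  obtain ⟨n, hn, hn1⟩ := h.exists_mem_ne_one
  refine ⟨n, fun i => ?_⟩
  have hxi : x i ∉ N := by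
    obtain ⟨v, rfl⟩ := hsurj i
    intro hmem
    have h1 := h.eq_one_of_mem_zpowers (hf v) (h.conj_inv_mem_iff.2 hmem)
    exact hx _ (by simpa [mul_assoc] using congrArg (fun g => (v : G) * g * (v : G)⁻¹) h1)
  exact (h.of_prime_card hp hxi).eq_top (subset_closure (by simp)) hn (subset_closure (by simp)) hn1

theorem two_lt_card [Finite G] (h : IsCyclicExtension N t) : 2 < Nat.card N := by
  obtain ⟨n, hn, hn1⟩ := h.exists_mem_ne_one
  have ht1 : t ≠ 1 := fun e => h.notMem (e ▸ N.one_mem)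
  have : Fintype N := Fintype.ofFinite N
  rw [Nat.card_eq_fintype_card, Fintype.two_lt_card_iff]
  refine ⟨1, ⟨n, hn⟩, ⟨t * n * t⁻¹, h.normal.conj_mem n hn t⟩, ?_, ?_, ?_⟩
  · simpa [Subtype.ext_iff] using hn1.symm
  · simp only [ne_eq, Subtype.ext_iff, OneMemClass.coe_one]
    intro e
    exact hn1 (by simpa using e.symm)
  · simp only [ne_eq, Subtype.ext_iff]
    intro e
    exact hn1 (h.eq_one_of_commute (mem_zpowers t) ht1 hn (eq_mul_inv_iff_mul_eq.1 e).symm)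

end IsCyclicExtension

theorem exists_pow_ne_one_zpowers_ne_top {Q : Type*} [Group Q] [Finite Q] {q : Q}
    (hq : ∀ g, g ∈ Subgroup.zpowers q) (hq1 : q ≠ 1) (hp : ¬ (Nat.card Q).Prime) :
    ∃ d : ℕ, q ^ d ≠ 1 ∧ Subgroup.zpowers (q ^ d) ≠ ⊤ := by
  have hord : orderOf q = Nat.card Q := orderOf_eq_card_of_forall_mem_zpowers hq
  have hne : Nat.card Q ≠ 1 := by rwa [← hord, ne_eq, orderOf_eq_one_iff]
  have hpos : 0 < Nat.card Q := Nat.card_pos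
  have hmin := Nat.minFac_prime hne
  have hdvd := Nat.minFac_dvd (Nat.card Q)
  have hlt := (Nat.not_prime_iff_minFac_lt (by omega)).1 hp
  refine ⟨(Nat.card Q).minFac, fun e => ?_, fun e => ?_⟩
  · have := Nat.le_of_dvd hmin.pos (orderOf_dvd_of_pow_eq_one e)
    omega
  · have h1 : orderOf (q ^ (Nat.card Q).minFac) = Nat.card Q := by
      rw [← Nat.card_zpowers, e, Subgroup.card_top]
    rw [orderOf_pow_of_dvd hmin.ne_zero (hord ▸ hdvd), hord] at h1
    have := Nat.div_lt_self hpos hmin.one_lt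
    omega

theorem Subgroup.le_of_unique_minimal_normal {G : Type*} [Group G] [Finite G] {N : Subgroup G}
    (huniq : ∀ M : Subgroup G,
      (M.Normal ∧ M ≠ ⊥ ∧ ∀ L : Subgroup G, L.Normal → L ≠ ⊥ → L ≤ M → L = M) → M = N)
    {M : Subgroup G} (hM : M.Normal) (hM1 : M ≠ ⊥) : N ≤ M := by
  obtain ⟨L, hLM, hL⟩ := exists_minimal_le_of_wellFoundedLT
    (fun L : Subgroup G => L.Normal ∧ L ≠ ⊥) M ⟨hM, hM1⟩
  rwa [← huniq L ⟨hL.prop.1, hL.prop.2, fun K hK hK1 hKL => hL.eq_of_le ⟨hK, hK1⟩ hKL⟩]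

/-- Let `G` be a finite nonabelian group whose unique minimal normal subgroup
`N` is abelian, with `G/N` cyclic. Then `s(G) = |N| - ε` and `u(G) = |N| - 1`,
where `ε = 0` if `|G/N|` is prime and `ε = 1` otherwise. In particular
`u(G) ≥ 2`. -/
theorem spread_abelian_monolith (G : Type*) [Group G] [Finite G]
    (hnonab : ¬ ∀ a b : G, a * b = b * a)
    (N : Subgroup G) [hN : N.Normal]
    (hmin : N ≠ ⊥ ∧ ∀ M : Subgroup G, M.Normal → M ≠ ⊥ → M ≤ N → M = N)
    (huniq : ∀ M : Subgroup G,
      (M.Normal ∧ M ≠ ⊥ ∧ ∀ L : Subgroup G, L.Normal → L ≠ ⊥ → L ≤ M → L = M) →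
      M = N)
    (habelian : ∀ a b : ↥N, a * b = b * a)
    (hcyc : IsCyclic (G ⧸ N)) :
    (SpreadGE G (Nat.card ↥N - if (Nat.card (G ⧸ N)).Prime then 0 else 1) ∧
      ¬ SpreadGE G (Nat.card ↥N - (if (Nat.card (G ⧸ N)).Prime then 0 else 1) + 1)) ∧
    (UniformSpreadGE G (Nat.card ↥N - 1) ∧ ¬ UniformSpreadGE G (Nat.card ↥N)) ∧
    UniformSpreadGE G 2 := by
  have hcenter : Subgroup.center G = ⊥ := by
    by_contra hZ
    have hle := Subgroup.le_of_unique_minimal_normal huniq inferInstance hZ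
    have hker : (QuotientGroup.mk' N).ker ≤ Subgroup.center G := by
      rwa [QuotientGroup.ker_mk']
    exact hnonab
      (MonoidHom.isMulCommutative_of_isCyclic_of_ker_le_center _ hker).is_comm.comm
  obtain ⟨q, hq⟩ := hcyc.exists_generator
  obtain ⟨t, rfl⟩ := QuotientGroup.mk_surjective q
  have hgen : ∀ g : G, ∃ n ∈ N, ∃ k : ℤ, g = n * t ^ k := by
    intro g
    obtain ⟨k, hk⟩ := Subgroup.mem_zpowers_iff.1 (hq g)
    refine ⟨g * (t ^ k)⁻¹, ?_, k, by group⟩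
    rw [← QuotientGroup.eq_one_iff]
    simp [hk]
  have hcomm : ∀ a ∈ N, ∀ b ∈ N, a * b = b * a := fun a ha b hb =>
    congrArg Subtype.val (habelian ⟨a, ha⟩ ⟨b, hb⟩)
  have htN : t ∉ N := by
    intro ht
    have hall : ∀ g, g ∈ N := fun g => by
      obtain ⟨n, hn, k, rfl⟩ := hgen g
      exact mul_mem hn (zpow_mem ht k)
    exact hnonab fun a b => hcomm a (hall a) b (hall b)
  have h : IsCyclicExtension N t := ⟨hN, hmin.1, hmin.2, hcomm, hgen, htN, hcenter⟩
  have hcard := h.two_lt_card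
  have hu : UniformSpreadGE G (Nat.card N - 1) := h.uniformSpreadGE (by omega)
  refine ⟨?_, ⟨hu, h.not_uniformSpreadGE⟩, h.uniformSpreadGE hcard⟩
  split_ifs with hp
  · exact ⟨h.spreadGE_card hp, h.not_spreadGE_card_add_one⟩
  · have hsub : Nat.card N - 1 + 1 = Nat.card N := by omega
    obtain ⟨c, hc⟩ := hu
    refine ⟨fun x hx => (hc x hx).imp fun y hy => hy.2, ?_⟩
    obtain ⟨d, hd1, hd⟩ := exists_pow_ne_one_zpowers_ne_top hq
      (mt (QuotientGroup.eq_one_iff t).1 htN) hp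
    rw [hsub]
    refine h.not_spreadGE_card (pow_mem (Subgroup.mem_zpowers t) d)
      (fun e => hd1 (by rw [← QuotientGroup.mk_pow, e, QuotientGroup.mk_one])) fun htop => hd ?_
    have hmap := congrArg (Subgroup.map (QuotientGroup.mk' N)) htop
    rw [Subgroup.map_sup, MonoidHom.map_zpowers, QuotientGroup.map_mk'_self, bot_sup_eq,
      Subgroup.map_top_of_surjective _ (QuotientGroup.mk'_surjective N)] at hmap
    simpa using hmap
end

section
/- Let G = ⟨a⟩⟨b⟩ be a finite group that is an internal semidirect product of cyclic subgroups ⟨a⟩ and ⟨b⟩, i.e., ⟨a⟩ is normal in G and ⟨a⟩ ∩ ⟨b⟩ = 1. Then for every integer i > 0 there exist nonnegative integers j and k such that ⟨a bⁱ⟩ = ⟨aʲ bᵏ⟩ and k divides the order of b. -/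
/-- If `n ∣ N` and `N ≠ 0`, every natural number `i` can be multiplied by some `u` coprime to `N`
so that it becomes congruent to `gcd i n` modulo `n`. -/
theorem Nat.exists_coprime_mul_modEq_gcd {n N : ℕ} (i : ℕ) (hN : N ≠ 0) (h : n ∣ N) :
    ∃ u : ℕ, u.Coprime N ∧ u * i ≡ i.gcd n [MOD n] := by
  have hn : 0 < n := Nat.pos_of_dvd_of_pos h (Nat.pos_of_ne_zero hN)
  have hd : 0 < i.gcd n := Nat.gcd_pos_of_pos_right i hn
  have : NeZero N := ⟨hN⟩
  have hdvd : n / i.gcd n ∣ N := (Nat.div_dvd_of_dvd (Nat.gcd_dvd_right i n)).trans h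
  obtain ⟨w, hw⟩ := ZMod.unitsMap_surjective hdvd
    (ZMod.unitOfCoprime (i / i.gcd n) (Nat.coprime_div_gcd_div_gcd hd))⁻¹
  refine ⟨(w : ZMod N).val, ZMod.val_coe_unit_coprime w, ?_⟩
  have hmod : (w : ZMod N).val * (i / i.gcd n) ≡ 1 [MOD n / i.gcd n] := by
    rw [← ZMod.natCast_eq_natCast_iff, Nat.cast_mul, Nat.cast_one]
    have hcast : (((w : ZMod N).val : ℕ) : ZMod (n / i.gcd n)) =
        (ZMod.unitsMap hdvd w : (ZMod (n / i.gcd n))ˣ) := by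
      rw [ZMod.unitsMap_val, ZMod.natCast_val]
    rw [hcast, hw, ← ZMod.coe_unitOfCoprime _ (Nat.coprime_div_gcd_div_gcd hd), Units.inv_mul]
  have hmul := hmod.mul_right' (i.gcd n)
  rwa [mul_assoc, Nat.div_mul_cancel (Nat.gcd_dvd_left i n),
    Nat.div_mul_cancel (Nat.gcd_dvd_right i n), one_mul] at hmul

/-- Modulo a normal subgroup containing `a`, the powers of `a * b` are the powers of `b`. -/
theorem Subgroup.mul_pow_mul_inv_pow_mem {G : Type*} [Group G] (H : Subgroup G) [H.Normal]
    {a : G} (ha : a ∈ H) (b : G) (u : ℕ) : (a * b) ^ u * (b ^ u)⁻¹ ∈ H := by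
  rw [← QuotientGroup.eq_one_iff] at ha ⊢
  simp [ha]

/-- Let `G = ⟨a⟩⟨b⟩` be a finite group which is an internal semidirect product
of the cyclic subgroups `⟨a⟩` (normal) and `⟨b⟩`. Then for every `i > 0` there
are nonnegative integers `j, k` with `⟨a * b ^ i⟩ = ⟨a ^ j * b ^ k⟩` and `k`
dividing the order of `b`. -/
theorem cyclic_semidirect_generator (G : Type*) [Group G] [Finite G] (a b : G)
    (hnorm : (Subgroup.zpowers a).Normal)
    (hdisj : Subgroup.zpowers a ⊓ Subgroup.zpowers b = ⊥)
    (hgen : Subgroup.zpowers a ⊔ Subgroup.zpowers b = ⊤) :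
    ∀ i : ℕ, 0 < i → ∃ j k : ℕ,
      Subgroup.zpowers (a * b ^ i) = Subgroup.zpowers (a ^ j * b ^ k) ∧
      k ∣ orderOf b := by
  intro i _
  obtain ⟨u, hu, hmod⟩ := Nat.exists_coprime_mul_modEq_gcd i
    (Nat.card_pos (α := G)).ne' (orderOf_dvd_natCard b)
  have hmem := (Subgroup.zpowers a).mul_pow_mul_inv_pow_mem
    (Subgroup.mem_zpowers a) (b ^ i) u
  rw [← mem_powers_iff_mem_zpowers] at hmem
  obtain ⟨j, hj : a ^ j = _⟩ := hmem
  refine ⟨j, i.gcd (orderOf b), ?_, Nat.gcd_dvd_right _ _⟩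
  have hpow : a ^ j * b ^ i.gcd (orderOf b) = (a * b ^ i) ^ u := by
    rw [← pow_eq_pow_iff_modEq.2 hmod, hj, ← pow_mul, mul_comm i u, inv_mul_cancel_right]
  rw [hpow]
  have hcop : (orderOf (a * b ^ i)).Coprime u :=
    (hu.coprime_dvd_right (orderOf_dvd_natCard _)).symm
  refine le_antisymm ?_ ?_
  · obtain ⟨m, hm⟩ := exists_pow_eq_self_of_coprime hcop.symm
    rw [Subgroup.zpowers_le]
    exact Subgroup.mem_zpowers_iff.2 ⟨m, by rw [zpow_natCast, hm]⟩
  · rw [Subgroup.zpowers_le]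
    exact Subgroup.npow_mem_zpowers _ _
end

section
/- Let T be a nonabelian finite simple group, let k ≥ 1, let N = T₁ × ⋯ × T_k be the direct product of k copies of T, identified with Inn(N) ≤ Aut(N) (N has trivial centre), and suppose G = ⟨N, z⟩ ≤ Aut(N) where z ∈ Aut(N) permutes the k direct factors T₁, …, T_k transitively. If G = ⟨h, z⟩ for some h ∈ N whose N-conjugacy class equals its Aut(N)-conjugacy class (h^N = h^{Aut(N)}), then |C_{Aut(N)}(z)| ≤ |N : C_N(h)| ≤ |N|/3^k. -/
/-- The index of the centralizer of `g` is the size of the conjugacy class of `g`. -/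
theorem index_centralizer_eq_ncard_conjugatesOf {G : Type*} [Group G] (g : G) :
    (Subgroup.centralizer {g}).index = (conjugatesOf g).ncard := by
  have h1 : (MulAction.stabilizer (ConjAct G) g).index = (Subgroup.centralizer {g}).index := by
    rw [ConjAct.stabilizer_eq_centralizer]
    rfl
  rw [← h1, MulAction.index_stabilizer]
  congr 1
  ext a
  rw [ConjAct.mem_orbit_conjAct, isConj_comm]
  rfl

/-- If the centralizer of `x` in a finite group is `{1, x}`, then left multiplication by a
conjugate of `x` exchanges the class of `x` with its complement. -/
theorem mul_mem_conjugatesOf_iff_notMem {G : Type*} [Group G] [Finite G] {x : G} (hx : x ≠ 1)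
    (hcard : Nat.card (Subgroup.centralizer {x}) = 2)
    (hC : ∀ c, c * x = x * c → c = 1 ∨ c = x) {d : G} (hd : d ∈ conjugatesOf x) (t : G) :
    d * t ∈ conjugatesOf x ↔ t ∉ conjugatesOf x := by
  have hxx : x * x = 1 := (hC (x * x) (mul_assoc _ _ _)).resolve_right (by simpa using hx)
  have hsq : ∀ e ∈ conjugatesOf x, e * e = 1 := by
    intro e he
    obtain ⟨g, rfl⟩ := isConj_iff.1 (show IsConj x _ from he)
    rw [conj_mul, hxx, mul_one, mul_inv_cancel]
  have hone : (1 : G) ∉ conjugatesOf x := fun h1 ↦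
    hx (isConj_one_left.1 (show IsConj x 1 from h1))
  have hnot : ∀ e ∈ conjugatesOf x, d * e ∉ conjugatesOf x := by
    intro e he hde
    have hcomm : e * d = d * e := by
      have h1 := hsq _ hde
      rw [← inv_eq_iff_mul_eq_one, mul_inv_rev, inv_eq_of_mul_eq_one_left (hsq e he),
        inv_eq_of_mul_eq_one_left (hsq d hd)] at h1
      exact h1
    obtain ⟨g, rfl⟩ := isConj_iff.1 (show IsConj x _ from hd)
    have h2 : (g⁻¹ * e * g) * x = x * (g⁻¹ * e * g) := by
      calc (g⁻¹ * e * g) * x = g⁻¹ * (e * (g * x * g⁻¹)) * g := by group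
        _ = x * (g⁻¹ * e * g) := by rw [hcomm]; group
    rcases hC _ h2 with h3 | h3
    · have : e = 1 := by
        calc e = g * (g⁻¹ * e * g) * g⁻¹ := by group
          _ = 1 := by rw [h3]; group
      exact hone (this ▸ he)
    · have : e = g * x * g⁻¹ := by
        calc e = g * (g⁻¹ * e * g) * g⁻¹ := by group
          _ = g * x * g⁻¹ := by rw [h3]
      rw [this, hsq _ hd] at hde
      exact hone hde
  refine ⟨fun h1 h2 ↦ hnot t h2 h1, fun ht ↦ ?_⟩
  have hdisj : Disjoint (conjugatesOf x) ((d * ·) '' conjugatesOf x) := by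
    rw [Set.disjoint_left]
    rintro _ h1 ⟨e, he, rfl⟩
    exact hnot e he h1
  have hunion : conjugatesOf x ∪ (d * ·) '' conjugatesOf x = Set.univ := by
    rw [Set.eq_univ_iff_ncard, Set.ncard_union_eq hdisj,
      Set.ncard_image_of_injective _ (mul_right_injective d),
      ← index_centralizer_eq_ncard_conjugatesOf,
      ← (Subgroup.centralizer {x}).index_mul_card, hcard, mul_two]
  obtain ⟨e, he, rfl⟩ := ((Set.mem_union _ _ _).1 (hunion.symm ▸ Set.mem_univ t)).resolve_left ht
  simpa [← mul_assoc, hsq d hd] using he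

/-- Centralizers of elements of a finite nonabelian simple group have order at least `3`. -/
theorem three_le_card_centralizer {T : Type*} [Group T] [Finite T] [IsSimpleGroup T]
    (hT : ¬ ∀ a b : T, a * b = b * a) (x : T) :
    3 ≤ Nat.card (Subgroup.centralizer {x}) := by
  by_contra! hlt
  have hle : ∀ a b : T, a * x = x * a → b * x = x * b → a = 1 ∨ b = 1 ∨ a = b := by
    intro a b ha hb
    by_contra! hne
    have h3 : ({1, a, b} : Set T).ncard = 3 :=
      Set.ncard_eq_three.2 ⟨1, a, b, hne.1.symm, hne.2.1.symm, hne.2.2, rfl⟩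
    have hsub : ({1, a, b} : Set T) ⊆ Subgroup.centralizer {x} := by
      rintro c (rfl | rfl | rfl)
      · exact one_mem _
      · simpa [Subgroup.mem_centralizer_iff] using ha.symm
      · simpa [Subgroup.mem_centralizer_iff] using hb.symm
    have := Set.ncard_le_ncard hsub
    rw [h3, ← Nat.card_coe_set_eq] at this
    exact absurd this (not_le.2 hlt)
  rcases eq_or_ne x 1 with rfl | hx
  · refine hT fun a b ↦ ?_
    rcases hle a b (by simp) (by simp) with rfl | rfl | rfl <;> simp
  have hC : ∀ c, c * x = x * c → c = 1 ∨ c = x := fun c hc ↦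
    (hle c x hc rfl).imp_right fun h1 ↦ h1.resolve_left hx
  have hcard : Nat.card (Subgroup.centralizer {x}) = 2 := by
    have : Nontrivial (Subgroup.centralizer {x}) :=
      ⟨⟨x, by simp [Subgroup.mem_centralizer_iff]⟩, 1, fun h1 ↦ hx (congrArg Subtype.val h1)⟩
    have := Finite.one_lt_card (α := Subgroup.centralizer {x})
    omega
  have key := fun {d : T} (hd : d ∈ conjugatesOf x) ↦
    mul_mem_conjugatesOf_iff_notMem hx hcard hC hd
  have hself : x ∈ conjugatesOf x := mem_conjugatesOf_self
  have hconj : ∀ a g : T, g * a * g⁻¹ ∈ conjugatesOf x → a ∈ conjugatesOf x := fun a g h1 ↦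
    IsConj.trans h1 (isConj_iff.2 ⟨g, rfl⟩).symm
  have hone : (1 : T) ∉ conjugatesOf x := (key hself 1).1 (by simpa using hself)
  let K : Subgroup T :=
    { carrier := (conjugatesOf x)ᶜ
      one_mem' := hone
      mul_mem' := by
        intro a b ha hb hab
        have h1 := (key ((key hself a).2 ha) b).2 hb
        rw [mul_assoc] at h1
        exact (key hself (a * b)).1 h1 hab
      inv_mem' := by
        intro a ha hainv
        have h1 := (key hainv a).2 ha
        rw [inv_mul_cancel] at h1
        exact hone h1 }
  have hK : K.Normal := ⟨fun a ha g h1 ↦ ha (hconj a g h1)⟩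
  rcases hK.eq_bot_or_eq_top with hbot | htop
  · have hall : ∀ t : T, t ≠ 1 → t ∈ conjugatesOf x := by
      intro t ht
      by_contra h1
      exact ht ((Subgroup.mem_bot).1 (hbot ▸ (show t ∈ K from h1)))
    have heq : ∀ t : T, t = 1 ∨ t = x := by
      intro t
      by_contra! h1
      refine (key hself (x⁻¹ * t)).1 (by simpa using hall t h1.1) (hall _ fun h2 ↦ h1.2 ?_)
      exact (inv_mul_eq_one.1 h2).symm
    refine hT fun a b ↦ ?_
    rcases heq a with rfl | rfl <;> rcases heq b with rfl | rfl <;> simp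
  · have : x ∈ K := htop ▸ Subgroup.mem_top x
    exact this hself

/-- An automorphism of a centreless group commuting with all inner automorphisms is trivial. -/
theorem MulAut.eq_one_of_commute_conj {N : Type*} [Group N] (hN : Subgroup.center N = ⊥)
    {c : MulAut N} (hc : ∀ n : N, c * MulAut.conj n = MulAut.conj n * c) : c = 1 := by
  ext n
  have hcen : n⁻¹ * c n ∈ Subgroup.center N := by
    rw [Subgroup.mem_center_iff]
    intro g
    have h1 : c (n * c⁻¹ g * n⁻¹) = n * c (c⁻¹ g) * n⁻¹ := DFunLike.congr_fun (hc n) (c⁻¹ g)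
    rw [map_mul, map_mul, map_inv, MulAut.apply_inv_self] at h1
    calc g * (n⁻¹ * c n) = n⁻¹ * (n * g * n⁻¹) * c n := by group
      _ = n⁻¹ * c n * g := by rw [← h1]; group
  rw [hN, Subgroup.mem_bot, inv_mul_eq_one] at hcen
  exact hcen.symm

/-- A power of a group with trivial centre has trivial centre. -/
theorem center_pi_eq_bot {ι T : Type*} [Group T] (hT : Subgroup.center T = ⊥) :
    Subgroup.center (ι → T) = ⊥ := by
  rw [eq_bot_iff]
  intro f hf
  rw [Subgroup.mem_center_iff] at hf
  rw [Subgroup.mem_bot]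
  ext i
  have : f i ∈ Subgroup.center T :=
    Subgroup.mem_center_iff.2 fun g ↦ congrFun (hf fun _ ↦ g) i
  simpa [hT] using this

/-- A nonabelian simple group has trivial centre. -/
theorem center_eq_bot_of_isSimpleGroup {T : Type*} [Group T] [IsSimpleGroup T]
    (hT : ¬ ∀ a b : T, a * b = b * a) : Subgroup.center T = ⊥ := by
  refine (Subgroup.Normal.eq_bot_or_eq_top inferInstance).resolve_right fun h ↦ hT fun a b ↦ ?_
  exact Subgroup.mem_center_iff.1 (h ▸ Subgroup.mem_top b) a

/-- Let `T` be a nonabelian finite simple group, `N = T^k`, identified with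
`Inn(N) ≤ Aut(N)` via `MulAut.conj`, and let `z ∈ Aut(N)` permute the `k`
direct factors of `N` transitively. If `G = ⟨N, z⟩ = ⟨h, z⟩` for some `h ∈ N`
whose `N`-class equals its `Aut(N)`-class, then
`|C_{Aut(N)}(z)| ≤ |N : C_N(h)| ≤ |N|/3^k`. -/
theorem centralizer_bound (T : Type*) [Group T] [Finite T] [IsSimpleGroup T]
    (hT : ¬ ∀ a b : T, a * b = b * a)
    (k : ℕ) [NeZero k]
    (z : MulAut (Fin k → T))
    -- `z` permutes the direct factors `T₁, …, T_k`, via the permutation `σ` ...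
    (σ : Equiv.Perm (Fin k))
    (hperm : ∀ i : Fin k,
      (⇑z) '' {f : Fin k → T | ∀ j, j ≠ i → f j = 1} =
        {f : Fin k → T | ∀ j, j ≠ σ i → f j = 1})
    -- ... transitively
    (htrans : ∀ i j : Fin k, ∃ n : ℕ, (σ ^ n) i = j)
    (h : Fin k → T)
    -- `G = ⟨N, z⟩` equals `⟨h, z⟩`
    (hgen : Subgroup.closure {MulAut.conj h, z} =
      (MulAut.conj : (Fin k → T) →* MulAut (Fin k → T)).range ⊔ Subgroup.zpowers z)
    -- the `N`-conjugacy class of `h` equals its `Aut(N)`-orbit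
    (hclass : ∀ φ : MulAut (Fin k → T), ∃ n : Fin k → T, φ h = n * h * n⁻¹) :
    Nat.card ↥(Subgroup.centralizer {z} : Subgroup (MulAut (Fin k → T))) ≤
      (Subgroup.centralizer {h} : Subgroup (Fin k → T)).index ∧
    (Subgroup.centralizer {h} : Subgroup (Fin k → T)).index * 3 ^ k ≤
      Nat.card (Fin k → T) := by
  have hN : Subgroup.center (Fin k → T) = ⊥ :=
    center_pi_eq_bot (center_eq_bot_of_isSimpleGroup hT)
  constructor
  · rw [index_centralizer_eq_ncard_conjugatesOf, ← Nat.card_coe_set_eq]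
    refine Nat.card_le_card_of_injective
      (fun c ↦ ⟨c.1 h, by
        obtain ⟨n, hn⟩ := hclass c.1
        exact isConj_iff.2 ⟨n, hn.symm⟩⟩) ?_
    intro c d hcd
    have hcd : c.1 h = d.1 h := congrArg Subtype.val hcd
    have hfix : (d⁻¹ * c).1 h = h := by
      simp [hcd]
    have hcz : (d⁻¹ * c).1 * z = z * (d⁻¹ * c).1 :=
      (Subgroup.mem_centralizer_iff.1 (d⁻¹ * c).2 z rfl).symm
    have hch : (d⁻¹ * c).1 * MulAut.conj h = MulAut.conj h * (d⁻¹ * c).1 := by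
      ext1 n
      change (d⁻¹ * c).1 (h * n * h⁻¹) = h * (d⁻¹ * c).1 n * h⁻¹
      rw [map_mul, map_mul, map_inv, hfix]
    have hle : Subgroup.closure {MulAut.conj h, z} ≤ Subgroup.centralizer {(d⁻¹ * c).1} := by
      rw [Subgroup.closure_le]
      rintro _ (rfl | rfl)
      · simpa only [SetLike.mem_coe, Subgroup.mem_centralizer_iff, Set.mem_singleton_iff,
          forall_eq] using hch
      · simpa only [SetLike.mem_coe, Subgroup.mem_centralizer_iff, Set.mem_singleton_iff,
          forall_eq] using hcz
    rw [hgen] at hle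
    have hone : (d⁻¹ * c).1 = 1 := MulAut.eq_one_of_commute_conj hN fun n ↦
      Subgroup.mem_centralizer_iff.1 (hle (Subgroup.mem_sup_left ⟨n, rfl⟩)) _ rfl
    exact (inv_mul_eq_one.1 (Subtype.ext hone)).symm
  · rw [← (Subgroup.centralizer {h}).index_mul_card]
    refine Nat.mul_le_mul_left _ ?_
    calc 3 ^ k = ∏ _i : Fin k, 3 := by simp
      _ ≤ ∏ i : Fin k, Nat.card (Subgroup.centralizer {h i}) :=
        Finset.prod_le_prod' fun i _ ↦ three_le_card_centralizer hT (h i)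
      _ = Nat.card (∀ i : Fin k, Subgroup.centralizer {h i}) := Nat.card_pi.symm
      _ ≤ Nat.card (Subgroup.centralizer {h}) := by
        refine Nat.card_le_card_of_injective (fun f ↦ ⟨fun i ↦ (f i).1, ?_⟩) ?_
        · rw [Subgroup.mem_centralizer_iff]
          rintro _ rfl
          ext i
          exact Subgroup.mem_centralizer_iff.1 (f i).2 _ rfl
        · intro f g hfg
          ext i
          exact congrFun (congrArg Subtype.val hfg) i
end

section
/- Let T be a nonabelian finite simple group, k ≥ 1 an integer and y ∈ Aut(T). Let N = T^k be the direct product of k copies of T, identified with Inn(N) ≤ Aut(N), and let x ∈ Aut(N) be defined by x(t₁,…,t_k) = (y(t_k), t₁, …, t_{k−1}). Then for a positive integer d, the element x is a d-th power in Aut(N) (i.e., x = w^d for some w ∈ Aut(N)) if and only if gcd(d, k) = 1 and y is a d-th power in Aut(T). -/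
/-- The automorphism of `ι → G` acting as `v` on every coordinate. -/
def MulAut.piDiagonal (ι : Type*) {G : Type*} [Group G] : MulAut G →* MulAut (ι → G) where
  toFun v := MulEquiv.piCongrRight fun _ => v
  map_one' := rfl
  map_mul' _ _ := rfl

theorem MulAut.piDiagonal_apply {ι G : Type*} [Group G] (v : MulAut G) (f : ι → G) (i : ι) :
    MulAut.piDiagonal ι v f i = v (f i) := rfl

/-- A nontrivial homomorphism from `T` into the `j`-th coordinate, given by an automorphism of
`ι → T` restricted to the `i`-th factor, is surjective when `T` is simple. -/
theorem MulAut.surjective_apply_mulSingle {T ι : Type*} [Group T] [IsSimpleGroup T]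
    [DecidableEq ι] (w : MulAut (ι → T)) {i j : ι}
    (h : ∃ t, w (Pi.mulSingle i t) j ≠ 1) :
    Function.Surjective fun t => w (Pi.mulSingle i t) j := by
  let φ : T →* T := (Pi.evalMonoidHom (fun _ : ι => T) j).comp
    (w.toMonoidHom.comp (MonoidHom.mulSingle (fun _ : ι => T) i))
  have hφ : ∀ t, φ t = w (Pi.mulSingle i t) j := fun _ => rfl
  have hn : φ.range.Normal := by
    refine ⟨?_⟩
    rintro _ ⟨t, rfl⟩ g
    obtain ⟨f, hf⟩ := w.surjective (Pi.mulSingle j g)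
    refine ⟨f i * t * (f i)⁻¹, ?_⟩
    have hc : Pi.mulSingle i (f i * t * (f i)⁻¹) = f * Pi.mulSingle i t * f⁻¹ := by
      ext l
      by_cases hl : l = i
      · subst hl
        simp
      · simp [hl]
    rw [hφ, hφ, hc, map_mul, map_mul, map_inv, hf]
    simp
  obtain ⟨t, ht⟩ := h
  have htop : φ.range = ⊤ := hn.eq_bot_or_eq_top.resolve_left fun hb =>
    ht (by
      have : φ t ∈ φ.range := ⟨t, rfl⟩
      rwa [hb, Subgroup.mem_bot] at this)
  exact MonoidHom.range_eq_top.mp htop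

/-- An automorphism of a finite power of a nonabelian simple group maps factors to factors. -/
theorem MulAut.exists_apply_mulSingle_eq_mulSingle {T ι : Type*} [Group T] [IsSimpleGroup T]
    [Finite ι] [DecidableEq ι] (hT : ¬ ∀ a b : T, a * b = b * a) (w : MulAut (ι → T)) :
    ∃ σ : ι → ι, ∀ i t, ∃ s, w (Pi.mulSingle i t) = Pi.mulSingle (σ i) s := by
  have hex : ∀ i, ∃ j, ∃ t, w (Pi.mulSingle i t) j ≠ 1 := by
    intro i
    obtain ⟨t, ht⟩ := exists_ne (1 : T)
    by_contra! h
    have h1 : w (Pi.mulSingle i t) = w 1 := by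
      rw [map_one]
      exact funext fun j => h j t
    exact ht (by simpa using w.injective h1)
  have huniq : ∀ i i' j, (∃ t, w (Pi.mulSingle i t) j ≠ 1) →
      (∃ t, w (Pi.mulSingle i' t) j ≠ 1) → i = i' := by
    intro i i' j h h'
    by_contra hne
    refine hT fun a b => ?_
    obtain ⟨s, rfl⟩ := w.surjective_apply_mulSingle h a
    obtain ⟨t, rfl⟩ := w.surjective_apply_mulSingle h' b
    have hc := Pi.mulSingle_commute (f := fun _ : ι => T) hne s t
    exact congrFun (hc.map w).eq j
  choose σ hσ using hex
  have hinj : Function.Injective σ := fun i i' h => huniq i i' (σ i) (hσ i) (h ▸ hσ i')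
  have hsurj := Finite.surjective_of_injective hinj
  refine ⟨σ, fun i t => ⟨w (Pi.mulSingle i t) (σ i), ?_⟩⟩
  ext j
  by_cases hj : j = σ i
  · subst hj
    simp
  · rw [Pi.mulSingle_eq_of_ne hj]
    by_contra hne
    obtain ⟨i', rfl⟩ := hsurj j
    exact hj (congrArg σ (huniq i' i _ (hσ i') ⟨t, hne⟩))

theorem Pi.eq_of_mulSingle_eq {ι G : Type*} [One G] [DecidableEq ι] {i j : ι} {s t : G}
    (ht : t ≠ 1) (h : (Pi.mulSingle i t : ι → G) = Pi.mulSingle j s) : i = j := by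
  by_contra hne
  have := congrFun h i
  rw [Pi.mulSingle_eq_same, Pi.mulSingle_eq_of_ne hne] at this
  exact ht this

theorem Fin.val_nsmul_one (k : ℕ) [NeZero k] (n : ℕ) : (n • (1 : Fin k)).val = n % k := by
  induction n with
  | zero => simp
  | succ n ih => rw [succ_nsmul, Fin.val_add, ih, Fin.val_one', ← Nat.add_mod]

theorem Fin.nsmul_eq_zero (k : ℕ) [NeZero k] (s : Fin k) : k • s = 0 := by
  simpa using card_nsmul_eq_zero' (x := s)

theorem Fin.gcd_eq_one_of_nsmul_eq_one {k : ℕ} [NeZero k] {d : ℕ} {s : Fin k}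
    (h : d • s = 1) : Nat.gcd d k = 1 := by
  obtain ⟨a, ha⟩ := Nat.gcd_dvd_left d k
  obtain ⟨b, hb⟩ := Nat.gcd_dvd_right d k
  have hz : b • (1 : Fin k) = 0 := by
    have hbd : b * d = a * k := by
      calc b * d = b * (d.gcd k * a) := by rw [← ha]
        _ = a * (d.gcd k * b) := by ring
        _ = a * k := by rw [← hb]
    rw [← h, ← mul_nsmul', hbd, mul_nsmul', Fin.nsmul_eq_zero, nsmul_zero]
  have hv := congrArg Fin.val hz
  rw [Fin.val_nsmul_one, Fin.val_zero] at hv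
  obtain ⟨c, hc⟩ := Nat.dvd_of_mod_eq_zero hv
  have hk : 0 < k := Nat.pos_of_neZero k
  have hb0 : 0 < b := Nat.pos_of_ne_zero (by rintro rfl; omega)
  have : b * (d.gcd k * c) = b * 1 := by
    calc b * (d.gcd k * c) = (d.gcd k * b) * c := by ring
      _ = b * 1 := by rw [← hb, ← hc, mul_one]
  exact Nat.eq_one_of_mul_eq_one_right (Nat.eq_of_mul_eq_mul_left hb0 this)

section TwistedShift

variable {T : Type*} [Group T] {k : ℕ} [NeZero k] {y : MulAut T} {x : MulAut (Fin k → T)}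

theorem twisted_shift_pow_apply
    (hx : ∀ (f : Fin k → T) (i : Fin k),
      x f i = if i = 0 then y (f (i - 1)) else f (i - 1))
    {n : ℕ} (hn : n ≤ k) (f : Fin k → T) (i : Fin k) :
    (x ^ n) f i = if i.val < n then y (f (i - n • 1)) else f (i - n • 1) := by
  induction n generalizing i with
  | zero => simp
  | succ n ih =>
    have hs : i - 1 - n • (1 : Fin k) = i - (n + 1) • 1 := by
      rw [succ_nsmul, sub_sub, add_comm]
    rw [pow_succ', MulAut.mul_apply, hx, ih (by omega), hs]
    by_cases hi : i = 0
    · subst hi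
      have hv : ¬ ((0 : Fin k) - 1).val < n := by
        have h1 : ((0 : Fin k) - 1).val = k - 1 := by
          obtain ⟨m, rfl⟩ := Nat.exists_eq_succ_of_ne_zero (NeZero.ne k)
          simp
        omega
      rw [if_pos rfl, if_neg hv, if_pos (by simp)]
    · have hv : (i - 1).val = i.val - 1 := by
        obtain ⟨m, rfl⟩ := Nat.exists_eq_succ_of_ne_zero (NeZero.ne k)
        rw [Fin.val_sub_one_of_ne_zero hi]
      have hi0 : i.val ≠ 0 := fun h => hi (Fin.ext (by simpa using h))
      rw [if_neg hi, hv]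
      congr 1
      exact propext (by omega)

theorem twisted_shift_pow_eq_piDiagonal
    (hx : ∀ (f : Fin k → T) (i : Fin k),
      x f i = if i = 0 then y (f (i - 1)) else f (i - 1)) :
    x ^ k = MulAut.piDiagonal (Fin k) y := by
  ext f i
  rw [twisted_shift_pow_apply hx le_rfl, if_pos i.isLt, Fin.nsmul_eq_zero, sub_zero,
    MulAut.piDiagonal_apply]

theorem twisted_shift_mulSingle
    (hx : ∀ (f : Fin k → T) (i : Fin k),
      x f i = if i = 0 then y (f (i - 1)) else f (i - 1)) (i : Fin k) (t : T) :
    ∃ s, x (Pi.mulSingle i t) = Pi.mulSingle (i + 1) s := by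
  refine ⟨x (Pi.mulSingle i t) (i + 1), ?_⟩
  ext j
  by_cases hj : j = i + 1
  · subst hj
    simp
  · have hj' : j - 1 ≠ i := fun h => hj (sub_eq_iff_eq_add.mp h)
    rw [hx, Pi.mulSingle_eq_of_ne hj, Pi.mulSingle_eq_of_ne hj']
    simp

theorem twisted_shift_commute_piDiagonal
    (hx : ∀ (f : Fin k → T) (i : Fin k),
      x f i = if i = 0 then y (f (i - 1)) else f (i - 1)) {v : MulAut T} (hv : Commute y v) :
    Commute x (MulAut.piDiagonal (Fin k) v) := by
  ext f i
  have hyv : ∀ t, y (v t) = v (y t) := fun t => DFunLike.congr_fun hv.eq t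
  simp only [MulAut.mul_apply, hx, MulAut.piDiagonal_apply]
  split_ifs
  · exact hyv _
  · rfl

theorem gcd_eq_one_of_twisted_shift_eq_pow [IsSimpleGroup T]
    (hx : ∀ (f : Fin k → T) (i : Fin k),
      x f i = if i = 0 then y (f (i - 1)) else f (i - 1))
    {w : MulAut (Fin k → T)} {d : ℕ} (hw : x = w ^ d) {σ : Fin k → Fin k}
    (hσ : ∀ i t, ∃ s, w (Pi.mulSingle i t) = Pi.mulSingle (σ i) s) :
    Nat.gcd d k = 1 ∧ ∀ t, ∃ s, (w ^ k) (Pi.mulSingle 0 t) = Pi.mulSingle 0 s := by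
  have hne : ∀ (u : MulAut (Fin k → T)) {i j l : Fin k},
      (∀ t, ∃ s, u (Pi.mulSingle i t) = Pi.mulSingle j s) →
      (∀ t, ∃ s, u (Pi.mulSingle i t) = Pi.mulSingle l s) → j = l := by
    intro u i j l hj hl
    obtain ⟨t, ht⟩ := exists_ne (1 : T)
    obtain ⟨s, hs⟩ := hj t
    obtain ⟨r, hr⟩ := hl t
    refine Pi.eq_of_mulSingle_eq (t := s) (s := r) ?_ (hs.symm.trans hr)
    rintro rfl
    rw [Pi.mulSingle_one] at hs
    exact ht (by simpa using hs)
  have hcomm : w * x = x * w := by rw [hw, ← pow_succ, ← pow_succ']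
  have hstep : ∀ i, σ (i + 1) = σ i + 1 := by
    intro i
    refine hne (w * x) (i := i) (fun t => ?_) (fun t => ?_)
    · obtain ⟨s, hs⟩ := twisted_shift_mulSingle hx i t
      rw [MulAut.mul_apply, hs]
      exact hσ _ _
    · obtain ⟨s, hs⟩ := hσ i t
      rw [hcomm, MulAut.mul_apply, hs]
      exact twisted_shift_mulSingle hx _ _
  have hnat : ∀ n : ℕ, σ (n • 1) = n • 1 + σ 0 := by
    intro n
    induction n with
    | zero => simp
    | succ n ih => rw [succ_nsmul, hstep, ih, add_right_comm]
  have hadd : ∀ i, σ i = i + σ 0 := by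
    intro i
    have hi : i.val • (1 : Fin k) = i :=
      Fin.ext (by rw [Fin.val_nsmul_one, Nat.mod_eq_of_lt i.isLt])
    simpa only [hi] using hnat i.val
  have hpow : ∀ (n : ℕ) (t : T), ∃ s,
      (w ^ n) (Pi.mulSingle 0 t) = Pi.mulSingle (n • σ 0) s := by
    intro n t
    induction n with
    | zero => exact ⟨t, by simp⟩
    | succ n ih =>
      obtain ⟨s, hs⟩ := ih
      rw [pow_succ', MulAut.mul_apply, hs, succ_nsmul, ← hadd]
      exact hσ _ _
  refine ⟨Fin.gcd_eq_one_of_nsmul_eq_one (s := σ 0) ?_, fun t => ?_⟩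
  · refine hne x (i := 0) (fun t => hw ▸ hpow d t) (fun t => ?_)
    simpa using twisted_shift_mulSingle hx 0 t
  · simpa only [Fin.nsmul_eq_zero] using hpow k t

end TwistedShift

/-- An automorphism of a power of a finite group preserving a factor restricts to an
automorphism of that factor. -/
theorem MulAut.exists_restrict_mulSingle {ι G : Type*} [Group G] [Finite G] [DecidableEq ι]
    {u : MulAut (ι → G)} {i : ι}
    (h : ∀ t, ∃ s, u (Pi.mulSingle i t) = Pi.mulSingle i s) :
    ∃ v : MulAut G, ∀ t, u (Pi.mulSingle i t) = Pi.mulSingle i (v t) := by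
  choose g hg using h
  let φ : G →* G := MonoidHom.mk' g fun a b => Pi.mulSingle_injective (M := fun _ : ι => G) i (by
    rw [← hg, Pi.mulSingle_mul, map_mul, hg, hg, Pi.mulSingle_mul])
  have hinj : Function.Injective φ := fun a b hab => by
    refine Pi.mulSingle_injective (M := fun _ : ι => G) i (u.injective ?_)
    rw [hg, hg]
    exact congrArg _ hab
  exact ⟨MulEquiv.ofBijective φ (Finite.injective_iff_bijective.mp hinj), hg⟩


/-- Let `T` be a nonabelian finite simple group, `k ≥ 1`, `y ∈ Aut(T)`, and
let `x ∈ Aut(T^k)` be the automorphism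
`x(t₁, …, t_k) = (y(t_k), t₁, …, t_{k-1})`. Then for `d > 0`, `x` is a `d`-th
power in `Aut(T^k)` if and only if `gcd(d, k) = 1` and `y` is a `d`-th power
in `Aut(T)`. -/
theorem twisted_shift_is_power_iff (T : Type*) [Group T] [Finite T]
    [IsSimpleGroup T] (hT : ¬ ∀ a b : T, a * b = b * a)
    (k : ℕ) [NeZero k] (y : MulAut T)
    (x : MulAut (Fin k → T))
    (hx : ∀ (f : Fin k → T) (i : Fin k),
      x f i = if i = 0 then y (f (i - 1)) else f (i - 1))
    (d : ℕ) (hd : 0 < d) :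
    (∃ w : MulAut (Fin k → T), x = w ^ d) ↔
      (Nat.gcd d k = 1 ∧ ∃ v : MulAut T, y = v ^ d) := by
  constructor
  · rintro ⟨w, hw⟩
    obtain ⟨σ, hσ⟩ := w.exists_apply_mulSingle_eq_mulSingle hT
    obtain ⟨hgcd, hfix⟩ := gcd_eq_one_of_twisted_shift_eq_pow hx hw hσ
    obtain ⟨v, hv⟩ := MulAut.exists_restrict_mulSingle hfix
    have hvn : ∀ (n : ℕ) (t : T),
        ((w ^ k) ^ n) (Pi.mulSingle 0 t) = Pi.mulSingle 0 ((v ^ n) t) := by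
      intro n t
      induction n with
      | zero => simp
      | succ n ih => rw [pow_succ', MulAut.mul_apply, ih, hv, pow_succ', MulAut.mul_apply]
    refine ⟨hgcd, v, ?_⟩
    ext t
    have h := congrFun (hvn d t) 0
    rw [← pow_mul, mul_comm, pow_mul, ← hw, twisted_shift_pow_eq_piDiagonal hx,
      MulAut.piDiagonal_apply] at h
    simpa using h
  · rintro ⟨hgcd, v, rfl⟩
    have hbez : (d : ℤ) * Nat.gcdA d k + k * Nat.gcdB d k = 1 := by
      rw [← Nat.gcd_eq_gcd_ab, hgcd, Nat.cast_one]
    have hc : Commute x (MulAut.piDiagonal (Fin k) v) :=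
      twisted_shift_commute_piDiagonal hx (Commute.pow_self v d)
    refine ⟨x ^ Nat.gcdA d k * MulAut.piDiagonal (Fin k) v ^ Nat.gcdB d k, ?_⟩
    have hk := twisted_shift_pow_eq_piDiagonal hx
    rw [map_pow] at hk
    rw [(hc.zpow_zpow _ _).mul_pow, ← zpow_natCast, ← zpow_natCast, ← zpow_mul, ← zpow_mul,
      mul_comm (Nat.gcdB d k), zpow_mul _ (d : ℤ), zpow_natCast _ d, ← hk, ← zpow_natCast,
      ← zpow_mul, ← zpow_add, mul_comm _ (d : ℤ), hbez, zpow_one]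
end

section
/- Let T be a nonabelian finite simple group, k ≥ 1 an integer and y ∈ Aut(T); set A = ⟨Inn(T), y⟩ ≤ Aut(T) and assume A is not isomorphic to Sym₆. Let N = T^k be the direct product of k copies of T, identified with Inn(N) ≤ Aut(N), let x ∈ Aut(N) be defined by x(t₁,…,t_k) = (y(t_k), t₁, …, t_{k−1}), and set G_k = ⟨N, x⟩ ≤ Aut(N). Suppose y satisfies: (I) for all nontrivial r, s ∈ A there exists z ∈ A with A = ⟨z⁻¹rz, y⟩ = ⟨z⁻¹sz, y⟩; (II) ⟨y⟩ ∩ T ≠ 1; and (III) if y is a square in Aut(T), then either the order of ⟨y⟩ ∩ T does not divide 4, or A = Inn(T) ≅ Alt₆ and y has order 4. Then the conjugacy class x^{G_k} witnesses u(G_k) ≥ 2; that is, for any two nontrivial elements a, b ∈ G_k there exists g ∈ G_k with G_k = ⟨a, g⁻¹xg⟩ = ⟨b, g⁻¹xg⟩. -/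
section Coordinates

theorem quasiperiodic_add_mul {T : Type*} [Group T] {y : MulAut T} {k : ℤ} {F : ℤ → T}
    (hF : ∀ l, F (l + k) = y⁻¹ (F l)) (l q : ℤ) :
    F (l + k * q) = (y ^ (-q)) (F l) := by
  induction q using Int.induction_on with
  | zero => simp
  | succ q ih =>
    have : l + k * ((q : ℤ) + 1) = (l + k * q) + k := by ring
    rw [this, hF, ih, ← MulAut.mul_apply, neg_add_rev, zpow_add, zpow_neg_one]
  | pred q ih =>
    have h1 : l + k * (-(q : ℤ)) = (l + k * (-(q : ℤ) - 1)) + k := by ring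
    rw [h1, hF] at ih
    rw [show -(-(q : ℤ) - 1) = 1 + -(-(q : ℤ)) by ring, zpow_add, MulAut.mul_apply, ← ih]
    simp

variable {T : Type*} [Group T] (y : MulAut T) (k : ℕ) [NeZero k]

/-- The `l`-th coordinate of `f ∈ T ^ k`, where the coordinates are extended to all integers
by the rule `coord (l + k) = y⁻¹ ∘ coord l`. -/
def coord (l : ℤ) : (Fin k → T) →* T :=
  ((y ^ (-(l / (k : ℤ))) : MulAut T) : T ≃* T).toMonoidHom.comp
    (Pi.evalMonoidHom (fun _ : Fin k => T)
      ⟨(l % (k : ℤ)).toNat, by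
        have h0 : (0 : ℤ) < k := by exact_mod_cast Nat.pos_of_ne_zero (NeZero.ne k)
        have h1 := Int.emod_lt_of_pos l h0
        have h2 := Int.emod_nonneg l h0.ne'
        omega⟩)

variable {y k}

theorem coord_def (l : ℤ) (i : Fin k) (h : l % (k : ℤ) = (i : ℕ)) (f : Fin k → T) :
    coord y k l f = (y ^ (-(l / (k : ℤ)))) (f i) := by
  have : (⟨(l % (k : ℤ)).toNat, by omega⟩ : Fin k) = i := by
    ext; simp [h]
  simp only [coord, MonoidHom.coe_comp, Function.comp, Pi.evalMonoidHom_apply, this]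
  rfl

theorem coord_fin (i : Fin k) (f : Fin k → T) : coord y k (i : ℕ) f = f i := by
  have h : (((i : ℕ) : ℤ)) % (k : ℤ) = (i : ℕ) := by
    rw [Int.emod_eq_of_lt] <;> omega
  have h' : (((i : ℕ) : ℤ)) / (k : ℤ) = 0 := by
    rw [Int.ediv_eq_zero_of_lt] <;> omega
  rw [coord_def _ i h, h']; simp

theorem exists_fin_emod (l : ℤ) : ∃ i : Fin k, l % (k : ℤ) = (i : ℕ) := by
  have h0 : (0 : ℤ) < k := by exact_mod_cast Nat.pos_of_ne_zero (NeZero.ne k)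
  have h1 := Int.emod_lt_of_pos l h0
  have h2 := Int.emod_nonneg l h0.ne'
  exact ⟨⟨(l % (k : ℤ)).toNat, by omega⟩, by simp [h2]⟩

theorem coord_add_mul (l q : ℤ) (f : Fin k → T) :
    coord y k (l + k * q) f = (y ^ (-q)) (coord y k l f) := by
  obtain ⟨i, hi⟩ := exists_fin_emod (k := k) l
  have hk : (k : ℤ) ≠ 0 := by exact_mod_cast NeZero.ne k
  rw [coord_def l i hi, coord_def (l + k * q) i (by rw [Int.add_mul_emod_self_left, hi]),
    Int.add_mul_ediv_left _ _ hk, ← MulAut.mul_apply, ← zpow_add]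
  congr 2; ring

theorem coord_add (l : ℤ) (f : Fin k → T) : coord y k (l + k) f = y⁻¹ (coord y k l f) := by
  simpa using coord_add_mul (y := y) l 1 f

theorem coord_ext {f g : Fin k → T} (h : ∀ l, coord y k l f = coord y k l g) : f = g := by
  funext i
  simpa [coord_fin] using h (i : ℕ)

theorem exists_coord_eq {F : ℤ → T} (hF : ∀ l, F (l + k) = y⁻¹ (F l)) :
    ∃ f : Fin k → T, ∀ l, coord y k l f = F l := by
  refine ⟨fun i => F (i : ℕ), fun l => ?_⟩
  obtain ⟨i, hi⟩ := exists_fin_emod (k := k) l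
  rw [coord_def l i hi, ← hi, ← quasiperiodic_add_mul hF, Int.emod_add_mul_ediv]

/-- Quasiperiodic sequences supported on one residue class. -/
theorem exists_coord_single (i : ℤ) (t : T) : ∃ f : Fin k → T, coord y k i f = t ∧
    ∀ l, ¬ (k : ℤ) ∣ l - i → coord y k l f = 1 := by
  have hk : (k : ℤ) ≠ 0 := by exact_mod_cast NeZero.ne k
  obtain ⟨f, hf⟩ := exists_coord_eq (y := y) (k := k)
    (F := fun l => if (k : ℤ) ∣ l - i then (y ^ (-((l - i) / (k : ℤ)))) t else 1) (by
      intro l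
      have h1 : (k : ℤ) ∣ l + k - i ↔ (k : ℤ) ∣ l - i := by
        rw [show l + k - i = l - i + k by ring]; exact dvd_add_self_right
      have h2 : (l + k - i) / (k : ℤ) = (l - i) / k + 1 := by
        rw [show l + k - i = l - i + k * 1 by ring, Int.add_mul_ediv_left _ _ hk]
      simp only [h1, h2]
      split_ifs
      · rw [neg_add_rev, zpow_add, zpow_neg_one, MulAut.mul_apply]
      · simp)
  exact ⟨f, by simp [hf], fun l hl => by simp [hf, hl]⟩

theorem coord_surjective (l : ℤ) : Function.Surjective (coord y k l) := fun t =>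
  let ⟨f, hf, _⟩ := exists_coord_single (y := y) (k := k) l t
  ⟨f, hf⟩

theorem coord_shift {x : MulAut (Fin k → T)}
    (hx : ∀ (f : Fin k → T) (i : Fin k),
      x f i = if i = 0 then y (f (i - 1)) else f (i - 1)) (l : ℤ) (f : Fin k → T) :
    coord y k l (x f) = coord y k (l - 1) f := by
  obtain ⟨i, hi⟩ := exists_fin_emod (k := k) l
  have hk : (k : ℤ) ≠ 0 := by exact_mod_cast NeZero.ne k
  have hk0 : 0 < k := Nat.pos_of_ne_zero (NeZero.ne k)
  have hl : l = i + k * (l / k) := by rw [← hi, Int.emod_add_mul_ediv]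
  have key : x f i = coord y k ((i : ℕ) - 1) f := by
    rw [hx]
    split_ifs with h
    · subst h
      have h1 : (((0 : Fin k) : ℕ) : ℤ) - 1 = (((0 - 1 : Fin k) : ℕ) : ℤ) + k * (-1) := by
        have : ((0 - 1 : Fin k) : ℕ) = k - 1 := by
          obtain ⟨m, rfl⟩ : ∃ m, k = m + 1 := ⟨k - 1, by omega⟩
          rcases m with _ | m
          · rfl
          · simp
        rw [this]; simp; omega
      rw [h1, coord_add_mul, coord_fin]; simp
    · have h1 : (((i : ℕ) : ℤ)) - 1 = (((i - 1 : Fin k) : ℕ) : ℤ) := by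
        have hne : (i : ℕ) ≠ 0 := fun h' => h (Fin.ext (by simpa using h'))
        have hk1 : 1 < k := by omega
        have h1 : (((1 : Fin k)) : ℕ) = 1 := by
          rw [Fin.val_one', Nat.mod_eq_of_lt hk1]
        rw [Fin.sub_val_of_le (by rw [Fin.le_def, h1]; omega), h1]
        omega
      rw [h1, coord_fin]
  have e1 : coord y k l (x f) = (y ^ (-(l / (k : ℤ)))) (x f i) := coord_def l i hi _
  rw [e1, key, ← coord_add_mul]
  congr 2; omega

end Coordinates

section HasCoord

variable {T : Type*} [Group T] {k : ℕ} [NeZero k] {y : MulAut T}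

/-- `a` acts on `T ^ k` by shifting the coordinates by `j` and then applying the automorphism
`α l` to the `l`-th coordinate. -/
def HasCoord (y : MulAut T) (a : MulAut (Fin k → T)) (j : ℤ) (α : ℤ → MulAut T) : Prop :=
  ∀ l f, coord y k l (a f) = α l (coord y k (l - j) f)

variable {a b : MulAut (Fin k → T)} {j j' : ℤ} {α β : ℤ → MulAut T}

theorem HasCoord.one : HasCoord y (1 : MulAut (Fin k → T)) 0 1 := fun l f => by simp

theorem HasCoord.mul (ha : HasCoord y a j α) (hb : HasCoord y b j' β) :
    HasCoord y (a * b) (j + j') (fun l => α l * β (l - j)) := fun l f => by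
  rw [MulAut.mul_apply, ha, hb, sub_sub, MulAut.mul_apply]

theorem HasCoord.inv (ha : HasCoord y a j α) :
    HasCoord y a⁻¹ (-j) (fun l => (α (l + j))⁻¹) := fun l f => by
  have h := ha (l + j) (a⁻¹ f)
  rw [MulAut.apply_inv_self, add_sub_cancel_right] at h
  rw [sub_neg_eq_add, h, MulAut.inv_apply_self]

theorem hasCoord_conj (n : Fin k → T) :
    HasCoord y (MulAut.conj n) 0 (fun l => MulAut.conj (coord y k l n)) := fun l f => by
  simp

theorem HasCoord.congr (ha : HasCoord y a j α) (hj : j = j') (h : ∀ l, α l = β l) :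
    HasCoord y a j' β := by
  subst hj
  rwa [← show α = β from funext h]

theorem HasCoord.sub_mul (ha : HasCoord y a j α) (q : ℤ) :
    HasCoord y a (j - k * q) (fun l => α l * y ^ q) := fun l f => by
  rw [ha, show l - (j - k * q) = l - j + k * q by ring, coord_add_mul, MulAut.mul_apply]
  simp

theorem HasCoord.ext (ha : HasCoord y a j α) (hb : HasCoord y b j α) : a = b := by
  ext f : 1
  exact coord_ext (y := y) fun l => by rw [ha, hb]

theorem HasCoord.unique (ha : HasCoord y a j α) (hb : HasCoord y a j β) (l : ℤ) :
    α l = β l := by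
  ext t
  obtain ⟨f, rfl⟩ := coord_surjective (y := y) (k := k) (l - j) t
  rw [← ha, ← hb]

theorem HasCoord.add_period (ha : HasCoord y a j α) (l : ℤ) : α (l + k) = y⁻¹ * α l * y := by
  ext t
  obtain ⟨f, rfl⟩ := coord_surjective (y := y) (k := k) (l + k - j) t
  rw [← ha, coord_add, ha, show l + k - j = l - j + k by ring, coord_add]
  simp

theorem HasCoord.exists_ne_one (ha : HasCoord y a 0 α) (h : a ≠ 1) : ∃ l, α l ≠ 1 := by
  by_contra! h'
  exact h (HasCoord.ext (ha.congr rfl h') HasCoord.one)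

theorem HasCoord.conj_inv_mul (ha : HasCoord y a j α) (g : Fin k → T) :
    HasCoord y ((MulAut.conj g)⁻¹ * a * MulAut.conj g) j (fun l =>
      (MulAut.conj (coord y k l g))⁻¹ * α l * MulAut.conj (coord y k (l - j) g)) :=
  (((hasCoord_conj g).inv.mul ha).mul (hasCoord_conj g)).congr (by ring) fun l => by
    simp

variable {x : MulAut (Fin k → T)}
  (hx : ∀ (f : Fin k → T) (i : Fin k), x f i = if i = 0 then y (f (i - 1)) else f (i - 1))
include hx

theorem hasCoord_shift : HasCoord y x 1 1 := fun l f => by simp [coord_shift hx]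

theorem hasCoord_shift_pow (q : ℕ) : HasCoord y (x ^ q) q 1 := by
  induction q with
  | zero => simpa using HasCoord.one
  | succ q ih =>
    rw [pow_succ]
    exact (ih.mul (hasCoord_shift hx)).congr (by push_cast; rfl) fun l => by simp

theorem hasCoord_shift_zpow (q : ℤ) : HasCoord y (x ^ q) q 1 := by
  obtain ⟨q, rfl | rfl⟩ := q.eq_nat_or_neg
  · simpa using hasCoord_shift_pow hx q
  · rw [zpow_neg, zpow_natCast]
    exact (hasCoord_shift_pow hx q).inv.congr rfl fun l => by simp

theorem hasCoord_shift_pow_mul (q : ℤ) : HasCoord y (x ^ (k * q)) 0 (fun _ => y ^ q) :=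
  ((hasCoord_shift_zpow hx (k * q)).sub_mul q).congr (by ring) fun l => by simp

theorem hasCoord_shift_pow_self : HasCoord y (x ^ k) 0 (fun _ => y) := by
  simpa using hasCoord_shift_pow_mul hx 1

/-- Elements of `G_k` have coordinates in `A`. -/
theorem exists_hasCoord {A : Subgroup (MulAut T)} (hA : MulAut.conj.range ≤ A)
    (ha : a ∈ (MulAut.conj : (Fin k → T) →* MulAut (Fin k → T)).range ⊔ Subgroup.zpowers x) :
    ∃ j α, HasCoord y a j α ∧ ∀ l, α l ∈ A := by
  let S : Subgroup (MulAut (Fin k → T)) :=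
    { carrier := {a | ∃ j α, HasCoord y a j α ∧ ∀ l, α l ∈ A}
      one_mem' := ⟨0, 1, HasCoord.one, fun l => one_mem A⟩
      mul_mem' := by
        rintro a b ⟨j, α, h, hα⟩ ⟨j', β, h', hβ⟩
        exact ⟨_, _, h.mul h', fun l => mul_mem (hα _) (hβ _)⟩
      inv_mem' := by
        rintro a ⟨j, α, h, hα⟩
        exact ⟨_, _, h.inv, fun l => inv_mem (hα _)⟩ }
  suffices h : MulAut.conj.range ⊔ Subgroup.zpowers x ≤ S from h ha
  refine sup_le ?_ ?_
  · rintro _ ⟨n, rfl⟩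
    exact ⟨_, _, hasCoord_conj n, fun l => hA ⟨_, rfl⟩⟩
  · rw [Subgroup.zpowers_le]
    exact ⟨_, _, hasCoord_shift hx, fun l => one_mem A⟩

end HasCoord

section SimpleGroup

variable {T : Type*} [Group T]

theorem mul_conj_mul_inv (ψ : MulAut T) (t : T) :
    ψ * MulAut.conj t * ψ⁻¹ = MulAut.conj (ψ t) := by
  ext s
  simp

theorem apply_eq_of_commute_conj {ψ : MulAut T} {v : T}
    (hinj : Function.Injective (MulAut.conj : T → MulAut T))
    (h : Commute ψ (MulAut.conj v)) : ψ v = v := by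
  apply hinj
  rw [← mul_conj_mul_inv, h.eq, mul_inv_cancel_right]

variable [IsSimpleGroup T] (hT : ¬ ∀ a b : T, a * b = b * a)
include hT

theorem conj_injective_of_simple : Function.Injective (MulAut.conj : T → MulAut T) := by
  rw [← MonoidHom.ker_eq_bot_iff]
  rcases (inferInstance : (MulAut.conj : T →* MulAut T).ker.Normal).eq_bot_or_eq_top with h | h
  · exact h
  · refine absurd (fun a b => ?_) hT
    have ha : a ∈ (MulAut.conj : T →* MulAut T).ker := h ▸ Subgroup.mem_top a
    have := DFunLike.congr_fun (MonoidHom.mem_ker.1 ha) b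
    simpa [mul_inv_eq_iff_eq_mul] using this

/-- An automorphism centralizing the inner automorphisms is trivial. -/
theorem eq_one_of_commute {A : Subgroup (MulAut T)} (hA : MulAut.conj.range ≤ A)
    {c y ψ : MulAut T} (hc : Subgroup.closure {c, y} = A) (h1 : Commute ψ c)
    (h2 : Commute ψ y) : ψ = 1 := by
  have h : A ≤ Subgroup.centralizer {ψ} := by
    rw [← hc, Subgroup.closure_le]
    rintro _ (rfl | rfl)
    · exact Subgroup.mem_centralizer_singleton_iff.2 h1.symm
    · exact Subgroup.mem_centralizer_singleton_iff.2 h2.symm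
  ext t
  have := Subgroup.mem_centralizer_singleton_iff.1 (h (hA ⟨t, rfl⟩))
  exact apply_eq_of_commute_conj (conj_injective_of_simple hT) this.symm

/-- A subgroup of `T ^ k` that projects onto each factor and separates any two
of them is everything. -/
theorem eq_top_of_surjective_of_separates {k : ℕ} {M : Subgroup (Fin k → T)}
    (hsurj : ∀ l t, ∃ n ∈ M, n l = t)
    (hsep : ∀ l l', l ≠ l' → ∃ n ∈ M, n l' = 1 ∧ n l ≠ 1) : M = ⊤ := by
  have key : ∀ (l : Fin k) (S : Finset (Fin k)), l ∉ S →
      ∀ t, ∃ n ∈ M, n l = t ∧ ∀ s ∈ S, n s = 1 := by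
    intro l
    have alt : ∀ S : Finset (Fin k), (∀ n ∈ M, (∀ s ∈ S, n s = 1) → n l = 1) ∨
        ∀ t, ∃ n ∈ M, n l = t ∧ ∀ s ∈ S, n s = 1 := by
      intro S
      let K : Subgroup T := (M ⊓ Subgroup.pi (S : Set (Fin k)) (fun _ => ⊥)).map
        (Pi.evalMonoidHom _ l)
      have hK : K.Normal := by
        refine ⟨?_⟩
        rintro _ ⟨n, ⟨hn, hn'⟩, rfl⟩ t
        obtain ⟨m, hm, rfl⟩ := hsurj l t
        refine ⟨m * n * m⁻¹, ⟨M.mul_mem (M.mul_mem hm hn) (M.inv_mem hm), fun s hs => ?_⟩, by simp⟩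
        have := hn' s hs
        simp_all
      rcases hK.eq_bot_or_eq_top with h | h
      · left
        intro n hn hn'
        have : n l ∈ K := ⟨n, ⟨hn, fun s hs => hn' s hs⟩, rfl⟩
        simpa [h] using this
      · right
        intro t
        obtain ⟨n, ⟨hn, hn'⟩, h⟩ : t ∈ K := h ▸ Subgroup.mem_top t
        exact ⟨n, hn, h, fun s hs => hn' s hs⟩
    intro S
    induction S using Finset.induction_on with
    | empty => intro _ t; simpa using hsurj l t
    | insert s S _ ih =>
      intro hl
      rw [Finset.mem_insert, not_or] at hl
      refine (alt (insert s S)).resolve_left fun hbad => hT ?_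
      have hs : ∀ t, ∃ n ∈ M, n l = t ∧ n s = 1 := by
        have := (alt {s}).resolve_left (by
          obtain ⟨n, hn, h1, h2⟩ := hsep l s hl.1
          exact fun h => h2 (h n hn (by simpa using h1)))
        simpa using this
      intro t t'
      obtain ⟨n, hn, rfl, hnS⟩ := ih hl.2 t
      obtain ⟨m, hm, rfl, hms⟩ := hs t'
      have := hbad (n * m * n⁻¹ * m⁻¹)
        (mul_mem (mul_mem (mul_mem hn hm) (inv_mem hn)) (inv_mem hm)) (by
          intro r hr
          rcases Finset.mem_insert.1 hr with rfl | hr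
          · simp [hms]
          · simp [hnS r hr])
      simpa [mul_inv_eq_iff_eq_mul] using this
  rw [eq_top_iff]
  intro f _
  refine Subgroup.pi_mem_of_mulSingle_mem f fun l => ?_
  obtain ⟨n, hn, hnl, hn'⟩ := key l (Finset.univ.erase l) (by simp) (f l)
  convert hn
  funext s
  by_cases hs : s = l
  · subst hs; simp [hnl]
  · simp [hs, hn' s (by simp [hs])]

end SimpleGroup

section Criterion

/-- The `i`-th coordinates of the elements of `H` that do not shift. -/
def baseCoord {T : Type*} [Group T] {k : ℕ} [NeZero k] (y : MulAut T)
    (H : Subgroup (MulAut (Fin k → T))) (i : ℤ) : Subgroup (MulAut T) where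
  carrier := {α | ∃ h ∈ H, ∃ c, HasCoord y h 0 c ∧ c i = α}
  one_mem' := ⟨1, H.one_mem, 1, HasCoord.one, rfl⟩
  mul_mem' := by
    rintro _ _ ⟨h, hh, c, hc, rfl⟩ ⟨h', hh', c', hc', rfl⟩
    exact ⟨h * h', H.mul_mem hh hh', _, (hc.mul hc').congr (add_zero 0) fun _ => rfl, by rw [sub_zero]⟩
  inv_mem' := by
    rintro _ ⟨h, hh, c, hc, rfl⟩
    exact ⟨h⁻¹, H.inv_mem hh, _, hc.inv.congr neg_zero fun _ => rfl, by rw [add_zero]⟩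

variable {T : Type*} [Group T] [Finite T] {k : ℕ} [NeZero k] {y : MulAut T}

/-- Two surjections on `T`, the first of which factors through the second, differ by an
automorphism of `T`. -/
theorem exists_mulAut_of_ker_le {M : Type*} [Group M] {p q : M →* T}
    (hp : Function.Surjective p) (hq : Function.Surjective q) (h : q.ker ≤ p.ker) :
    ∃ φ : MulAut T, ∀ n, p n = φ (q n) := by
  let f : T →* T := q.liftOfSurjective hq ⟨p, h⟩
  have hf : ∀ n, f (q n) = p n := fun n => MonoidHom.liftOfRightInverse_comp_apply _ _ _ _ _
  have hs : Function.Surjective f := fun t => by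
    obtain ⟨n, rfl⟩ := hp t
    exact ⟨q n, hf n⟩
  exact ⟨MulEquiv.ofBijective f (Finite.injective_iff_bijective.1
    (Finite.injective_iff_surjective.2 hs)), fun n => (hf n).symm⟩

variable [IsSimpleGroup T] (hT : ¬ ∀ a b : T, a * b = b * a)
  {x : MulAut (Fin k → T)}
  (hx : ∀ (f : Fin k → T) (i : Fin k), x f i = if i = 0 then y (f (i - 1)) else f (i - 1))
  {A : Subgroup (MulAut T)} (hA : MulAut.conj.range ≤ A)
  {v : T} (hv : v ≠ 1) (hvy : MulAut.conj v ∈ Subgroup.zpowers y)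
include hT hx hA hv hvy

/-- A subgroup containing `x` and a base element with a coordinate that together with `y`
generates `A` is either `G_k` or its coordinates are tied together with a period `k / d`. -/
theorem eq_or_exists_prime {H : Subgroup (MulAut (Fin k → T))} (hxH : x ∈ H)
    (hHG : H ≤ MulAut.conj.range ⊔ Subgroup.zpowers x)
    {h : MulAut (Fin k → T)} (hh : h ∈ H) {c : ℤ → MulAut T} (hc : HasCoord y h 0 c)
    {i : ℤ} (hi : Subgroup.closure {c i, y} = A) :
    H = MulAut.conj.range ⊔ Subgroup.zpowers x ∨
      ∃ (d e : ℕ) (φ : MulAut T), d.Prime ∧ d * e = k ∧ φ ^ d = y⁻¹ ∧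
        ∀ h' ∈ H, ∀ c', HasCoord y h' 0 c' → ∀ l, c' (l + e) = φ * c' l * φ⁻¹ := by
  set M : Subgroup (Fin k → T) := H.comap MulAut.conj with hM
  have stab : ∀ h ∈ H, ∀ n ∈ M, h n ∈ M := by
    intro h hh n hn
    change MulAut.conj (h n) ∈ H
    rw [← mul_conj_mul_inv]
    exact mul_mem (mul_mem hh hn) (inv_mem hh)
  have surj_i : ∀ t, ∃ n ∈ M, coord y k i n = t := by
    have hS : A ≤ baseCoord y H i := by
      rw [← hi, Subgroup.closure_le]
      rintro _ (rfl | rfl)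
      · exact ⟨h, hh, c, hc, rfl⟩
      · exact ⟨x ^ k, pow_mem hxH k, _, hasCoord_shift_pow_self hx, rfl⟩
    have hQ : (M.map (coord y k i)).Normal := by
      refine ⟨?_⟩
      rintro _ ⟨n, hn, rfl⟩ t
      obtain ⟨h, hh, c, hc, hci⟩ := hS (hA ⟨t, rfl⟩)
      refine ⟨h n, stab h hh n hn, ?_⟩
      rw [hc, sub_zero, hci, MulAut.conj_apply]
    have hne : M.map (coord y k i) ≠ ⊥ := by
      have hyv : y v = v := by
        obtain ⟨m, hm⟩ := hvy
        refine apply_eq_of_commute_conj (conj_injective_of_simple hT) ?_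
        rw [← hm]
        exact (Commute.refl y).zpow_right m
      obtain ⟨f, hf⟩ := exists_coord_eq (y := y) (k := k) (F := fun _ => v) (by
        intro l
        rw [MulAut.inv_apply, MulEquiv.eq_symm_apply, hyv])
      obtain ⟨m, hm⟩ := hvy
      have hfM : f ∈ M := by
        change MulAut.conj f ∈ H
        rw [((hasCoord_conj f).congr rfl fun l => by rw [hf, ← hm]).ext
          (hasCoord_shift_pow_mul hx m)]
        exact zpow_mem hxH _
      intro hbot
      have : coord y k i f ∈ M.map (coord y k i) := ⟨f, hfM, rfl⟩
      rw [hbot, hf, Subgroup.mem_bot] at this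
      exact hv this
    intro t
    have := hQ.eq_bot_or_eq_top.resolve_left hne
    exact (this ▸ Subgroup.mem_top t : t ∈ M.map (coord y k i))
  have shift : ∀ (l m : ℤ), ∀ n ∈ M, ∃ n' ∈ M, ∀ q, coord y k (l + q) n' = coord y k (m + q) n :=
    fun l m n hn => ⟨(x ^ (l - m)) n, stab _ (zpow_mem hxH _) n hn, fun q => by
      rw [hasCoord_shift_zpow hx]
      simp only [Pi.one_apply, MulAut.one_apply]
      congr 2; ring⟩
  have surj : ∀ l t, ∃ n ∈ M, coord y k l n = t := by
    intro l t
    obtain ⟨n, hn, rfl⟩ := surj_i t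
    obtain ⟨n', hn', h⟩ := shift l i n hn
    exact ⟨n', hn', by simpa using h 0⟩
  by_cases hsep : ∀ l l' : Fin k, l ≠ l' → ∃ n ∈ M, n l' = 1 ∧ n l ≠ 1
  · left
    have hMtop := eq_top_of_surjective_of_separates hT
      (fun l t => by simpa [coord_fin] using surj (l : ℕ) t) hsep
    refine le_antisymm hHG (sup_le ?_ ((Subgroup.zpowers_le).2 hxH))
    rintro _ ⟨n, rfl⟩
    exact (hMtop ▸ Subgroup.mem_top n : n ∈ M)
  right
  push Not at hsep
  obtain ⟨l₁, l₀, hne, hker⟩ := hsep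
  let D : AddSubgroup ℤ :=
    { carrier := {δ | ∃ φ : MulAut T, ∀ l, ∀ n ∈ M, coord y k (l + δ) n = φ (coord y k l n)}
      zero_mem' := ⟨1, fun l n _ => by simp⟩
      add_mem' := by
        rintro δ ε ⟨φ, hφ⟩ ⟨ψ, hψ⟩
        exact ⟨ψ * φ, fun l n hn => by rw [← add_assoc, hψ _ n hn, hφ _ n hn, MulAut.mul_apply]⟩
      neg_mem' := by
        rintro δ ⟨φ, hφ⟩
        refine ⟨φ⁻¹, fun l n hn => ?_⟩
        rw [MulAut.inv_apply, MulEquiv.eq_symm_apply, ← hφ _ n hn, neg_add_cancel_right] }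
  have hkD : (k : ℤ) ∈ D := ⟨y⁻¹, fun l n _ => coord_add l n⟩
  have hδD : ((l₁ : ℕ) : ℤ) - (l₀ : ℕ) ∈ D := by
    obtain ⟨φ, hφ⟩ := exists_mulAut_of_ker_le (M := M)
      (p := (coord y k (l₁ : ℕ)).comp M.subtype) (q := (coord y k (l₀ : ℕ)).comp M.subtype)
      (fun t => by
        obtain ⟨n, hn, h⟩ := surj (l₁ : ℕ) t
        exact ⟨⟨n, hn⟩, h⟩)
      (fun t => by
        obtain ⟨n, hn, h⟩ := surj (l₀ : ℕ) t
        exact ⟨⟨n, hn⟩, h⟩)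
      (by
        rintro ⟨n, hn⟩ h
        rw [MonoidHom.mem_ker] at h ⊢
        simpa [coord_fin] using hker n hn (by simpa [coord_fin] using h))
    refine ⟨φ, fun l n hn => ?_⟩
    obtain ⟨n', hn', h⟩ := shift (l₀ : ℕ) l n hn
    rw [← h, show ((l₀ : ℕ) : ℤ) + ((l₁ : ℕ) - (l₀ : ℕ)) = (l₁ : ℕ) by ring]
    have h0 := h 0
    rw [add_zero, add_zero] at h0
    rw [← h0]
    exact hφ ⟨n', hn'⟩
  set δ : ℤ := ((l₁ : ℕ) : ℤ) - (l₀ : ℕ) with hδ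
  have hk0 : k ≠ 0 := NeZero.ne k
  have hgD : (Int.gcd δ k : ℤ) ∈ D := by
    rw [Int.gcd_eq_gcd_ab, mul_comm δ, mul_comm (k : ℤ), ← smul_eq_mul, ← smul_eq_mul]
    exact add_mem (D.zsmul_mem hδD _) (D.zsmul_mem hkD _)
  have hδ0 : δ ≠ 0 := fun h => hne (Fin.ext (by omega))
  have hgk : Int.gcd δ k ∣ k := by exact_mod_cast Int.gcd_dvd_right δ (k : ℤ)
  have hgδ : Int.gcd δ k ∣ δ.natAbs := by
    have := Int.gcd_dvd_left δ (k : ℤ)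
    exact Int.natCast_dvd.1 this
  obtain ⟨g, hg⟩ := hgk
  have hg1 : g ≠ 1 := by
    rintro rfl
    have := Nat.le_of_dvd (by omega) hgδ
    omega
  obtain ⟨d, hd, e', rfl⟩ := Nat.exists_prime_and_dvd hg1
  obtain ⟨φ, hφ⟩ : ((Int.gcd δ k * e' : ℕ) : ℤ) ∈ D := by
    rw [Nat.cast_mul, mul_comm, ← smul_eq_mul]
    exact D.zsmul_mem hgD _
  have hde : d * (Int.gcd δ k * e') = k := by conv_rhs => rw [hg]
                                              ring
  set e := Int.gcd δ k * e'
  refine ⟨d, e, φ, hd, hde, ?_, ?_⟩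
  · have hm : ∀ m : ℕ, ∀ l, ∀ n ∈ M, coord y k (l + m * e) n = (φ ^ m) (coord y k l n) := by
      intro m
      induction m with
      | zero => simp
      | succ m ih =>
        intro l n hn
        rw [show l + ((m + 1 : ℕ) : ℤ) * e = l + m * e + e by push_cast; ring, hφ _ n hn, ih _ n hn,
          pow_succ', MulAut.mul_apply]
    ext t
    obtain ⟨n, hn, rfl⟩ := surj 0 t
    rw [← hm d 0 n hn, ← coord_add]
    congr 2
    exact_mod_cast congrArg (fun z => 0 + z) hde
  · intro h' hh' c' hc' l
    rw [eq_mul_inv_iff_mul_eq]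
    ext t
    obtain ⟨n, hn, rfl⟩ := surj l t
    rw [MulAut.mul_apply, MulAut.mul_apply, ← hφ l n hn]
    have h1 := hφ l _ (stab h' hh' n hn)
    rw [hc', hc', sub_zero, sub_zero] at h1
    exact h1

end Criterion

section Testers

variable {T : Type*} [Group T] {k : ℕ} [NeZero k]

/-- `x` together with the conjugate of `a` by `g` generates the group `G_k`. -/
def Gen (x a : MulAut (Fin k → T)) (g : Fin k → T) : Prop :=
  Subgroup.closure {(MulAut.conj g)⁻¹ * a * MulAut.conj g, x} =
    MulAut.conj.range ⊔ Subgroup.zpowers x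

/-- The coordinates of the non-shifting elements of `⟨a ^ g, x⟩` at places that differ by `e`
are tied together by `φ`. -/
def Tied (y : MulAut T) (x a : MulAut (Fin k → T)) (g : Fin k → T) (e : ℕ) (φ : MulAut T) :
    Prop :=
  ∀ h ∈ Subgroup.closure {(MulAut.conj g)⁻¹ * a * MulAut.conj g, x}, ∀ c,
    HasCoord y h 0 c → ∀ l, c (l + e) = φ * c l * φ⁻¹

/-- `C g` are the coordinates of some non-shifting element of `⟨a ^ g, x⟩` that depends on `g`
in a controlled way. -/
structure IsTester (y : MulAut T) (x a : MulAut (Fin k → T)) (j : ℤ)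
    (C : (Fin k → T) → ℤ → MulAut T) : Prop where
  exists_mem : ∀ g, ∃ h ∈ Subgroup.closure {(MulAut.conj g)⁻¹ * a * MulAut.conj g, x},
    HasCoord y h 0 (C g)
  mul_fixed : ∀ g u, (∀ l, y (coord y k l u) = coord y k l u) → ∀ l,
    C (g * u) l = (MulAut.conj (coord y k l u))⁻¹ * C g l * MulAut.conj (coord y k l u)
  eq_conj : ∀ g l, (j ≠ 0 → coord y k (l - j) g = 1) →
    C g l = (MulAut.conj (coord y k l g))⁻¹ * C 1 l * MulAut.conj (coord y k l g)

variable {y : MulAut T} {x a : MulAut (Fin k → T)} {j : ℤ} {α : ℤ → MulAut T}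

theorem IsTester.tied {C : (Fin k → T) → ℤ → MulAut T} (hC : IsTester y x a j C)
    {g : Fin k → T} {e : ℕ} {φ : MulAut T} (h : Tied y x a g e φ) (l : ℤ) :
    C g (l + e) = φ * C g l * φ⁻¹ :=
  let ⟨h', hh', hc⟩ := hC.exists_mem g
  h h' hh' _ hc l

theorem isTester_of_base (ha : HasCoord y a 0 α) :
    IsTester y x a 0 (fun g l =>
      (MulAut.conj (coord y k l g))⁻¹ * α l * MulAut.conj (coord y k l g)) where
  exists_mem g := ⟨_, Subgroup.subset_closure (Set.mem_insert _ _),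
    (ha.conj_inv_mul g).congr rfl fun l => by rw [sub_zero]⟩
  mul_fixed g u _ l := by simp [mul_assoc]
  eq_conj g l _ := by simp

theorem commute_conj_of_fixed {u : T} (hu : y u = u) : Commute y (MulAut.conj u) := by
  have := mul_conj_mul_inv y u
  rwa [hu, mul_inv_eq_iff_eq_mul] at this

theorem isTester_of_shift
    (hx : ∀ (f : Fin k → T) (i : Fin k), x f i = if i = 0 then y (f (i - 1)) else f (i - 1))
    (hj : j ≠ 0) (ha : HasCoord y a j α) :
    IsTester y x a j (fun g l =>
      ((MulAut.conj (coord y k l g))⁻¹ * α l * MulAut.conj (coord y k (l - j) g)) * y *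
      ((MulAut.conj (coord y k l g))⁻¹ * α l * MulAut.conj (coord y k (l - j) g))⁻¹) where
  exists_mem g := by
    have h1 := ha.conj_inv_mul g
    have ha' := Subgroup.subset_closure
      (Set.mem_insert ((MulAut.conj g)⁻¹ * a * MulAut.conj g) {x})
    have hx' := Subgroup.subset_closure
      (Set.mem_insert_of_mem ((MulAut.conj g)⁻¹ * a * MulAut.conj g) (Set.mem_singleton x))
    refine ⟨_, mul_mem (mul_mem ha' (pow_mem hx' k)) (inv_mem ha'),
      ((h1.mul (hasCoord_shift_pow_self hx)).mul h1.inv).congr (by ring) fun l => ?_⟩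
    simp only [add_zero, sub_add_cancel]
  mul_fixed g u hu l := by
    have h := (commute_conj_of_fixed (hu (l - j))).eq
    simp only [map_mul]
    generalize MulAut.conj (coord y k (l - j) u) = w at *
    have h' : w * y * w⁻¹ = y := by rw [← h, mul_inv_cancel_right]
    calc _ = (MulAut.conj (coord y k l u))⁻¹ * ((MulAut.conj (coord y k l g))⁻¹ * α l *
        MulAut.conj (coord y k (l - j) g) * (w * y * w⁻¹) * ((MulAut.conj (coord y k l g))⁻¹ *
        α l * MulAut.conj (coord y k (l - j) g))⁻¹) * MulAut.conj (coord y k l u) := by group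
      _ = _ := by rw [h']
  eq_conj g l h := by
    simp [h hj, mul_assoc]

end Testers

section Commuting

/-- Among three candidates, at most one of which is excluded for each of two reasons, there is an
admissible one. -/
theorem exists_not_and_not {ι : Type*} {P Q : ι → Prop} (u v w : ι)
    (huv : ¬ (P u ∧ P v) ∧ ¬ (Q u ∧ Q v)) (huw : ¬ (P u ∧ P w) ∧ ¬ (Q u ∧ Q w))
    (hvw : ¬ (P v ∧ P w) ∧ ¬ (Q v ∧ Q w)) : ∃ i, ¬ P i ∧ ¬ Q i := by
  by_contra! h
  have := h u
  have := h v
  have := h w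
  tauto

variable {T : Type*} [Group T] {y V : MulAut T}

/-- `V ^ p` conjugates `c'` to a conjugate of `c` by a `d`-th root of `y⁻¹`. -/
def ConjByRoot (y V c c' : MulAut T) (d p : ℕ) (φ : MulAut T) : Prop :=
  φ ^ d = y⁻¹ ∧ (V ^ p)⁻¹ * c' * V ^ p = φ * c * φ⁻¹

theorem commute_of_pow_eq_inv {φ : MulAut T} {d : ℕ} (h : φ ^ d = y⁻¹) : Commute φ y := by
  have := (Commute.refl φ).pow_right d
  rw [h] at this
  simpa using this.inv_right

theorem commute_of_mem_zpowers {w : MulAut T} (hw : Commute w y) (hV : V ∈ Subgroup.zpowers y) :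
    Commute w V := by
  obtain ⟨m, rfl⟩ := hV
  exact hw.zpow_right m

theorem ConjByRoot.conj_eq (hV : V ∈ Subgroup.zpowers y) {c c' : MulAut T} {d p : ℕ}
    {φ : MulAut T} (h : ConjByRoot y V c c' d p φ) :
    c' = (V ^ p * φ) * c * (V ^ p * φ)⁻¹ ∧ Commute (V ^ p * φ) y := by
  refine ⟨?_, ?_⟩
  · have := h.2
    rw [mul_inv_rev]
    calc c' = V ^ p * ((V ^ p)⁻¹ * c' * V ^ p) * (V ^ p)⁻¹ := by group
      _ = _ := by rw [this]; group
  · exact ((commute_of_mem_zpowers (Commute.refl y) hV).symm.pow_left p).mul_left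
      (commute_of_pow_eq_inv h.1)

section

variable [IsSimpleGroup T] (hT : ¬ ∀ a b : T, a * b = b * a)
  {A : Subgroup (MulAut T)} (hA : MulAut.conj.range ≤ A)

include hT hA in
theorem eq_of_conj_eq {c w w' : MulAut T} (hc : Subgroup.closure {c, y} = A) (hw : Commute w y)
    (hw' : Commute w' y) (h : w * c * w⁻¹ = w' * c * w'⁻¹) : w = w' := by
  have : w'⁻¹ * w = 1 := by
    refine eq_one_of_commute hT hA hc ?_ (hw'.inv_left.mul_left hw)
    rw [mul_inv_eq_iff_eq_mul] at h
    change w'⁻¹ * w * c = c * (w'⁻¹ * w)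
    rw [mul_assoc, h]
    group
  exact (inv_mul_eq_one.1 this).symm

variable (hV : V ∈ Subgroup.zpowers y) {c c' : MulAut T} {d : ℕ}
include hT hA hV

theorem ConjByRoot.eq (hc : Subgroup.closure {c, y} = A) {p p' : ℕ} {φ φ' : MulAut T}
    (h : ConjByRoot y V c c' d p φ) (h' : ConjByRoot y V c c' d p' φ') :
    V ^ p * φ = V ^ p' * φ' :=
  eq_of_conj_eq hT hA hc (h.conj_eq hV).2 (h'.conj_eq hV).2
    ((h.conj_eq hV).1.symm.trans (h'.conj_eq hV).1)

theorem ConjByRoot.pow_eq (hc : Subgroup.closure {c, y} = A) {p p' : ℕ} {φ φ' : MulAut T}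
    (h : ConjByRoot y V c c' d p φ) (h' : ConjByRoot y V c c' d p' φ') :
    V ^ (p * d) = V ^ (p' * d) := by
  have := congrArg (· ^ d) (h.eq hT hA hV hc h')
  have hφ := (commute_of_mem_zpowers (commute_of_pow_eq_inv h.1) hV).symm.pow_left p
  have hφ' := (commute_of_mem_zpowers (commute_of_pow_eq_inv h'.1) hV).symm.pow_left p'
  simp only [hφ.mul_pow, hφ'.mul_pow, h.1, h'.1, mul_left_inj] at this
  rwa [pow_mul, pow_mul]

/-- Conjugating by a suitable power of `V` prevents two elements from being conjugate under a
square root of `y⁻¹`. -/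
theorem exists_pow_not_conjByRoot_two (hV4 : V ^ 4 ≠ 1) {e e' : MulAut T}
    (hc : Subgroup.closure {c, y} = A) (he : Subgroup.closure {e, y} = A) :
    ∃ r : ℕ, ∀ φ, ¬ ConjByRoot y V c c' 2 r φ ∧ ¬ ConjByRoot y V e e' 2 r φ := by
  have hV2 : V ^ 2 ≠ 1 := fun h => hV4 (by rw [show 4 = 2 * 2 by rfl, pow_mul, h, one_pow])
  have key : ∀ {c c'}, Subgroup.closure {c, y} = A → ∀ p p', V ^ (p * 2) ≠ V ^ (p' * 2) →
      ¬ ((∃ φ, ConjByRoot y V c c' 2 p φ) ∧ ∃ φ, ConjByRoot y V c c' 2 p' φ) := by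
    rintro c c' hc p p' hp ⟨⟨φ, h⟩, φ', h'⟩
    exact hp (h.pow_eq hT hA hV hc h')
  have h01 : V ^ (0 * 2) ≠ V ^ (1 * 2) := by simpa using hV2.symm
  have h02 : V ^ (0 * 2) ≠ V ^ (2 * 2) := by simpa using hV4.symm
  have h12 : V ^ (1 * 2) ≠ V ^ (2 * 2) := fun h => hV2 (by
    have : V ^ 2 * V ^ 2 = V ^ 2 := by rw [← pow_add]; simpa using h.symm
    exact mul_eq_right.1 this)
  obtain ⟨r, h1, h2⟩ := exists_not_and_not
    (P := fun p : ℕ => ∃ φ, ConjByRoot y V c c' 2 p φ)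
    (Q := fun p : ℕ => ∃ φ, ConjByRoot y V e e' 2 p φ) 0 1 2
    ⟨key hc _ _ h01, key he _ _ h01⟩ ⟨key hc _ _ h02, key he _ _ h02⟩
    ⟨key hc _ _ h12, key he _ _ h12⟩
  exact ⟨r, fun φ => ⟨fun h => h1 ⟨φ, h⟩, fun h => h2 ⟨φ, h⟩⟩⟩

theorem exists_pow_not_conjByRoot_two_single (hV2 : V ^ 2 ≠ 1)
    (hc : Subgroup.closure {c, y} = A) : ∃ r : ℕ, ∀ φ, ¬ ConjByRoot y V c c' 2 r φ := by
  by_contra! h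
  obtain ⟨φ, h0⟩ := h 0
  obtain ⟨φ', h1⟩ := h 1
  have := h0.pow_eq hT hA hV hc h1
  exact hV2 (by simpa using this.symm)

theorem exists_pow_not_conjByRoot_odd (hV1 : V ≠ 1) (hd : Odd d)
    {c₀ c₁ c₂ e₀ e₁ e₂ : MulAut T}
    (hc : Subgroup.closure {c₀, y} = A) (he : Subgroup.closure {e₀, y} = A) :
    ∃ p q : ℕ, ∀ φ, φ ^ d = y⁻¹ →
      ¬ ((V ^ p)⁻¹ * c₁ * V ^ p = φ * c₀ * φ⁻¹ ∧ c₀ = φ * ((V ^ q)⁻¹ * c₂ * V ^ q) * φ⁻¹) ∧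
      ¬ ((V ^ p)⁻¹ * e₁ * V ^ p = φ * e₀ * φ⁻¹ ∧ e₀ = φ * ((V ^ q)⁻¹ * e₂ * V ^ q) * φ⁻¹) := by
  let bad : MulAut T → MulAut T → MulAut T → ℕ × ℕ → Prop := fun c₀ c₁ c₂ z => ∃ φ, φ ^ d = y⁻¹ ∧
    (V ^ z.1)⁻¹ * c₁ * V ^ z.1 = φ * c₀ * φ⁻¹ ∧ c₀ = φ * ((V ^ z.2)⁻¹ * c₂ * V ^ z.2) * φ⁻¹
  have key : ∀ {c₀ c₁ c₂}, Subgroup.closure {c₀, y} = A → ∀ z z',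
      (V ^ (z.1 * d) ≠ V ^ (z'.1 * d) ∨ V ^ (z.1 + z.2) ≠ V ^ (z'.1 + z'.2)) →
      ¬ (bad c₀ c₁ c₂ z ∧ bad c₀ c₁ c₂ z') := by
    rintro c₀ c₁ c₂ hc z z' hz ⟨⟨φ, h, h1, h2⟩, φ', h', h1', h2'⟩
    have e1 : ConjByRoot y V c₀ c₁ d z.1 φ := ⟨h, h1⟩
    have e1' : ConjByRoot y V c₀ c₁ d z'.1 φ' := ⟨h', h1'⟩
    rcases hz with hz | hz
    · exact hz (e1.pow_eq hT hA hV hc e1')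
    · have hVy : Commute V y := (commute_of_mem_zpowers (Commute.refl y) hV).symm
      have e2 : V ^ z.2 * φ⁻¹ = V ^ z'.2 * φ'⁻¹ := by
        refine eq_of_conj_eq hT hA hc
          ((hVy.pow_left _).mul_left (commute_of_pow_eq_inv h).inv_left)
          ((hVy.pow_left _).mul_left (commute_of_pow_eq_inv h').inv_left) ?_
        trans c₂
        · rw [h2]; group
        · rw [h2']; group
      have hφ := (commute_of_mem_zpowers (commute_of_pow_eq_inv h) hV).pow_right z.2
      have hφ' := (commute_of_mem_zpowers (commute_of_pow_eq_inv h') hV).pow_right z'.2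
      apply hz
      have := congrArg₂ (· * ·) (e1.eq hT hA hV hc e1') e2
      rw [mul_assoc, ← mul_assoc φ, hφ.eq, mul_inv_cancel_right, mul_assoc (V ^ z'.1),
        ← mul_assoc φ', hφ'.eq, mul_inv_cancel_right] at this
      rwa [pow_add, pow_add]
  suffices h : ∃ z, ¬ bad c₀ c₁ c₂ z ∧ ¬ bad e₀ e₁ e₂ z by
    obtain ⟨z, h1, h2⟩ := h
    exact ⟨z.1, z.2, fun φ hφ => ⟨fun h => h1 ⟨φ, hφ, h⟩, fun h => h2 ⟨φ, hφ, h⟩⟩⟩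
  by_cases hVd : V ^ d = 1
  · have hV2 : V ^ 2 ≠ 1 := by
      intro h
      have h1 := Nat.dvd_gcd (orderOf_dvd_of_pow_eq_one h) (orderOf_dvd_of_pow_eq_one hVd)
      rw [hd.coprime_two_left] at h1
      exact hV1 (orderOf_eq_one_iff.1 (Nat.dvd_one.1 h1))
    have hV12 : V ^ 1 ≠ V ^ 2 := fun h => hV1 (by
      rw [pow_one, pow_two] at h
      exact mul_eq_left.1 h.symm)
    exact exists_not_and_not (0, 0) (0, 1) (0, 2)
      ⟨key hc _ _ (Or.inr (by simpa using hV1.symm)), key he _ _ (Or.inr (by simpa using hV1.symm))⟩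
      ⟨key hc _ _ (Or.inr (by simpa using hV2.symm)), key he _ _ (Or.inr (by simpa using hV2.symm))⟩
      ⟨key hc _ _ (Or.inr (by simpa using hV12)), key he _ _ (Or.inr (by simpa using hV12))⟩
  · exact exists_not_and_not (0, 0) (0, 1) (1, 0)
      ⟨key hc _ _ (Or.inr (by simpa using hV1.symm)), key he _ _ (Or.inr (by simpa using hV1.symm))⟩
      ⟨key hc _ _ (Or.inr (by simpa using hV1.symm)), key he _ _ (Or.inr (by simpa using hV1.symm))⟩
      ⟨key hc _ _ (Or.inl (by simpa using Ne.symm hVd)),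
        key he _ _ (Or.inl (by simpa using Ne.symm hVd))⟩

end

end Commuting

section MainLemma

variable {T : Type*} [Group T] {k : ℕ}

theorem closure_conj_le {x a : MulAut (Fin k → T)}
    (ha : a ∈ (MulAut.conj : (Fin k → T) →* MulAut (Fin k → T)).range ⊔ Subgroup.zpowers x)
    (g : Fin k → T) : Subgroup.closure {(MulAut.conj g)⁻¹ * a * MulAut.conj g, x} ≤
      MulAut.conj.range ⊔ Subgroup.zpowers x := by
  have hg : MulAut.conj g ∈
      (MulAut.conj : (Fin k → T) →* MulAut (Fin k → T)).range ⊔ Subgroup.zpowers x :=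
    Subgroup.mem_sup_left ⟨g, rfl⟩
  rw [Subgroup.closure_le]
  rintro _ (rfl | rfl)
  · exact mul_mem (mul_mem (inv_mem hg) ha) hg
  · exact Subgroup.mem_sup_right (Subgroup.mem_zpowers _)

variable [NeZero k] {y : MulAut T}

/-- An integer sequence of period `k` with prescribed values around `i`. -/
theorem exists_periodic (k : ℕ) [NeZero k] (i : ℤ) (r : ℕ) (p q : ℕ → ℕ) : ∃ ε : ℤ → ℕ,
    (∀ l, ε (l + k) = ε l) ∧ ε i = 0 ∧ (∀ e : ℕ, 2 * e = k → ε (i + e) = r) ∧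
    ∀ e : ℕ, e ≠ 0 → 2 * e < k → ε (i + e) = p e ∧ ε (i - e) = q e := by
  have hk0 : k ≠ 0 := NeZero.ne k
  refine ⟨fun l => if ((l - i) % k).toNat = 0 then 0 else if 2 * ((l - i) % k).toNat < k then
    p ((l - i) % k).toNat else if 2 * ((l - i) % k).toNat = k then r else
      q (k - ((l - i) % k).toNat), fun l => ?_, by simp, fun e he => ?_, fun e h0 he => ⟨?_, ?_⟩⟩
  · have : (l + k - i) % k = (l - i) % k := by
      rw [show l + k - i = l - i + k by ring, Int.add_emod_right]
    simp only [this]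
  · have : ((i + e - i) % k).toNat = e := by
      rw [add_sub_cancel_left, Int.emod_eq_of_lt] <;> omega
    simp only [this]
    rw [if_neg (by omega), if_neg (by omega), if_pos he]
  · have : ((i + e - i) % k).toNat = e := by
      rw [add_sub_cancel_left, Int.emod_eq_of_lt] <;> omega
    simp only [this]
    rw [if_neg h0, if_pos he]
  · have : ((i - e - i) % k).toNat = k - e := by
      rw [show i - (e : ℤ) - i = (k - e : ℤ) + k * (-1) by ring, Int.add_mul_emod_self_left,
        Int.emod_eq_of_lt] <;> omega
    simp only [this]
    rw [if_neg (by omega), if_neg (by omega), if_neg (by omega)]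
    congr 1; omega

variable [Finite T] [IsSimpleGroup T] (hT : ¬ ∀ a b : T, a * b = b * a)
  {x : MulAut (Fin k → T)}
  (hx : ∀ (f : Fin k → T) (i : Fin k), x f i = if i = 0 then y (f (i - 1)) else f (i - 1))
  {A : Subgroup (MulAut T)} (hA : MulAut.conj.range ≤ A)
  {v : T} (hv : v ≠ 1) (hvy : MulAut.conj v ∈ Subgroup.zpowers y)
include hT hx hA hv hvy

/-- If the period `k / 2` can be excluded by a choice of the coordinate `i + k / 2`, then some
conjugates of `a` and of `b` generate `G_k` together with `x`. -/
theorem exists_gen_of_not_tied {a b : MulAut (Fin k → T)}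
    (ha : a ∈ (MulAut.conj : (Fin k → T) →* MulAut (Fin k → T)).range ⊔ Subgroup.zpowers x)
    (hb : b ∈ (MulAut.conj : (Fin k → T) →* MulAut (Fin k → T)).range ⊔ Subgroup.zpowers x)
    {ja jb : ℤ} {C E : (Fin k → T) → ℤ → MulAut T} (hC : IsTester y x a ja C)
    (hE : IsTester y x b jb E) {g₀ : Fin k → T} {i : ℤ}
    (hCi : Subgroup.closure {C g₀ i, y} = A) (hEi : Subgroup.closure {E g₀ i, y} = A)
    (hr : ∃ r : ℕ, ∀ u, (∀ l, y (coord y k l u) = coord y k l u) → coord y k i u = 1 →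
      ∀ e : ℕ, 2 * e = k → coord y k (i + e) u = v ^ r → ∀ φ, φ ^ 2 = y⁻¹ →
      ¬ Tied y x a (g₀ * u) e φ ∧ ¬ Tied y x b (g₀ * u) e φ) :
    ∃ g, Gen x a g ∧ Gen x b g := by
  have hvV : MulAut.conj v ≠ 1 := fun h => hv (conj_injective_of_simple hT (by rw [h, map_one]))
  have hyv : y v = v := apply_eq_of_commute_conj (conj_injective_of_simple hT)
    (commute_of_mem_zpowers (Commute.refl y) hvy)
  obtain ⟨r, hr⟩ := hr
  have hpq : ∀ e : ℕ, ∃ p q : ℕ, ∀ d, Odd d → d * e = k → ∀ φ, φ ^ d = y⁻¹ →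
      ¬ ((MulAut.conj v ^ p)⁻¹ * C g₀ (i + e) * MulAut.conj v ^ p = φ * C g₀ i * φ⁻¹ ∧
        C g₀ i = φ * ((MulAut.conj v ^ q)⁻¹ * C g₀ (i - e) * MulAut.conj v ^ q) * φ⁻¹) ∧
      ¬ ((MulAut.conj v ^ p)⁻¹ * E g₀ (i + e) * MulAut.conj v ^ p = φ * E g₀ i * φ⁻¹ ∧
        E g₀ i = φ * ((MulAut.conj v ^ q)⁻¹ * E g₀ (i - e) * MulAut.conj v ^ q) * φ⁻¹) := by
    intro e
    by_cases h : ∃ d, Odd d ∧ d * e = k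
    · obtain ⟨d, hd, hde⟩ := h
      obtain ⟨p, q, hpq⟩ := exists_pow_not_conjByRoot_odd hT hA hvy hvV hd hCi hEi
      refine ⟨p, q, fun d' _ hde' φ hφ => hpq φ ?_⟩
      have : d' = d := Nat.eq_of_mul_eq_mul_right
        (Nat.pos_of_ne_zero fun h0 => NeZero.ne k (by rw [← hde, h0, mul_zero]))
        (hde'.trans hde.symm)
      rwa [← this]
    · push Not at h
      exact ⟨0, 0, fun d hd hde => absurd hde (h d hd)⟩
  choose p q hpq using hpq
  obtain ⟨ε, hεk, hεi, hεr, hεpq⟩ := exists_periodic k i r p q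
  have hyvε : ∀ n : ℕ, y (v ^ n) = v ^ n := fun n => by rw [map_pow, hyv]
  obtain ⟨u, hu⟩ := exists_coord_eq (y := y) (k := k) (F := fun l => v ^ ε l) (by
    intro l
    rw [hεk, MulAut.inv_apply, MulEquiv.eq_symm_apply, hyvε])
  have hufix : ∀ l, y (coord y k l u) = coord y k l u := fun l => by rw [hu, hyvε]
  have hCu : ∀ {a ja} {C : (Fin k → T) → ℤ → MulAut T}, IsTester y x a ja C → ∀ l, C (g₀ * u) l =
      (MulAut.conj v ^ ε l)⁻¹ * C g₀ l * MulAut.conj v ^ ε l := by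
    intro a ja C hC l
    rw [hC.mul_fixed _ _ hufix, hu, map_pow]
  have main : ∀ {a ja} {C : (Fin k → T) → ℤ → MulAut T},
      a ∈ (MulAut.conj : (Fin k → T) →* MulAut (Fin k → T)).range ⊔ Subgroup.zpowers x →
      IsTester y x a ja C → Subgroup.closure {C g₀ i, y} = A →
      (∀ e : ℕ, 2 * e = k → ∀ φ, φ ^ 2 = y⁻¹ → ¬ Tied y x a (g₀ * u) e φ) →
      (∀ e d, Odd d → d * e = k → ∀ φ, φ ^ d = y⁻¹ →
        ¬ ((MulAut.conj v ^ p e)⁻¹ * C g₀ (i + e) * MulAut.conj v ^ p e = φ * C g₀ i * φ⁻¹ ∧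
          C g₀ i = φ * ((MulAut.conj v ^ q e)⁻¹ * C g₀ (i - e) * MulAut.conj v ^ q e) * φ⁻¹)) →
      Gen x a (g₀ * u) := by
    intro a ja C ha hC hCi h2 hodd
    obtain ⟨h, hh, hc⟩ := hC.exists_mem (g₀ * u)
    have hCi' : C (g₀ * u) i = C g₀ i := by rw [hCu hC, hεi]; simp
    rcases eq_or_exists_prime hT hx hA hv hvy
      (Subgroup.subset_closure (Set.mem_insert_of_mem _ (Set.mem_singleton x)))
      (closure_conj_le ha _) hh hc (i := i) (by rw [hCi', hCi]) with
      h | ⟨d, e, φ, hd, hde, hφ, htied⟩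
    · exact h
    exfalso
    rcases hd.eq_two_or_odd' with rfl | hd'
    · exact h2 e hde φ hφ htied
    · have he0 : e ≠ 0 := fun h0 => NeZero.ne k (by rw [← hde, h0, mul_zero])
      have h2e : 2 * e < k := by
        rw [← hde]
        refine Nat.mul_lt_mul_of_pos_right ?_ (Nat.pos_of_ne_zero he0)
        refine lt_of_le_of_ne hd.two_le fun h => ?_
        rw [← h] at hd'
        exact absurd hd' (by decide)
      refine hodd e d hd' hde φ hφ ⟨?_, ?_⟩
      · rw [← (hεpq e he0 h2e).1, ← hCu hC, hC.tied htied, hCi']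
      · rw [← (hεpq e he0 h2e).2, ← hCu hC, ← hC.tied htied, sub_add_cancel, hCi']
  have hui : coord y k i u = 1 := by rw [hu, hεi, pow_zero]
  have hue : ∀ e : ℕ, 2 * e = k → coord y k (i + e) u = v ^ r := fun e he => by rw [hu, hεr e he]
  refine ⟨g₀ * u, ?_, ?_⟩
  · exact main ha hC hCi (fun e he φ hφ => (hr u hufix hui e he (hue e he) φ hφ).1)
      fun e d hd hde φ hφ => (hpq e d hd hde φ hφ).1
  · exact main hb hE hEi (fun e he φ hφ => (hr u hufix hui e he (hue e he) φ hφ).2)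
      fun e d hd hde φ hφ => (hpq e d hd hde φ hφ).2

end MainLemma

section AlternatingSix

open Equiv Equiv.Perm

/-- The cycle types of the nontrivial even permutations of six points. -/
theorem cycleType_of_even {g : Perm (Fin 6)} (hg : sign g = 1) (h1 : g ≠ 1) :
    g.cycleType = {3} ∨ g.cycleType = {2, 2} ∨ g.cycleType = {5} ∨ g.cycleType = {4, 2} ∨
      g.cycleType = {3, 3} := by
  have hsum : g.cycleType.sum ≤ 6 := (sum_cycleType_le g)
  have h2 : ∀ n ∈ g.cycleType, 2 ≤ n := fun n hn => two_le_of_mem_cycleType hn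
  rw [sign_of_cycleType] at hg
  have hne : g.cycleType ≠ 0 := fun h => h1 (cycleType_eq_zero.1 h)
  generalize g.cycleType = m at *
  have hpar : Even (m.sum + m.card) := by
    by_contra h
    rw [Nat.not_even_iff_odd] at h
    rw [h.neg_one_pow] at hg
    exact absurd hg (by decide)
  clear hg
  induction m using Multiset.induction_on with
  | empty => exact absurd rfl hne
  | cons a m _ =>
    induction m using Multiset.induction_on with
    | empty =>
      simp only [Multiset.cons_zero, Multiset.sum_singleton, Multiset.card_singleton,
        Multiset.mem_singleton, forall_eq] at hsum h2 hpar ⊢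
      interval_cases a <;> revert hpar <;> decide
    | cons b m _ =>
      induction m using Multiset.induction_on with
      | empty =>
        have ha := h2 a (by simp)
        have hb := h2 b (by simp)
        simp only [Multiset.cons_zero, Multiset.sum_cons, Multiset.sum_singleton] at hsum hpar ⊢
        have ha' : a ≤ 4 := by omega
        have hb' : b ≤ 4 := by omega
        interval_cases a <;> interval_cases b <;> revert hpar hsum <;> decide
      | cons c m _ =>
        have ha := h2 a (by simp)
        have hb := h2 b (by simp)
        have hc := h2 c (by simp)
        have hm : m = 0 := by
          by_contra hm
          obtain ⟨d, hd⟩ := Multiset.exists_mem_of_ne_zero hm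
          have := Multiset.single_le_sum (fun _ _ => Nat.zero_le _) d hd
          have := h2 d (by simp [hd])
          simp only [Multiset.sum_cons] at hsum
          omega
        subst hm
        simp only [Multiset.sum_cons, Multiset.sum_zero, Multiset.card_cons,
          Multiset.card_zero] at hsum hpar
        rw [Nat.even_iff] at hpar
        omega

/-- Every even permutation of six points is a product of two involutions. -/
theorem exists_involution_mul {g : Perm (Fin 6)} (hg : sign g = 1) :
    ∃ t, sign t = 1 ∧ t ≠ 1 ∧ t * t = 1 ∧ g * t ≠ 1 ∧ g * t * (g * t) = 1 := by
  have key : ∀ r t : Perm (Fin 6), g.cycleType = r.cycleType →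
      sign t = 1 ∧ t ≠ 1 ∧ t * t = 1 ∧ r * t ≠ 1 ∧ r * t * (r * t) = 1 →
      ∃ t, sign t = 1 ∧ t ≠ 1 ∧ t * t = 1 ∧ g * t ≠ 1 ∧ g * t * (g * t) = 1 := by
    rintro r t hr ⟨h1, h2, h3, h4, h5⟩
    obtain ⟨c, hc⟩ := isConj_iff.1 (isConj_iff_cycleType_eq.2 hr.symm)
    refine ⟨MulAut.conj c t, ?_⟩
    rw [← hc, ← MulAut.conj_apply, ← map_mul, ← map_mul, ← map_mul, h3, h5, map_one,
      (MulAut.conj c).map_ne_one_iff, (MulAut.conj c).map_ne_one_iff]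
    refine ⟨?_, h2, rfl, h4, rfl⟩
    rw [MulAut.conj_apply, Perm.sign_mul, Perm.sign_mul, h1, mul_one, ← Perm.sign_mul,
      mul_inv_cancel, Perm.sign_one]
  by_cases h1 : g = 1
  · exact key 1 (swap 0 1 * swap 2 3) (by rw [h1]) (by decide +kernel)
  rcases cycleType_of_even hg h1 with h | h | h | h | h
  · exact key c[0, 1, 2] (swap 1 2 * swap 4 5)
      (h.trans (by decide +kernel)) (by decide +kernel)
  · exact key (swap 0 1 * swap 2 3) (swap 2 3 * swap 4 5)
      (h.trans (by decide +kernel)) (by decide +kernel)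
  · exact key c[0, 1, 2, 3, 4] (swap 1 4 * swap 2 3)
      (h.trans (by decide +kernel)) (by decide +kernel)
  · exact key (c[0, 1, 2, 3] * swap 4 5) (swap 1 3 * swap 4 5)
      (h.trans (by decide +kernel)) (by decide +kernel)
  · exact key (c[0, 1, 2] * c[3, 4, 5]) (swap 1 2 * swap 4 5)
      (h.trans (by decide +kernel)) (by decide +kernel)

theorem cycleType_of_orderOf_eq_four {g : Perm (Fin 6)} (hg : sign g = 1) (h4 : orderOf g = 4) :
    g.cycleType = {4, 2} := by
  have h1 : g ≠ 1 := by
    rintro rfl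
    simp at h4
  rw [← lcm_cycleType] at h4
  rcases cycleType_of_even hg h1 with h | h | h | h | h <;> rw [h] at h4 <;>
    first | exact h | exact absurd h4 (by decide)

theorem exists_orderOf_conj_mul {g w : Perm (Fin 6)} (hg : sign g = 1) (hg1 : g ≠ 1)
    (hw : sign w = 1) (hw4 : orderOf w = 4) (m : ℕ) :
    ∃ z, sign z = 1 ∧ orderOf (z⁻¹ * g * z * w) ≠ m := by
  have key : ∀ (n : ℕ) (r : Perm (Fin 6)), n.Prime → g.cycleType = r.cycleType →
      (r * (c[0, 1, 2, 3] * swap 4 5)) ^ n = 1 ∧ r * (c[0, 1, 2, 3] * swap 4 5) ≠ 1 →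
      ∃ z, sign z = 1 ∧ orderOf (z⁻¹ * g * z * w) = n := by
    rintro n r hn hr ⟨hn1, hn2⟩
    have := Fact.mk hn
    have hord := orderOf_eq_prime hn1 hn2
    obtain ⟨d, hd⟩ := isConj_iff.1 (isConj_iff_cycleType_eq.2 hr)
    obtain ⟨c, hc⟩ := isConj_iff.1 (isConj_iff_cycleType_eq.2
      ((cycleType_of_orderOf_eq_four hw hw4).trans
        (by decide +kernel : _ = (c[0, 1, 2, 3] * swap 4 5 : Perm (Fin 6)).cycleType)))
    have hs : (swap 4 5 : Perm (Fin 6)) * (c[0, 1, 2, 3] * swap 4 5) * (swap 4 5)⁻¹ =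
        c[0, 1, 2, 3] * swap 4 5 := by decide +kernel
    rcases Int.units_eq_one_or (sign (d⁻¹ * c)) with h | h
    · refine ⟨d⁻¹ * c, h, ?_⟩
      rw [← hord]
      refine SemiconjBy.orderOf_eq c ?_
      change c * _ = _ * c
      rw [← hd, ← hc]
      group
    · refine ⟨d⁻¹ * swap 4 5 * c, ?_, ?_⟩
      · rw [Perm.sign_mul, Perm.sign_mul, mul_right_comm, ← Perm.sign_mul, h, sign_swap (by decide)]
        rfl
      · rw [← hord]
        refine SemiconjBy.orderOf_eq (swap 4 5 * c) ?_
        change (swap 4 5 * c) * _ = _ * (swap 4 5 * c)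
        rw [← hs, ← hd, ← hc]
        group
  suffices h : ∃ n, n ≠ m ∧ ∃ z, sign z = 1 ∧ orderOf (z⁻¹ * g * z * w) = n by
    obtain ⟨n, hn, z, hz, h⟩ := h
    exact ⟨z, hz, h.trans_ne hn⟩
  have hpair : ∀ r r' : Perm (Fin 6), g.cycleType = r.cycleType → g.cycleType = r'.cycleType →
      (r * (c[0, 1, 2, 3] * swap 4 5)) ^ 3 = 1 ∧ r * (c[0, 1, 2, 3] * swap 4 5) ≠ 1 →
      (r' * (c[0, 1, 2, 3] * swap 4 5)) ^ 5 = 1 ∧ r' * (c[0, 1, 2, 3] * swap 4 5) ≠ 1 →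
      ∃ n, n ≠ m ∧ ∃ z, sign z = 1 ∧ orderOf (z⁻¹ * g * z * w) = n := by
    intro r r' hr hr' h3 h5
    by_cases hm : m = 3
    · exact ⟨5, by omega, key 5 r' (by norm_num) hr' h5⟩
    · exact ⟨3, Ne.symm hm, key 3 r (by norm_num) hr h3⟩
  rcases cycleType_of_even hg hg1 with h | h | h | h | h
  · exact hpair c[2, 3, 4] c[3, 4, 5] (h.trans (by decide +kernel))
      (h.trans (by decide +kernel)) (by decide +kernel) (by decide +kernel)
  · exact hpair (swap 2 3 * swap 4 5) (swap 1 2 * swap 3 4) (h.trans (by decide +kernel))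
      (h.trans (by decide +kernel)) (by decide +kernel) (by decide +kernel)
  · exact hpair c[1, 4, 5, 3, 2] c[1, 2, 3, 4, 5] (h.trans (by decide +kernel))
      (h.trans (by decide +kernel)) (by decide +kernel) (by decide +kernel)
  · exact hpair (swap 0 1 * c[2, 4, 5, 3]) (swap 0 1 * c[2, 4, 3, 5])
      (h.trans (by decide +kernel)) (h.trans (by decide +kernel)) (by decide +kernel)
      (by decide +kernel)
  · exact hpair (c[0, 2, 1] * c[3, 4, 5]) (c[0, 1, 2] * c[3, 4, 5])
      (h.trans (by decide +kernel)) (h.trans (by decide +kernel)) (by decide +kernel)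
      (by decide +kernel)

variable {T : Type*} [Group T] (f : T ≃* alternatingGroup (Fin 6))
include f

theorem exists_involution_mul_of_equiv (g : T) :
    ∃ t, t ≠ 1 ∧ t * t = 1 ∧ g * t ≠ 1 ∧ g * t * (g * t) = 1 := by
  obtain ⟨t, ht, h1, h2, h3, h4⟩ := exists_involution_mul (mem_alternatingGroup.1 (f g).2)
  refine ⟨f.symm ⟨t, mem_alternatingGroup.2 ht⟩, ?_, ?_, ?_, ?_⟩
  · rw [f.symm.map_ne_one_iff]
    exact fun h => h1 (congrArg Subtype.val h)
  · rw [← map_mul, f.symm.map_eq_one_iff]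
    exact Subtype.ext h2
  · rw [← f.map_ne_one_iff, map_mul, f.apply_symm_apply]
    exact fun h => h3 (congrArg Subtype.val h)
  · rw [← f.map_eq_one_iff, map_mul, map_mul, f.apply_symm_apply]
    exact Subtype.ext h4

theorem exists_orderOf_conj_mul_of_equiv {g w : T} (hg : g ≠ 1) (hw : orderOf w = 4) (m : ℕ) :
    ∃ z, orderOf (z⁻¹ * g * z * w) ≠ m := by
  obtain ⟨z, hz, h⟩ := exists_orderOf_conj_mul (mem_alternatingGroup.1 (f g).2)
    (fun h => hg (f.map_eq_one_iff.1 (Subtype.ext h))) (mem_alternatingGroup.1 (f w).2)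
    (by rw [Subgroup.orderOf_coe, f.orderOf_eq, hw]) m
  refine ⟨f.symm ⟨z, mem_alternatingGroup.2 hz⟩, fun h' => h ?_⟩
  rw [← f.orderOf_eq, ← Subgroup.orderOf_coe] at h'
  simpa using h'

end AlternatingSix

section Conjugation

/-- Conjugating a pair of generators. -/
theorem closure_conj_eq {G : Type*} [Group G] {S : Subgroup G} {a x w : G} (hw : w ∈ S)
    (h : Subgroup.closure {w⁻¹ * a * w, x} = S) : Subgroup.closure {a, w * x * w⁻¹} = S := by
  have hmem : w⁻¹ * a * w ∈ S := h ▸ Subgroup.subset_closure (Set.mem_insert _ _)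
  have hx : x ∈ S := h ▸ Subgroup.subset_closure (Set.mem_insert_of_mem _ rfl)
  apply le_antisymm
  · rw [Subgroup.closure_le]
    rintro _ (rfl | rfl)
    · have := mul_mem (mul_mem hw hmem) (inv_mem hw)
      simpa [mul_assoc] using this
    · exact mul_mem (mul_mem hw hx) (inv_mem hw)
  · have hle : S ≤ (Subgroup.closure {a, w * x * w⁻¹}).comap (MulAut.conj w).toMonoidHom := by
      conv_lhs => rw [← h]
      rw [Subgroup.closure_le]
      rintro _ (rfl | rfl)
      · change w * (w⁻¹ * a * w) * w⁻¹ ∈ Subgroup.closure {a, w * x * w⁻¹}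
        have := Subgroup.subset_closure (Set.mem_insert a {w * x * w⁻¹})
        simpa [mul_assoc] using this
      · exact Subgroup.subset_closure (Set.mem_insert_of_mem _ rfl)
    intro s hs
    have := hle (mul_mem (mul_mem (inv_mem hw) hs) hw)
    change w * (w⁻¹ * s * w) * w⁻¹ ∈ Subgroup.closure {a, w * x * w⁻¹} at this
    simpa [mul_assoc] using this

end Conjugation

section Pairs

variable {T : Type*} [Group T] {k : ℕ} [NeZero k] {y : MulAut T}

/-- Any two nontrivial elements of `A` are conjugated by a common inner automorphism to elements
generating `A` together with `y`. -/
def UniformlyGenerated (y : MulAut T) (A : Subgroup (MulAut T)) : Prop :=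
  ∀ r s : MulAut T, r ∈ A → s ∈ A → r ≠ 1 → s ≠ 1 →
    ∃ z : T, Subgroup.closure {(MulAut.conj z)⁻¹ * r * MulAut.conj z, y} = A ∧
      Subgroup.closure {(MulAut.conj z)⁻¹ * s * MulAut.conj z, y} = A

theorem uniformlyGenerated_of_mem {A : Subgroup (MulAut T)}
    (hA : A = (MulAut.conj : T →* MulAut T).range ⊔ Subgroup.zpowers y)
    (hI : ∀ r s : MulAut T, r ∈ A → s ∈ A → r ≠ 1 → s ≠ 1 →
      ∃ z ∈ A, Subgroup.closure {z⁻¹ * r * z, y} = A ∧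
        Subgroup.closure {z⁻¹ * s * z, y} = A) : UniformlyGenerated y A := by
  intro r s hr hs hr1 hs1
  obtain ⟨z, hz, h1, h2⟩ := hI r s hr hs hr1 hs1
  have hn : (MulAut.conj : T →* MulAut T).range.Normal := ⟨by
    rintro _ ⟨t, rfl⟩ ψ
    exact ⟨ψ t, (mul_conj_mul_inv ψ t).symm⟩⟩
  obtain ⟨_, ⟨t, rfl⟩, _, ⟨m, rfl⟩, rfl⟩ := Subgroup.mem_sup_of_normal_left.1 (hA ▸ hz)
  have hm : y ^ m ∈ A := hA ▸ Subgroup.mem_sup_right (Subgroup.zpow_mem_zpowers y m)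
  have key : ∀ r, Subgroup.closure {(MulAut.conj t * y ^ m)⁻¹ * r * (MulAut.conj t * y ^ m), y} = A →
      Subgroup.closure {(MulAut.conj t)⁻¹ * r * MulAut.conj t, y} = A := by
    intro r h
    have := closure_conj_eq (a := (MulAut.conj t)⁻¹ * r * MulAut.conj t) (x := y) hm
      (by simpa only [mul_inv_rev, mul_assoc] using h)
    rwa [((Commute.refl y).zpow_left m).eq, mul_inv_cancel_right] at this
  exact ⟨t, key r h1, key s h2⟩

/-- `a` has a non-shifting power, or a non-shifting product of conjugates, which has a nontrivial
`i`-th coordinate. The parameter `m` restricts the shift of `a`. -/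
def Testable (y : MulAut T) (x : MulAut (Fin k → T)) (A : Subgroup (MulAut T)) (m : ℤ)
    (a : MulAut (Fin k → T)) (i : ℤ) : Prop :=
  ∃ j C, (j ≠ 0 → ¬ (k : ℤ) ∣ m * j) ∧ IsTester y x a j C ∧ (∀ l, C 1 l ∈ A) ∧ C 1 i ≠ 1

/-- `⟨a ^ g, x⟩` has a non-shifting element whose `i`-th coordinate generates `A` together
with `y`. -/
def Placed (y : MulAut T) (x : MulAut (Fin k → T)) (A : Subgroup (MulAut T))
    (a : MulAut (Fin k → T)) (g : Fin k → T) (i : ℤ) : Prop :=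
  ∃ j C, IsTester y x a j C ∧ Subgroup.closure {C g i, y} = A

/-- No twist of `g` by a `y`-invariant element with coordinates `1` and `v ^ r` at the places `i`
and `i + k / 2` makes the places that differ by `k / 2` tied. -/
def Untied (y : MulAut T) (x : MulAut (Fin k → T)) (v : T) (a : MulAut (Fin k → T))
    (g : Fin k → T) (i : ℤ) (r : ℕ) : Prop :=
  ∀ u, (∀ l, y (coord y k l u) = coord y k l u) → coord y k i u = 1 →
    ∀ e : ℕ, 2 * e = k → coord y k (i + e) u = v ^ r → ∀ φ, φ ^ 2 = y⁻¹ → ¬ Tied y x a (g * u) e φ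

theorem untied_of_not_conjByRoot {x a : MulAut (Fin k → T)} {j : ℤ}
    {C : (Fin k → T) → ℤ → MulAut T} (hC : IsTester y x a j C) {g : Fin k → T} {i : ℤ} {r : ℕ}
    {v : T} (h : ∀ (e : ℕ) φ, 2 * e = k →
      ¬ ConjByRoot y (MulAut.conj v) (C g i) (C g (i + e)) 2 r φ) :
    Untied y x v a g i r := by
  intro u hu hui e he hue φ hφ ht
  refine h e φ he ⟨hφ, ?_⟩
  have := hC.tied ht i
  rw [hC.mul_fixed g u hu, hC.mul_fixed g u hu, hui, hue] at this
  simpa using this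

variable [Finite T] [IsSimpleGroup T] (hT : ¬ ∀ a b : T, a * b = b * a)
  {x : MulAut (Fin k → T)}
  (hx : ∀ (f : Fin k → T) (i : Fin k), x f i = if i = 0 then y (f (i - 1)) else f (i - 1))
  {A : Subgroup (MulAut T)} (hA : MulAut.conj.range ≤ A)
  {v : T} (hv : v ≠ 1) (hvy : MulAut.conj v ∈ Subgroup.zpowers y)
include hT hx hA hv hvy

theorem exists_gen_of_placed {a b : MulAut (Fin k → T)}
    (ha : a ∈ (MulAut.conj : (Fin k → T) →* MulAut (Fin k → T)).range ⊔ Subgroup.zpowers x)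
    (hb : b ∈ (MulAut.conj : (Fin k → T) →* MulAut (Fin k → T)).range ⊔ Subgroup.zpowers x)
    {g : Fin k → T} {i : ℤ} (ha' : Placed y x A a g i) (hb' : Placed y x A b g i) {r : ℕ}
    (har : Untied y x v a g i r) (hbr : Untied y x v b g i r) : ∃ g, Gen x a g ∧ Gen x b g := by
  obtain ⟨_, C, hC, hCi⟩ := ha'
  obtain ⟨_, E, hE, hEi⟩ := hb'
  exact exists_gen_of_not_tied hT hx hA hv hvy ha hb hC hE hCi hEi
    ⟨r, fun u hu hui e he hue φ hφ => ⟨har u hu hui e he hue φ hφ, hbr u hu hui e he hue φ hφ⟩⟩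

theorem exists_gen_of_testable (hU : UniformlyGenerated y A)
    (hne : (∀ w, y ≠ w ^ 2) ∨ MulAut.conj v ^ 4 ≠ 1 ∨ ¬ 2 ∣ k) {a b : MulAut (Fin k → T)}
    (ha : a ∈ (MulAut.conj : (Fin k → T) →* MulAut (Fin k → T)).range ⊔ Subgroup.zpowers x)
    (hb : b ∈ (MulAut.conj : (Fin k → T) →* MulAut (Fin k → T)).range ⊔ Subgroup.zpowers x)
    {i : ℤ} (ha' : Testable y x A 1 a i) (hb' : Testable y x A 1 b i) :
    ∃ g, Gen x a g ∧ Gen x b g := by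
  obtain ⟨ja, C, hja, hC, hCA, hCi⟩ := ha'
  obtain ⟨jb, E, hjb, hE, hEA, hEi⟩ := hb'
  obtain ⟨z, hz1, hz2⟩ := hU _ _ (hCA i) (hEA i) hCi hEi
  obtain ⟨g, hgi, hg⟩ := exists_coord_single (y := y) (k := k) i z
  have val : ∀ {a j C}, IsTester y x a j C → (j ≠ 0 → ¬ (k : ℤ) ∣ 1 * j) →
      C g i = (MulAut.conj z)⁻¹ * C 1 i * MulAut.conj z := by
    intro a j C hC hj
    rw [hC.eq_conj g i, hgi]
    intro h0
    refine hg _ fun hd => hj h0 ?_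
    rw [show i - j - i = -(1 * j) by ring, dvd_neg] at hd
    exact hd
  rw [← val hC hja] at hz1
  rw [← val hE hjb] at hz2
  suffices h : ∃ r, Untied y x v a g i r ∧ Untied y x v b g i r by
    obtain ⟨r, h1, h2⟩ := h
    exact exists_gen_of_placed hT hx hA hv hvy ha hb ⟨_, C, hC, hz1⟩ ⟨_, E, hE, hz2⟩ h1 h2
  rcases hne with hy | hV | hk
  · refine ⟨0, untied_of_not_conjByRoot hC ?_, untied_of_not_conjByRoot hE ?_⟩ <;>
    · rintro e φ - ⟨h, -⟩
      exact hy φ⁻¹ (by rw [inv_pow, h, inv_inv])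
  · obtain ⟨r, hr⟩ := exists_pow_not_conjByRoot_two hT hA hvy hV
      (c' := C g (i + (k / 2 : ℕ))) (e' := E g (i + (k / 2 : ℕ))) hz1 hz2
    refine ⟨r, untied_of_not_conjByRoot hC ?_, untied_of_not_conjByRoot hE ?_⟩
    · rintro e φ he
      rw [show e = k / 2 by omega]
      exact (hr φ).1
    · rintro e φ he
      rw [show e = k / 2 by omega]
      exact (hr φ).2
  · exact ⟨0, fun u _ _ e he => absurd ⟨e, he.symm⟩ hk, fun u _ _ e he => absurd ⟨e, he.symm⟩ hk⟩

end Pairs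

section HalfShift

variable {T : Type*} [Group T] {k : ℕ} [NeZero k] {y : MulAut T}

/-- `a` shifts by half of the period and its square is trivial. -/
def HalfShift (y : MulAut T) (A : Subgroup (MulAut T)) (a : MulAut (Fin k → T)) : Prop :=
  ∃ (e : ℕ) (α : ℤ → MulAut T), 2 * e = k ∧ HasCoord y a (-e) α ∧ (∀ l, α l ∈ A) ∧
    ∀ l, α l * α (l + e) = y

theorem range_le_of_mem_normalizer [IsSimpleGroup T]
    {A L : Subgroup (MulAut T)} (hA : MulAut.conj.range ≤ A) {c : MulAut T}
    (hc : Subgroup.closure {c, y} = A) (hcL : ∀ w ∈ L, c * w * c⁻¹ ∈ L)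
    (hcL' : ∀ w ∈ L, c⁻¹ * w * c ∈ L) (hy : y ∈ L)
    {v : T} (hv : v ≠ 1) (hvL : MulAut.conj v ∈ L) : MulAut.conj.range ≤ L := by
  have hAL : A ≤ Subgroup.normalizer (L : Set (MulAut T)) := by
    rw [← hc, Subgroup.closure_le]
    rintro _ (rfl | rfl)
    · refine Subgroup.mem_normalizer_iff.2 fun w => ⟨hcL w, fun h => ?_⟩
      simpa [mul_assoc] using hcL' _ h
    · exact Subgroup.le_normalizer hy
  have hn : (L.comap (MulAut.conj : T →* MulAut T)).Normal := ⟨fun t ht s => by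
    rw [Subgroup.mem_comap, map_mul, map_mul, map_inv]
    exact (Subgroup.mem_normalizer_iff.1 (hAL (hA ⟨s, rfl⟩)) _).1 ht⟩
  rcases hn.eq_bot_or_eq_top with h | h
  · exact absurd (Subgroup.mem_bot.1 (h ▸ hvL : v ∈ (⊥ : Subgroup T))) hv
  · rintro _ ⟨t, rfl⟩
    exact (h ▸ Subgroup.mem_top t : t ∈ L.comap (MulAut.conj : T →* MulAut T))

section Involution

variable {s : MulAut T} (hs : s * s = 1)
include hs

theorem closure_conj_of_involution [IsSimpleGroup T]
    {A : Subgroup (MulAut T)} (hA : A = MulAut.conj.range) (hc : Subgroup.closure {s, y} = A)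
    {v : T} (hv : v ≠ 1) (hvy : MulAut.conj v = y) :
    Subgroup.closure {s * y * s⁻¹, y} = A := by
  have hs' : s⁻¹ = s := inv_eq_of_mul_eq_one_left hs
  have h1 : s * y * s⁻¹ ∈ Subgroup.closure {s * y * s⁻¹, y} :=
    Subgroup.subset_closure (Set.mem_insert _ _)
  have h2 : y ∈ Subgroup.closure {s * y * s⁻¹, y} :=
    Subgroup.subset_closure (Set.mem_insert_of_mem _ rfl)
  have hn : ∀ w ∈ Subgroup.closure {s * y * s⁻¹, y}, s * w * s⁻¹ ∈
      Subgroup.closure {s * y * s⁻¹, y} := by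
    change _ ≤ (Subgroup.closure {s * y * s⁻¹, y}).comap (MulAut.conj s).toMonoidHom
    rw [Subgroup.closure_le]
    rintro _ (rfl | rfl)
    · change s * (s * y * s⁻¹) * s⁻¹ ∈ Subgroup.closure {s * y * s⁻¹, y}
      rwa [show s * (s * y * s⁻¹) * s⁻¹ = (s * s) * y * (s * s)⁻¹ by group, hs, one_mul, inv_one,
        mul_one]
    · exact h1
  apply le_antisymm
  · have hsA : s ∈ A := hc ▸ Subgroup.subset_closure (Set.mem_insert _ _)
    have hyA : y ∈ A := hc ▸ Subgroup.subset_closure (Set.mem_insert_of_mem _ rfl)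
    rw [Subgroup.closure_le]
    rintro _ (rfl | rfl)
    · exact mul_mem (mul_mem hsA hyA) (inv_mem hsA)
    · exact hyA
  · conv_lhs => rw [hA]
    exact range_le_of_mem_normalizer hA.ge hc hn (fun w hw => by
      have := hn w hw
      rwa [hs'] at this ⊢) h2 hv (hvy ▸ h2)

theorem not_sq_mul_eq_one [IsSimpleGroup T] (hT : ¬ ∀ a b : T, a * b = b * a)
    {A : Subgroup (MulAut T)} (hA : MulAut.conj.range ≤ A) (hc : Subgroup.closure {s, y} = A)
    {v : T} (hv : v ≠ 1) (hvy : MulAut.conj v = y) (hy : y ^ 4 = 1) (r : ℕ) {φ : MulAut T}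
    (hφ : φ ^ 2 = y⁻¹) : s * (y ^ r * φ) * (s * (y ^ r * φ)) ≠ 1 := by
  intro h
  have hs' : s⁻¹ = s := inv_eq_of_mul_eq_one_left hs
  have hq : s * (y ^ r * φ) * s⁻¹ = (y ^ r * φ)⁻¹ := by
    rw [eq_inv_iff_mul_eq_one, hs', ← h]
    group
  have hq2 : (y ^ r * φ) ^ 2 = y ^ (2 * r : ℤ) * y⁻¹ := by
    rw [((commute_of_pow_eq_inv hφ).symm.pow_left r).mul_pow, hφ, ← pow_mul, ← zpow_natCast]
    congr 2
    push_cast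
    ring
  have hyq : ((y ^ r * φ) ^ 2) ^ (2 * r - 1 : ℤ) = y := by
    rw [hq2, ← zpow_sub_one, ← zpow_mul,
      show (2 * r - 1 : ℤ) * (2 * r - 1) = (4 : ℕ) * (r * r - r : ℤ) + 1 by push_cast; ring,
      zpow_add, zpow_mul, zpow_natCast, hy, one_zpow, one_mul, zpow_one]
  have hsy : s * y * s⁻¹ = y⁻¹ := by
    conv_lhs => rw [← hyq]
    conv_rhs => rw [← hyq]
    rw [← conj_zpow, ← conj_pow, hq, inv_pow, inv_zpow]
  have hinv : ∀ w ∈ Subgroup.zpowers y, s * w * s⁻¹ ∈ Subgroup.zpowers y := by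
    rintro _ ⟨m, rfl⟩
    change s * y ^ m * s⁻¹ ∈ _
    rw [← conj_zpow, hsy]
    exact zpow_mem (inv_mem (Subgroup.mem_zpowers y)) m
  have hle := range_le_of_mem_normalizer hA hc hinv (fun w hw => by
    have := hinv w hw
    rwa [hs'] at this ⊢) (Subgroup.mem_zpowers y) hv (hvy ▸ Subgroup.mem_zpowers _)
  refine hT fun a b => conj_injective_of_simple hT ?_
  obtain ⟨m, hm⟩ := hle ⟨a, rfl⟩
  obtain ⟨n, hn⟩ := hle ⟨b, rfl⟩
  rw [map_mul, map_mul, ← hm, ← hn]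
  exact ((Commute.refl y).zpow_zpow m n).eq

end Involution

variable {x : MulAut (Fin k → T)}
  (hx : ∀ (f : Fin k → T) (i : Fin k), x f i = if i = 0 then y (f (i - 1)) else f (i - 1))
include hx

section

variable [IsSimpleGroup T] {A : Subgroup (MulAut T)} (hA : A = MulAut.conj.range)
  {v : T} (hv : v ≠ 1) (hvy : MulAut.conj v = y)
  {a : MulAut (Fin k → T)} {e : ℕ} (he : 2 * e = k) {α : ℤ → MulAut T}
  (ha : HasCoord y a (-e) α) {g : Fin k → T} {i : ℤ} {s : MulAut T} (hs : s * s = 1)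
  (hsg : (MulAut.conj (coord y k i g))⁻¹ * α i * MulAut.conj (coord y k (i + e) g) = s)
  (hc : Subgroup.closure {s, y} = A)
include hA hv hvy he ha hs hsg hc

theorem placed_of_halfShift : Placed y x A a g i := by
  have he0 : -(e : ℤ) ≠ 0 := by
    have := NeZero.ne k
    omega
  refine ⟨_, _, isTester_of_shift hx he0 ha, ?_⟩
  rw [sub_neg_eq_add, hsg]
  exact closure_conj_of_involution hs hA hc hv hvy

theorem untied_of_halfShift (hT : ¬ ∀ a b : T, a * b = b * a) (hα : ∀ l, α l * α (l + e) = y)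
    (hy : y ^ 4 = 1) (r : ℕ) : Untied y x v a g i r := by
  intro u hu hui e' he' hue φ hφ ht
  obtain rfl : e' = e := by omega
  have h1 := (ha.conj_inv_mul (g * u)).mul (hasCoord_shift_zpow hx e')
  have hmem := mul_mem (Subgroup.subset_closure
      (Set.mem_insert ((MulAut.conj (g * u))⁻¹ * a * MulAut.conj (g * u)) {x}))
    (zpow_mem (Subgroup.subset_closure (Set.mem_insert_of_mem
      ((MulAut.conj (g * u))⁻¹ * a * MulAut.conj (g * u)) (Set.mem_singleton x))) (e' : ℤ))
  have h2 := ht _ hmem _ (h1.congr (neg_add_cancel _) fun _ => rfl) i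
  have hper : coord y k (i + e' + e') (g * u) = y⁻¹ (coord y k i (g * u)) := by
    rw [show i + e' + e' = i + k by rw [← he']; push_cast; ring, coord_add]
  simp only [sub_neg_eq_add, mul_one, hper, Pi.one_apply] at h2
  have hz : coord y k i (g * u) = coord y k i g := by simp [hui]
  have hz' : MulAut.conj (coord y k (i + e') (g * u)) =
      MulAut.conj (coord y k (i + e') g) * y ^ r := by simp [hue, hvy]
  have h3 : MulAut.conj (y⁻¹ (coord y k i g)) = y⁻¹ * MulAut.conj (coord y k i g) * y := by
    rw [← mul_conj_mul_inv, inv_inv]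
  have hα' : α (i + e') = (α i)⁻¹ * y := by rw [← hα i, inv_mul_cancel_left]
  rw [hz, hz', h3, hα', ← mul_assoc _ _ (y ^ r), hsg] at h2
  refine not_sq_mul_eq_one hs hT hA.ge hc hv hvy hy r hφ ?_
  calc s * (y ^ r * φ) * (s * (y ^ r * φ)) = s * y ^ r * (φ * (s * y ^ r) * φ⁻¹) * φ ^ 2 := by group
    _ = s * s⁻¹ := by
      rw [← h2, hφ, ← hsg]
      group
    _ = 1 := mul_inv_cancel s

end

end HalfShift

section Alternating

variable {T : Type*} [Group T] {k : ℕ} [NeZero k] {y : MulAut T}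

theorem exists_coord_pair {e : ℕ} (he : 2 * e = k) (i : ℤ) (z z' : T) : ∃ g : Fin k → T,
    coord y k i g = z ∧ coord y k (i + e) g = z' ∧
      ∀ l, ¬ (k : ℤ) ∣ l - i → ¬ (k : ℤ) ∣ l - i - e → coord y k l g = 1 := by
  have hk := NeZero.ne k
  have hke : ¬ (k : ℤ) ∣ e := fun h => by
    have := Nat.le_of_dvd (by omega) (Int.natCast_dvd_natCast.1 h)
    omega
  obtain ⟨g, hg, hg'⟩ := exists_coord_single (y := y) (k := k) i z
  obtain ⟨h, hh, hh'⟩ := exists_coord_single (y := y) (k := k) (i + e) z'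
  refine ⟨g * h, ?_, ?_, fun l h1 h2 => ?_⟩
  · rw [map_mul, hg, hh' i (by rwa [sub_add_cancel_left, dvd_neg]), mul_one]
  · rw [map_mul, hh, hg' _ (by rwa [add_sub_cancel_left]), one_mul]
  · rw [map_mul, hg' l h1, hh' l (by rwa [← sub_sub]), one_mul]

theorem IsTester.eq_conj_of_coord_pair {x a : MulAut (Fin k → T)} {j : ℤ}
    {C : (Fin k → T) → ℤ → MulAut T} (hC : IsTester y x a j C) (hj : j ≠ 0 → ¬ (k : ℤ) ∣ 2 * j)
    {e : ℕ} (he : 2 * e = k) {g : Fin k → T} {i : ℤ}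
    (hg : ∀ l, ¬ (k : ℤ) ∣ l - i → ¬ (k : ℤ) ∣ l - i - e → coord y k l g = 1) :
    C g i = (MulAut.conj (coord y k i g))⁻¹ * C 1 i * MulAut.conj (coord y k i g) ∧
      C g (i + e) = (MulAut.conj (coord y k (i + e) g))⁻¹ * C 1 (i + e) *
        MulAut.conj (coord y k (i + e) g) := by
  have hk : (k : ℤ) = 2 * e := by exact_mod_cast he.symm
  refine ⟨hC.eq_conj g i fun h0 => hg _ ?_ ?_, hC.eq_conj g _ fun h0 => hg _ ?_ ?_⟩ <;>
  · rintro ⟨m, hm⟩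
    apply hj h0
    first
    | exact ⟨-2 * m, by linarith⟩
    | exact ⟨-2 * m - 1, by linarith⟩
    | exact ⟨-2 * m + 1, by linarith⟩

theorem Testable.of_two {x a : MulAut (Fin k → T)} {A : Subgroup (MulAut T)} {i : ℤ}
    (h : Testable y x A 2 a i) : Testable y x A 1 a i :=
  let ⟨j, C, hj, h⟩ := h
  ⟨j, C, fun h0 hd => hj h0 (by rw [one_mul] at hd; exact hd.mul_left 2), h⟩

theorem HalfShift.testable {x a : MulAut (Fin k → T)}
    (hx : ∀ (f : Fin k → T) (i : Fin k), x f i = if i = 0 then y (f (i - 1)) else f (i - 1))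
    {A : Subgroup (MulAut T)} (hyA : y ∈ A) (hy : y ≠ 1) (h : HalfShift y A a) (i : ℤ) :
    Testable y x A 1 a i := by
  obtain ⟨e, α, he, ha, hα, -⟩ := h
  have hk := NeZero.ne k
  refine ⟨_, _, fun _ hd => ?_, isTester_of_shift hx (by omega) ha, fun l => ?_, ?_⟩
  · rw [one_mul, dvd_neg, Int.natCast_dvd_natCast] at hd
    have := Nat.le_of_dvd (by omega) hd
    omega
  · simpa using mul_mem (mul_mem (hα l) hyA) (inv_mem (hα l))
  · simpa using hy

theorem untied_of_orderOf_ne {x a : MulAut (Fin k → T)} {j : ℤ}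
    {C : (Fin k → T) → ℤ → MulAut T} (hC : IsTester y x a j C) {g : Fin k → T} {i : ℤ} {e : ℕ}
    (he : 2 * e = k) {v : T} (hvy : MulAut.conj v ∈ Subgroup.zpowers y)
    (h : orderOf (C g (i + e) * y) ≠ orderOf (C g i * y)) (r : ℕ) : Untied y x v a g i r := by
  refine untied_of_not_conjByRoot hC fun e' φ he' hφ => h ?_
  obtain rfl : e' = e := by omega
  obtain ⟨h1, h2⟩ := hφ.conj_eq hvy
  generalize MulAut.conj v ^ r * φ = w at h1 h2
  rw [← MulEquiv.orderOf_eq (MulAut.conj w) (C g i * y), h1]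
  congr 1
  rw [MulAut.conj_apply, mul_assoc, h2.inv_left.eq, mul_assoc w, mul_assoc w, mul_assoc]

variable [IsSimpleGroup T] (hT : ¬ ∀ a b : T, a * b = b * a)
  {x : MulAut (Fin k → T)} {A : Subgroup (MulAut T)} (hA : A = MulAut.conj.range)
  {v : T} (hvy : MulAut.conj v = y) (hy : orderOf y = 4)
include hT hA hvy hy

theorem exists_untied_of_testable {a : MulAut (Fin k → T)}
    {j : ℤ} {C : (Fin k → T) → ℤ → MulAut T} (hC : IsTester y x a j C) {g : Fin k → T} {i : ℤ}
    (hc : Subgroup.closure {C g i, y} = A) : ∃ r, Untied y x v a g i r := by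
  obtain ⟨r, hr⟩ := exists_pow_not_conjByRoot_two_single hT hA.ge (hvy ▸ Subgroup.mem_zpowers _)
    (V := MulAut.conj v) (c' := C g (i + (k / 2 : ℕ)))
    (fun h => absurd (orderOf_dvd_of_pow_eq_one (hvy ▸ h)) (by rw [hy]; decide)) hc
  refine ⟨r, untied_of_not_conjByRoot hC fun e φ he => ?_⟩
  rw [show e = k / 2 by omega]
  exact hr φ

variable (hv : v ≠ 1)
  (hx : ∀ (f : Fin k → T) (i : Fin k), x f i = if i = 0 then y (f (i - 1)) else f (i - 1))
include hv hx

theorem placed_and_untied_of_halfShift {a : MulAut (Fin k → T)} {e : ℕ} (he : 2 * e = k)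
    {α : ℤ → MulAut T} (ha : HasCoord y a (-e) α) (hα : ∀ l, α l * α (l + e) = y) {t z : T}
    (ht : t * t = 1) {i : ℤ}
    (hc : Subgroup.closure {(MulAut.conj z)⁻¹ * MulAut.conj t * MulAut.conj z, y} = A)
    {g : Fin k → T} (hgz : coord y k i g = z)
    (hg : α i * MulAut.conj (coord y k (i + e) g) = MulAut.conj t * MulAut.conj z) :
    Placed y x A a g i ∧ ∀ r, Untied y x v a g i r := by
  have hs : (MulAut.conj z)⁻¹ * MulAut.conj t * MulAut.conj z *
      ((MulAut.conj z)⁻¹ * MulAut.conj t * MulAut.conj z) = 1 := by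
    simp only [← map_mul, ← map_inv]
    rw [show z⁻¹ * t * z * (z⁻¹ * t * z) = z⁻¹ * (t * t) * z by group, ht]
    simp
  have hsg : (MulAut.conj (coord y k i g))⁻¹ * α i * MulAut.conj (coord y k (i + e) g) =
      (MulAut.conj z)⁻¹ * MulAut.conj t * MulAut.conj z := by
    rw [hgz, mul_assoc, hg, mul_assoc]
  exact ⟨placed_of_halfShift hx hA hv hvy he ha hs hsg hc,
    untied_of_halfShift hx hA hv hvy he ha hs hsg hc hT hα (hy ▸ pow_orderOf_eq_one y)⟩

variable [Finite T]
  (hU : UniformlyGenerated y A) (f : T ≃* alternatingGroup (Fin 6))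
  {a b : MulAut (Fin k → T)}
  (ha : a ∈ (MulAut.conj : (Fin k → T) →* MulAut (Fin k → T)).range ⊔ Subgroup.zpowers x)
  (hb : b ∈ (MulAut.conj : (Fin k → T) →* MulAut (Fin k → T)).range ⊔ Subgroup.zpowers x)
  {i : ℤ}
include hU ha hb f

theorem exists_gen_of_testable_of_testable {e : ℕ} (he : 2 * e = k)
    (ha' : Testable y x A 2 a i) (hb' : Testable y x A 2 b i) :
    ∃ g, Gen x a g ∧ Gen x b g := by
  have hinj := conj_injective_of_simple hT
  obtain ⟨ja, C, hja, hC, hCA, hCi⟩ := ha'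
  obtain ⟨jb, E, hjb, hE, hEA, hEi⟩ := hb'
  obtain ⟨z, hz1, hz2⟩ := hU _ _ (hCA i) (hEA i) hCi hEi
  obtain ⟨z', hz'⟩ : ∃ z', C 1 (i + e) = 1 ∨
      orderOf ((MulAut.conj z')⁻¹ * C 1 (i + e) * MulAut.conj z' * y) ≠
      orderOf ((MulAut.conj z)⁻¹ * C 1 i * MulAut.conj z * y) := by
    obtain ⟨q, hq⟩ := hA ▸ hCA (i + e)
    by_cases hq1 : q = 1
    · exact ⟨1, Or.inl (by rw [← hq, hq1, map_one])⟩
    have hv4 : orderOf v = 4 := by rw [← orderOf_injective _ hinj v, hvy, hy]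
    obtain ⟨z', hz'⟩ := exists_orderOf_conj_mul_of_equiv f hq1 hv4
      (orderOf ((MulAut.conj z)⁻¹ * C 1 i * MulAut.conj z * y))
    refine ⟨z', Or.inr ?_⟩
    rw [← orderOf_injective _ hinj] at hz'
    simpa only [map_mul, map_inv, hq, hvy] using hz'
  obtain ⟨g, hgz, hgz', hg⟩ := exists_coord_pair (y := y) he i z z'
  have hCg := hC.eq_conj_of_coord_pair hja he hg
  have hEg := (hE.eq_conj_of_coord_pair hjb he hg).1
  rw [hgz, hgz'] at hCg
  rw [hgz] at hEg
  rw [← hCg.1] at hz1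
  rw [← hEg] at hz2
  rw [← hCg.1, ← hCg.2] at hz'
  obtain ⟨r, hr⟩ := exists_untied_of_testable hT hA hvy hy hE hz2
  have hvy' : MulAut.conj v ∈ Subgroup.zpowers y := hvy ▸ Subgroup.mem_zpowers _
  have hCu : ∀ r, Untied y x v a g i r := by
    intro r
    rcases hz' with h1 | hz'
    · refine untied_of_not_conjByRoot hC ?_
      rintro e' φ he' ⟨-, h⟩
      obtain rfl : e' = e := by omega
      rw [hCg.2, hCg.1, h1] at h
      apply hCi
      have h' : (MulAut.conj z)⁻¹ * C 1 i * MulAut.conj z = 1 := by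
        rw [← conj_eq_one_iff (a := φ), ← h]
        group
      rw [← conj_eq_one_iff (a := (MulAut.conj z)⁻¹), inv_inv]
      exact h'
    · exact untied_of_orderOf_ne hC he hvy' hz' r
  exact exists_gen_of_placed hT hx hA.ge hv hvy' ha hb ⟨_, C, hC, hz1⟩ ⟨_, E, hE, hz2⟩
    (hCu r) hr

theorem exists_gen_of_halfShift_of_testable (ha' : HalfShift y A a)
    (hb' : Testable y x A 2 b i) : ∃ g, Gen x a g ∧ Gen x b g := by
  obtain ⟨e, α, he, hα, hαA, hαy⟩ := ha'
  obtain ⟨j, E, hj, hE, hEA, hEi⟩ := hb'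
  obtain ⟨p, hp⟩ := hA ▸ hαA i
  obtain ⟨t, ht, htt, -, -⟩ := exists_involution_mul_of_equiv f 1
  obtain ⟨z, hz1, hz2⟩ := hU _ _ (hA ▸ ⟨t, rfl⟩) (hEA i)
    ((map_ne_one_iff _ (conj_injective_of_simple hT)).2 ht) hEi
  obtain ⟨g, hgz, hgz', hg⟩ := exists_coord_pair (y := y) he i z (p⁻¹ * t * z)
  have hEg := (hE.eq_conj_of_coord_pair hj he hg).1
  rw [hgz] at hEg
  rw [← hEg] at hz2
  obtain ⟨r, hr⟩ := exists_untied_of_testable hT hA hvy hy hE hz2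
  obtain ⟨h1, h2⟩ := placed_and_untied_of_halfShift hT hA hvy hy hv hx he hα hαy htt hz1 hgz
    (by rw [hgz', ← hp]; simp [mul_assoc])
  exact exists_gen_of_placed hT hx hA.ge hv (hvy ▸ Subgroup.mem_zpowers _) ha hb h1
    ⟨_, E, hE, hz2⟩ (h2 r) hr

theorem exists_gen_of_halfShift_of_halfShift (ha' : HalfShift y A a) (hb' : HalfShift y A b) :
    ∃ g, Gen x a g ∧ Gen x b g := by
  obtain ⟨e, α, he, hα, hαA, hαy⟩ := ha'
  obtain ⟨e', β, he', hβ, hβA, hβy⟩ := hb'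
  obtain rfl : e' = e := by omega
  obtain ⟨p, hp⟩ := hA ▸ hαA 0
  obtain ⟨q, hq⟩ := hA ▸ hβA 0
  obtain ⟨t, ht, htt, hqt, hqtt⟩ := exists_involution_mul_of_equiv f (q * p⁻¹)
  have hinj := conj_injective_of_simple hT
  obtain ⟨z, hz1, hz2⟩ := hU _ _ (hA ▸ ⟨t, rfl⟩) (hA ▸ ⟨_, rfl⟩)
    ((map_ne_one_iff _ hinj).2 ht) ((map_ne_one_iff _ hinj).2 hqt)
  obtain ⟨g, hgz, hgz', -⟩ := exists_coord_pair (y := y) he 0 z (p⁻¹ * t * z)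
  obtain ⟨h1, h2⟩ := placed_and_untied_of_halfShift hT hA hvy hy hv hx he hα hαy htt hz1 hgz
    (by rw [hgz', ← hp]; simp [mul_assoc])
  obtain ⟨h3, h4⟩ := placed_and_untied_of_halfShift hT hA hvy hy hv hx he hβ hβy hqtt hz2 hgz
    (by rw [hgz', ← hq]; simp [mul_assoc])
  exact exists_gen_of_placed hT hx hA.ge hv (hvy ▸ Subgroup.mem_zpowers _) ha hb h1 h3 (h2 0) (h4 0)

theorem exists_gen_of_alternating (ha' : Testable y x A 2 a i ∨ HalfShift y A a)
    (hb' : Testable y x A 2 b i ∨ HalfShift y A b) : ∃ g, Gen x a g ∧ Gen x b g := by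
  by_cases hk : 2 ∣ k
  · obtain ⟨e, he⟩ := hk
    rcases ha' with ha' | ha' <;> rcases hb' with hb' | hb'
    · exact exists_gen_of_testable_of_testable hT hA hvy hy hv hx hU f ha hb he.symm ha' hb'
    · obtain ⟨g, h1, h2⟩ :=
        exists_gen_of_halfShift_of_testable hT hA hvy hy hv hx hU f hb ha hb' ha'
      exact ⟨g, h2, h1⟩
    · exact exists_gen_of_halfShift_of_testable hT hA hvy hy hv hx hU f ha hb ha' hb'
    · exact exists_gen_of_halfShift_of_halfShift hT hA hvy hy hv hx hU f ha hb ha' hb'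
  · have hs : ∀ a : MulAut (Fin k → T), ¬ HalfShift y A a :=
      fun a ⟨e, _, he, _⟩ => hk ⟨e, he.symm⟩
    exact exists_gen_of_testable hT hx hA.ge hv (hvy ▸ Subgroup.mem_zpowers _) hU
      (Or.inr (Or.inr hk)) ha hb (ha'.resolve_right (hs a)).of_two (hb'.resolve_right (hs b)).of_two

end Alternating

section Reduction

variable {T : Type*} [Group T] {k : ℕ}

theorem Gen.of_pow {x a : MulAut (Fin k → T)}
    (ha : a ∈ (MulAut.conj : (Fin k → T) →* MulAut (Fin k → T)).range ⊔ Subgroup.zpowers x)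
    {n : ℕ} {g : Fin k → T} (h : Gen x (a ^ n) g) : Gen x a g := by
  refine le_antisymm (closure_conj_le ha g) (h.ge.trans ?_)
  rw [Subgroup.closure_le]
  rintro _ (rfl | rfl)
  · have := pow_mem (Subgroup.subset_closure
      (Set.mem_insert ((MulAut.conj g)⁻¹ * a * MulAut.conj g) {x})) n
    have hc := conj_pow (a := (MulAut.conj g)⁻¹) (b := a) (i := n)
    rw [inv_inv] at hc
    rwa [hc] at this
  · exact Subgroup.subset_closure (Set.mem_insert_of_mem _ rfl)

variable [NeZero k] {y : MulAut T}

theorem testable_of_base {A : Subgroup (MulAut T)} {a : MulAut (Fin k → T)} {α : ℤ → MulAut T}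
    (x : MulAut (Fin k → T)) (ha : HasCoord y a 0 α) (hα : ∀ l, α l ∈ A) {i : ℤ} (hi : α i ≠ 1) :
    Testable y x A 2 a i :=
  ⟨0, _, fun h => absurd rfl h, isTester_of_base ha, fun l => by simpa using hα l, by simpa using hi⟩

section

variable {x : MulAut (Fin k → T)} {A : Subgroup (MulAut T)} (hyA : y ∈ A)
include hyA

theorem halfShift_of_mul_self_eq_one {a : MulAut (Fin k → T)} {j : ℤ} {α : ℤ → MulAut T}
    (ha : HasCoord y a j α) (hα : ∀ l, α l ∈ A) (hj : ¬ (k : ℤ) ∣ j) (h2j : (k : ℤ) ∣ 2 * j)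
    (haa : a * a = 1) : HalfShift y A a := by
  obtain ⟨q, hq⟩ := h2j
  have hqo : ¬ 2 ∣ q := by
    rintro ⟨m, rfl⟩
    exact hj ⟨m, by linarith⟩
  obtain ⟨m, rfl⟩ : ∃ m, q = 2 * m + 1 := ⟨q / 2, by omega⟩
  obtain ⟨e, he⟩ : ∃ e : ℕ, 2 * e = k := by
    refine ⟨(j - k * m).toNat, ?_⟩
    have : 2 * (j - k * m) = k := by linarith
    omega
  have hk : (k : ℤ) = 2 * e := by exact_mod_cast he.symm
  have ha' := (ha.sub_mul (m + 1)).congr (j' := -e) (by linarith)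
    fun _ => rfl
  refine ⟨e, _, he, ha', fun l => mul_mem (hα l) (zpow_mem hyA _), fun l => ?_⟩
  have h1 := ((ha'.mul ha').sub_mul (-1)).congr (j' := 0) (by linarith) fun _ => rfl
  rw [haa] at h1
  have := h1.unique HasCoord.one l
  simpa [mul_inv_eq_one] using this

variable (hA : MulAut.conj.range ≤ A) (hy : y ≠ 1)
  (hx : ∀ (f : Fin k → T) (i : Fin k), x f i = if i = 0 then y (f (i - 1)) else f (i - 1))
include hA hy hx

/-- Every nontrivial element of `G_k` has a nontrivial power of one of three kinds. -/
theorem exists_pow_base_or_testable {a : MulAut (Fin k → T)}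
    (ha : a ∈ (MulAut.conj : (Fin k → T) →* MulAut (Fin k → T)).range ⊔ Subgroup.zpowers x)
    (ha1 : a ≠ 1) : ∃ n : ℕ, a ^ n ≠ 1 ∧
      ((∃ α, HasCoord y (a ^ n) 0 α ∧ ∀ l, α l ∈ A) ∨
        ∀ i, Testable y x A 2 (a ^ n) i ∨ HalfShift y A (a ^ n)) := by
  obtain ⟨j, α, hα, hαA⟩ := exists_hasCoord hx hA ha
  by_cases hj : (k : ℤ) ∣ j
  · obtain ⟨q, rfl⟩ := hj
    refine ⟨1, by rwa [pow_one], Or.inl ⟨_, ?_, fun l => mul_mem (hαA l) (zpow_mem hyA q)⟩⟩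
    rw [pow_one]
    exact (hα.sub_mul q).congr (sub_self _) fun _ => rfl
  by_cases h2j : (k : ℤ) ∣ 2 * j
  · by_cases haa : a * a = 1
    · exact ⟨1, by rwa [pow_one], Or.inr fun i => Or.inr (by
        rw [pow_one]
        exact halfShift_of_mul_self_eq_one hyA hα hαA hj h2j haa)⟩
    · obtain ⟨q, hq⟩ := h2j
      refine ⟨2, by rwa [pow_two], Or.inl ⟨_, ?_, fun l =>
        mul_mem (mul_mem (hαA l) (hαA (l - j))) (zpow_mem hyA q)⟩⟩
      rw [pow_two]
      exact ((hα.mul hα).sub_mul q).congr (by linarith) fun _ => rfl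
  · refine ⟨1, by rwa [pow_one], Or.inr fun i => Or.inl ?_⟩
    rw [pow_one]
    refine ⟨j, _, fun _ => h2j, isTester_of_shift hx ?_ hα, fun l => ?_, ?_⟩
    · rintro rfl
      exact hj (dvd_zero _)
    · simpa using mul_mem (mul_mem (hαA l) hyA) (inv_mem (hαA l))
    · simpa using hy

end

section

variable {x : MulAut (Fin k → T)} {A : Subgroup (MulAut T)}
  {Gk : Subgroup (MulAut (Fin k → T))}
  (hcommon : ∀ a ∈ Gk, ∀ b ∈ Gk, ∀ i, (Testable y x A 2 a i ∨ HalfShift y A a) →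
    (Testable y x A 2 b i ∨ HalfShift y A b) → ∃ g, Gen x a g ∧ Gen x b g)
include hcommon

theorem exists_gen_of_base {a b : MulAut (Fin k → T)} (ha : a ∈ Gk) (hb : b ∈ Gk)
    (ha1 : a ≠ 1) (hb1 : b ≠ 1) {α β : ℤ → MulAut T}
    (hα : HasCoord y a 0 α) (hαA : ∀ l, α l ∈ A) (hβ : HasCoord y b 0 β) (hβA : ∀ l, β l ∈ A) :
    ∃ g, Gen x a g ∧ Gen x b g := by
  by_cases h : ∃ i, α i ≠ 1 ∧ β i ≠ 1
  · obtain ⟨i, h1, h2⟩ := h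
    exact hcommon a ha b hb i (Or.inl (testable_of_base x hα hαA h1))
      (Or.inl (testable_of_base x hβ hβA h2))
  · push Not at h
    obtain ⟨i, hi⟩ := hα.exists_ne_one ha1
    obtain ⟨i', hi'⟩ := hβ.exists_ne_one hb1
    have h1 := testable_of_base x hα hαA hi
    have h2 := testable_of_base x hβ hβA hi'
    obtain ⟨ga, hga, -⟩ := hcommon a ha a ha i (Or.inl h1) (Or.inl h1)
    obtain ⟨gb, hgb, -⟩ := hcommon b hb b hb i' (Or.inl h2) (Or.inl h2)
    classical
    obtain ⟨g, hg⟩ := exists_coord_eq (y := y) (k := k)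
      (F := fun l => if α l = 1 then coord y k l gb else coord y k l ga) (by
        intro l
        have hl : α (l + k) = 1 ↔ α l = 1 := by
          rw [hα.add_period, mul_assoc, inv_mul_eq_one, eq_comm, mul_eq_right]
        simp only [hl, coord_add]
        split_ifs <;> rfl)
    refine ⟨g, ?_, ?_⟩
    · have : (MulAut.conj g)⁻¹ * a * MulAut.conj g = (MulAut.conj ga)⁻¹ * a * MulAut.conj ga := by
        refine ((hα.conj_inv_mul g).congr rfl fun l => ?_).ext (hα.conj_inv_mul ga)
        rw [sub_zero, hg]
        split_ifs with h0
        · simp [h0]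
        · rfl
      rwa [Gen, this]
    · have : (MulAut.conj g)⁻¹ * b * MulAut.conj g = (MulAut.conj gb)⁻¹ * b * MulAut.conj gb := by
        refine ((hβ.conj_inv_mul g).congr rfl fun l => ?_).ext (hβ.conj_inv_mul gb)
        rw [sub_zero, hg]
        split_ifs with h0
        · rfl
        · simp [h l h0]
      rwa [Gen, this]

theorem exists_gen_of_ne_one
    (hx : ∀ (f : Fin k → T) (i : Fin k), x f i = if i = 0 then y (f (i - 1)) else f (i - 1))
    (hA : MulAut.conj.range ≤ A) (hyA : y ∈ A) (hy : y ≠ 1)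
    (hGk : Gk = MulAut.conj.range ⊔ Subgroup.zpowers x) {a b : MulAut (Fin k → T)} (ha : a ∈ Gk)
    (hb : b ∈ Gk) (ha1 : a ≠ 1) (hb1 : b ≠ 1) : ∃ g, Gen x a g ∧ Gen x b g := by
  obtain ⟨m, hm1, hm⟩ := exists_pow_base_or_testable hyA hA hy hx (hGk ▸ ha) ha1
  obtain ⟨n, hn1, hn⟩ := exists_pow_base_or_testable hyA hA hy hx (hGk ▸ hb) hb1
  suffices h : ∃ g, Gen x (a ^ m) g ∧ Gen x (b ^ n) g by
    obtain ⟨g, h1, h2⟩ := h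
    exact ⟨g, h1.of_pow (hGk ▸ ha), h2.of_pow (hGk ▸ hb)⟩
  have hma := pow_mem ha m
  have hnb := pow_mem hb n
  rcases hm with ⟨α, hα, hαA⟩ | hm <;> rcases hn with ⟨β, hβ, hβA⟩ | hn
  · exact exists_gen_of_base hcommon hma hnb hm1 hn1 hα hαA hβ hβA
  · obtain ⟨i, hi⟩ := hα.exists_ne_one hm1
    exact hcommon _ hma _ hnb i (Or.inl (testable_of_base x hα hαA hi)) (hn i)
  · obtain ⟨i, hi⟩ := hβ.exists_ne_one hn1
    exact hcommon _ hma _ hnb i (hm i) (Or.inl (testable_of_base x hβ hβA hi))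
  · exact hcommon _ hma _ hnb 0 (hm 0) (hn 0)

end

end Reduction

/-- Let `T` be a nonabelian finite simple group, `y ∈ Aut(T)`,
`A = ⟨Inn(T), y⟩ ≤ Aut(T)` with `A ≇ Sym₆`, and suppose `y` satisfies the
conditions (I), (II), (III) below. Let `N = T^k` (identified with
`Inn(N) ≤ Aut(N)`), let `x ∈ Aut(N)` be given by
`x(t₁, …, t_k) = (y(t_k), t₁, …, t_{k-1})` and let `G_k = ⟨N, x⟩ ≤ Aut(N)`.
Then the conjugacy class of `x` in `G_k` witnesses `u(G_k) ≥ 2`. -/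
theorem reduction_theorem (T : Type*) [Group T] [Finite T] [IsSimpleGroup T]
    (hT : ¬ ∀ a b : T, a * b = b * a)
    (k : ℕ) [NeZero k] (y : MulAut T)
    (A : Subgroup (MulAut T))
    (hA : A = (MulAut.conj : T →* MulAut T).range ⊔ Subgroup.zpowers y)
    (hAnotS6 : ¬ Nonempty (↥A ≃* Equiv.Perm (Fin 6)))
    -- (I): for all nontrivial `r, s ∈ A` there is `z ∈ A` with
    -- `A = ⟨z⁻¹rz, y⟩ = ⟨z⁻¹sz, y⟩`
    (hI : ∀ r s : MulAut T, r ∈ A → s ∈ A → r ≠ 1 → s ≠ 1 →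
      ∃ z ∈ A, Subgroup.closure {z⁻¹ * r * z, y} = A ∧
        Subgroup.closure {z⁻¹ * s * z, y} = A)
    -- (II): `⟨y⟩ ∩ T ≠ 1`
    (hII : Subgroup.zpowers y ⊓ (MulAut.conj : T →* MulAut T).range ≠ ⊥)
    -- (III): if `y` is a square in `Aut(T)`, then either `|⟨y⟩ ∩ T|` does not
    -- divide `4`, or `A = Inn(T) ≅ Alt₆` and `y` has order `4`
    (hIII : (∃ w : MulAut T, y = w ^ 2) →
      (¬ (Nat.card ↥(Subgroup.zpowers y ⊓ (MulAut.conj : T →* MulAut T).range) ∣ 4) ∨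
        (A = (MulAut.conj : T →* MulAut T).range ∧
          Nonempty (T ≃* ↥(alternatingGroup (Fin 6))) ∧ orderOf y = 4)))
    (x : MulAut (Fin k → T))
    (hx : ∀ (f : Fin k → T) (i : Fin k),
      x f i = if i = 0 then y (f (i - 1)) else f (i - 1))
    (Gk : Subgroup (MulAut (Fin k → T)))
    (hGk : Gk = (MulAut.conj : (Fin k → T) →* MulAut (Fin k → T)).range ⊔
      Subgroup.zpowers x) :
    ∀ a b : MulAut (Fin k → T), a ∈ Gk → b ∈ Gk → a ≠ 1 → b ≠ 1 →
      ∃ g ∈ Gk, Subgroup.closure {a, g⁻¹ * x * g} = Gk ∧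
        Subgroup.closure {b, g⁻¹ * x * g} = Gk := by
  intro a b ha hb ha1 hb1
  have hyA : y ∈ A := hA ▸ Subgroup.mem_sup_right (Subgroup.mem_zpowers y)
  have hTA : MulAut.conj.range ≤ A := hA ▸ le_sup_left
  have hU := uniformlyGenerated_of_mem hA hI
  have hy1 : y ≠ 1 := by
    rintro rfl
    simp at hII
  have hcommon : ∀ a ∈ Gk, ∀ b ∈ Gk, ∀ i, (Testable y x A 2 a i ∨ HalfShift y A a) →
      (Testable y x A 2 b i ∨ HalfShift y A b) → ∃ g, Gen x a g ∧ Gen x b g := by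
    intro a ha b hb i hai hbi
    rw [hGk] at ha hb
    have hgen : ∀ v : T, v ≠ 1 → MulAut.conj v ∈ Subgroup.zpowers y →
        ((∀ w, y ≠ w ^ 2) ∨ MulAut.conj v ^ 4 ≠ 1) → ∃ g, Gen x a g ∧ Gen x b g := by
      intro v hv hvy hne
      exact exists_gen_of_testable hT hx hTA hv hvy hU (by tauto) ha hb
        (hai.elim Testable.of_two fun h => h.testable hx hyA hy1 i)
        (hbi.elim Testable.of_two fun h => h.testable hx hyA hy1 i)
    have : IsCyclic ↥(Subgroup.zpowers y ⊓ (MulAut.conj : T →* MulAut T).range) :=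
      isCyclic_of_injective (Subgroup.inclusion inf_le_left) (Subgroup.inclusion_injective _)
    obtain ⟨⟨V, hVy, v, rfl⟩, hV⟩ := this.exists_generator
    have hcard : orderOf (MulAut.conj v) =
        Nat.card ↥(Subgroup.zpowers y ⊓ (MulAut.conj : T →* MulAut T).range) :=
      (orderOf_injective _ (Subgroup.subtype_injective _) _).trans
        (orderOf_eq_card_of_forall_mem_zpowers hV)
    have hv : v ≠ 1 := by
      rintro rfl
      rw [map_one, orderOf_one] at hcard
      exact hII (Subgroup.card_eq_one.1 hcard.symm)
    by_cases hsq : ∃ w, y = w ^ 2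
    · rcases hIII hsq with h4 | ⟨hA', ⟨f⟩, hy⟩
      · exact hgen v hv hVy (Or.inr fun h => h4 (hcard ▸ orderOf_dvd_of_pow_eq_one h))
      · obtain ⟨v', hv'⟩ := hA' ▸ hyA
        refine exists_gen_of_alternating hT hA' hv' hy ?_ hx hU f ha hb hai hbi
        rintro rfl
        exact hy1 (by rw [← hv', map_one])
    · exact hgen v hv hVy (Or.inl fun w hw => hsq ⟨w, hw⟩)
  obtain ⟨g, h1, h2⟩ := exists_gen_of_ne_one hcommon hx hTA hyA hy1 hGk ha hb ha1 hb1
  have hg : MulAut.conj g ∈ Gk := hGk ▸ Subgroup.mem_sup_left ⟨g, rfl⟩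
  refine ⟨(MulAut.conj g)⁻¹, inv_mem hg, ?_, ?_⟩
  · rw [inv_inv]
    exact closure_conj_eq hg (h1.trans hGk.symm)
  · rw [inv_inv]
    exact closure_conj_eq hg (h2.trans hGk.symm)
end
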